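/- arXiv:2409.07317 — 2 statements merged into one kernel-verified Lean document; each statement's English description precedes it below -/
import Mathlib

section
/- (Macdonald identity, type BC_l^{(2)}.) Let R' be a finite root system of type C_l (l ≥ 1) spanning a real vector space with positive definite symmetric bilinear form I, normalized so that the short roots of R' have squared length 2; let (R')^+ be its positive roots, ρ' its Weyl vector, Q((R')^∨) its coroot lattice, and d_{C_l}(λ) = ∏_{α ∈ (R')^+} I(λ + ρ', α)/I(ρ', α). Then for every real q with 0 < q < 1, ( η(q^{1/2})^2 · η(q)^{2l−3} · η(q^2)^2 )^l = Σ_{γ ∈ (2l+1)·Q((R')^∨)} d_{C_l}(γ) · q^{I(ρ' + γ, ρ' + γ)/(2(2l+1))}, and the series on the right-hand side converges absolutely. -/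
open scoped BigOperators Classical

/-- The standard inner product on `Fin n → ℝ`. -/
noncomputable def ip {n : ℕ} (x y : Fin n → ℝ) : ℝ := ∑ i, x i * y i

/-- The standard orthonormal vectors `ε_i`. -/
noncomputable def eps {n : ℕ} (i : Fin n) : Fin n → ℝ := Pi.single i 1

/-- The positive roots of the root system of type `C_l`:
`ε_i - ε_j, ε_i + ε_j (i < j)` and `2ε_i`, normalized so the short roots
`±ε_i ± ε_j` have squared length `2`. -/
noncomputable def posC (l : ℕ) : Finset (Fin l → ℝ) :=
  ((Finset.univ.filter fun p : Fin l × Fin l => p.1 < p.2).image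
      fun p => eps p.1 - eps p.2) ∪
  ((Finset.univ.filter fun p : Fin l × Fin l => p.1 < p.2).image
      fun p => eps p.1 + eps p.2) ∪
  (Finset.univ.image fun i : Fin l => (2 : ℝ) • eps i)

/-- The full root system of type `C_l`. -/
noncomputable def rootsC (l : ℕ) : Set (Fin l → ℝ) :=
  {v | v ∈ posC l ∨ -v ∈ posC l}

/-- The Weyl vector `ρ'` of `C_l`. -/
noncomputable def rhoC (l : ℕ) : Fin l → ℝ := (2 : ℝ)⁻¹ • ∑ α ∈ posC l, α

/-- The coroot lattice `Q((R')^∨)` of `C_l`. -/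
noncomputable def corootLatC (l : ℕ) : AddSubgroup (Fin l → ℝ) :=
  AddSubgroup.closure {x | ∃ α ∈ rootsC l, x = (2 / ip α α) • α}

/-- `d_{C_l}(λ) = ∏_{α ∈ (R')⁺} I(λ+ρ',α)/I(ρ',α)`. -/
noncomputable def dC (l : ℕ) (lam : Fin l → ℝ) : ℝ :=
  ∏ α ∈ posC l, (ip (lam + rhoC l) α / ip (rhoC l) α)

/-- The Dedekind eta function, `η(q) = q^{1/24} ∏_{n=1}^∞ (1 - qⁿ)`, for real `0 < q < 1`. -/
noncomputable def eta (q : ℝ) : ℝ := q ^ ((1 : ℝ) / 24) * ∏' n : ℕ, (1 - q ^ (n + 1))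

/-- The `q`-Pochhammer symbol `(a; q)_∞ = ∏_{n ≥ 0} (1 - a qⁿ)`. -/
noncomputable def qPoch (a : ℂ) (q : ℝ) : ℂ := ∏' n : ℕ, (1 - a * (q : ℂ) ^ n)

section qPoch

variable {q : ℝ}

lemma summable_norm_mul_pow (hq0 : 0 < q) (hq1 : q < 1) (a : ℂ) :
    Summable fun n : ℕ => ‖-(a * (q : ℂ) ^ n)‖ := by
  simp only [norm_neg, norm_mul, norm_pow, Complex.norm_real, Real.norm_eq_abs, abs_of_pos hq0]
  exact (summable_geometric_of_lt_one hq0.le hq1).mul_left _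

lemma multipliable_qPoch (hq0 : 0 < q) (hq1 : q < 1) (a : ℂ) :
    Multipliable fun n : ℕ => 1 - a * (q : ℂ) ^ n := by
  simpa [sub_eq_add_neg] using
    multipliable_one_add_of_summable (summable_norm_mul_pow hq0 hq1 a)

lemma hasProd_qPoch (hq0 : 0 < q) (hq1 : q < 1) (a : ℂ) :
    HasProd (fun n : ℕ => 1 - a * (q : ℂ) ^ n) (qPoch a q) :=
  (multipliable_qPoch hq0 hq1 a).hasProd

lemma qPoch_eq_one_sub_mul (hq0 : 0 < q) (hq1 : q < 1) (a : ℂ) :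
    qPoch a q = (1 - a) * qPoch (a * q) q := by
  have h := (multipliable_qPoch hq0 hq1 (a * q))
  have h2 := tprod_eq_zero_mul' (f := fun n : ℕ => 1 - a * (q : ℂ) ^ n)
    (by simpa [pow_succ', mul_assoc] using h)
  simpa [qPoch, pow_succ', mul_assoc] using h2

lemma differentiable_qPoch (hq0 : 0 < q) (hq1 : q < 1) : Differentiable ℂ fun a => qPoch a q := by
  have key : HasProdLocallyUniformlyOn (fun (n : ℕ) (a : ℂ) => 1 - a * (q : ℂ) ^ n)
      (fun a => qPoch a q) Set.univ := by
    apply hasProdLocallyUniformlyOn_of_forall_compact isOpen_univ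
    intro K _ hcK
    obtain ⟨B, hB⟩ := hcK.isBounded.exists_norm_le
    simp_rw [sub_eq_add_neg, qPoch]
    refine ((summable_geometric_of_lt_one hq0.le hq1).mul_left B).hasProdUniformlyOn_nat_one_add
      hcK (.of_forall fun n x hx => ?_) (fun _ => by fun_prop)
    simp only [norm_neg, norm_mul, norm_pow, Complex.norm_real, Real.norm_eq_abs, abs_of_pos hq0]
    gcongr
    exact hB x hx
  rw [← differentiableOn_univ]
  exact key.differentiableOn (.of_forall fun _ => by
    simpa [Finset.prod_fn] using DifferentiableOn.finsetProd (fun _ _ => by fun_prop)) isOpen_univ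

lemma qPoch_ne_zero (hq0 : 0 < q) (hq1 : q < 1) {a : ℂ} (ha : ‖a‖ < 1) : qPoch a q ≠ 0 := by
  have := tprod_one_add_ne_zero_of_summable (f := fun n : ℕ => -(a * (q : ℂ) ^ n)) ?_
    (summable_norm_mul_pow hq0 hq1 a)
  · simpa [qPoch, sub_eq_add_neg] using this
  · intro n h
    have h1 : a * (q : ℂ) ^ n = 1 := by linear_combination -h
    have h2 : ‖a * (q : ℂ) ^ n‖ < 1 := by
      rw [norm_mul, norm_pow, Complex.norm_real, Real.norm_eq_abs, abs_of_pos hq0]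
      calc ‖a‖ * q ^ n ≤ ‖a‖ * 1 := by gcongr; exact pow_le_one₀ hq0.le hq1.le
        _ < 1 := by simpa
    rw [h1] at h2
    simp at h2

lemma qPoch_conj (hq0 : 0 < q) (hq1 : q < 1) (a : ℂ) :
    qPoch (starRingEnd ℂ a) q = starRingEnd ℂ (qPoch a q) := by
  refine HasProd.tprod_eq ?_
  simpa [Function.comp_def] using
    (hasProd_qPoch hq0 hq1 a).map (starRingEnd ℂ) Complex.continuous_conj

lemma multipliable_qPoch_real (hq0 : 0 < q) (hq1 : q < 1) (a : ℝ) :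
    Multipliable fun n : ℕ => 1 - a * q ^ n := by
  have := multipliable_one_add_of_summable (f := fun n : ℕ => -(a * q ^ n)) (by
    simpa [abs_mul, abs_of_pos hq0] using
      (summable_geometric_of_lt_one hq0.le hq1).mul_left |a|)
  simpa [sub_eq_add_neg] using this

lemma qPoch_ofReal (hq0 : 0 < q) (hq1 : q < 1) (a : ℝ) :
    qPoch a q = ((∏' n : ℕ, (1 - a * q ^ n) : ℝ) : ℂ) := by
  refine HasProd.tprod_eq ?_
  simpa [Function.comp_def] using
    (multipliable_qPoch_real hq0 hq1 a).hasProd.map Complex.ofRealHom Complex.continuous_ofReal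

lemma qPoch_pow_eq_prod_roots (hq0 : 0 < q) (hq1 : q < 1) (a : ℂ) {h : ℕ} (hh : 0 < h) {ζ : ℂ}
    (hζ : IsPrimitiveRoot ζ h) :
    ∏ k ∈ Finset.range h, qPoch (a * ζ ^ k) q = qPoch (a ^ h) (q ^ h) := by
  symm
  refine HasProd.tprod_eq ?_
  convert hasProd_prod (s := Finset.range h) fun k _ => hasProd_qPoch hq0 hq1 (a * ζ ^ k) using 2
    with n
  have h1 := hζ.pow_sub_pow_eq_prod_sub_mul 1 (a * (q : ℂ) ^ n) hh
  have h2 : Polynomial.nthRootsFinset h (1 : ℂ) = (Finset.range h).image (ζ ^ ·) := by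
    symm
    refine Finset.eq_of_subset_of_card_le ?_ ?_
    · intro x hx
      obtain ⟨k, -, rfl⟩ := Finset.mem_image.mp hx
      rw [Polynomial.mem_nthRootsFinset hh]
      rw [← pow_mul, mul_comm, pow_mul, hζ.pow_eq_one, one_pow]
    · rw [hζ.card_nthRootsFinset, Finset.card_image_of_injOn, Finset.card_range]
      intro i hi j hj hij
      exact hζ.pow_inj (by simpa using hi) (by simpa using hj) hij
  rw [h2, Finset.prod_image] at h1
  · have e : ((q ^ h : ℝ) : ℂ) ^ n = ((q : ℂ) ^ n) ^ h := by push_cast; ring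
    rw [e, ← mul_pow, ← one_pow h, h1, one_pow]
    exact Finset.prod_congr rfl fun k _ => by ring
  · intro i hi j hj hij
    exact hζ.pow_inj (by simpa using hi) (by simpa using hj) hij

lemma qPoch_eq_prod_range (hq0 : 0 < q) (hq1 : q < 1) (a : ℂ) {h : ℕ} (hh : 0 < h) :
    ∏ r ∈ Finset.range h, qPoch (a * (q : ℂ) ^ r) (q ^ h) = qPoch a q := by
  have : NeZero h := ⟨hh.ne'⟩
  have h1 := ((Nat.divModEquiv h).symm.trans (Equiv.refl _)).hasProd_iff.mpr
    (hasProd_qPoch hq0 hq1 a)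
  have h2 := (Equiv.prodComm (Fin h) ℕ).hasProd_iff.mpr h1
  have h3 := h2.prod_fiberwise (g := fun r : Fin h => qPoch (a * (q : ℂ) ^ (r : ℕ)) (q ^ h)) ?_
  · rw [← Fin.prod_univ_eq_prod_range fun r => qPoch (a * (q : ℂ) ^ r) (q ^ h)]
    exact (hasProd_fintype _).unique h3
  · intro r
    convert hasProd_qPoch (pow_pos hq0 h) (pow_lt_one₀ hq0.le hq1 hh.ne') (a * (q : ℂ) ^ (r : ℕ))
      using 2 with n
    simp only [Function.comp_apply, Equiv.trans_apply, Equiv.prodComm_apply, Prod.swap_prod_mk,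
      Nat.divModEquiv_symm_apply, Equiv.refl_apply]
    push_cast
    ring

lemma qPoch_sq (hq0 : 0 < q) (hq1 : q < 1) (a : ℂ) :
    qPoch a q * qPoch (-a) q = qPoch (a ^ 2) (q ^ 2) := by
  symm
  refine HasProd.tprod_eq ?_
  convert (hasProd_qPoch hq0 hq1 a).mul (hasProd_qPoch hq0 hq1 (-a)) using 2 with n
  push_cast
  ring

lemma qPoch_euler (hq0 : 0 < q) (hq1 : q < 1) :
    qPoch (q ^ 2) (q ^ 2) = qPoch (-q) (q ^ 2) * qPoch q (q ^ 2) * qPoch (q ^ 4) (q ^ 4) := by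
  have h2 : q ^ 2 < 1 := pow_lt_one₀ hq0.le hq1 two_ne_zero
  have e1 := qPoch_sq (pow_pos hq0 2) h2 q
  have e2 := qPoch_eq_prod_range (pow_pos hq0 2) h2 (q ^ 2) (h := 2) two_pos
  simp only [Finset.prod_range_succ, Finset.prod_range_zero] at e2
  rw [← e2, mul_comm (qPoch (-q) _), e1]
  push_cast
  ring_nf

end qPoch

section Laurent

lemma summable_zpow_sq_mul_zpow_abs {P B : ℝ} (hP0 : 0 < P) (hP1 : P < 1) (hB : 0 < B) :
    Summable fun m : ℤ => P ^ (m ^ 2) * B ^ |m| := by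
  have hT : 0 < -Real.log P / Real.pi :=
    div_pos (neg_pos.mpr (Real.log_neg hP0 hP1)) Real.pi_pos
  have := summable_pow_mul_jacobiTheta₂_term_bound (Real.log B / (2 * Real.pi)) hT 0
  refine this.congr fun m => ?_
  rw [← Real.rpow_intCast, ← Real.rpow_intCast, Real.rpow_def_of_pos hP0, Real.rpow_def_of_pos hB,
    ← Real.exp_add, pow_zero, one_mul]
  congr 1
  push_cast
  field_simp
  ring

/-- The theta series `∑ P^{m²} z^m`. -/
noncomputable def thetaSeries (P : ℝ) (z : ℂ) : ℂ := ∑' m : ℤ, (P : ℂ) ^ (m ^ 2) * z ^ m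

lemma norm_zpow_le_zpow_abs {z : ℂ} {B : ℝ} (h1 : ‖z‖ ≤ B)
    (h2 : ‖z‖⁻¹ ≤ B) (m : ℤ) : ‖z ^ m‖ ≤ B ^ |m| := by
  rw [norm_zpow]
  rcases le_or_gt 0 m with hm | hm
  · rw [abs_of_nonneg hm]
    lift m to ℕ using hm
    simpa using pow_le_pow_left₀ (norm_nonneg z) h1 m
  · rw [abs_of_neg hm]
    obtain ⟨k, rfl⟩ : ∃ k : ℕ, m = -k := ⟨m.natAbs, by omega⟩
    simpa using pow_le_pow_left₀ (inv_nonneg.mpr (norm_nonneg z)) h2 k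

lemma norm_thetaSeries_term_le {P : ℝ} (hP0 : 0 < P) {z : ℂ} {B : ℝ}
    (h1 : ‖z‖ ≤ B) (h2 : ‖z‖⁻¹ ≤ B) (m : ℤ) :
    ‖(P : ℂ) ^ (m ^ 2) * z ^ m‖ ≤ P ^ (m ^ 2) * B ^ |m| := by
  rw [norm_mul, norm_zpow (P : ℂ), Complex.norm_real, Real.norm_eq_abs, abs_of_pos hP0]
  gcongr
  exact norm_zpow_le_zpow_abs h1 h2 m

lemma summable_norm_thetaSeries {P : ℝ} (hP0 : 0 < P) (hP1 : P < 1) {z : ℂ} (hz : z ≠ 0) :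
    Summable fun m : ℤ => ‖(P : ℂ) ^ (m ^ 2) * z ^ m‖ := by
  have hz' : 0 < ‖z‖ := norm_pos_iff.mpr hz
  have hB : 0 < ‖z‖ + ‖z‖⁻¹ := by positivity
  exact (summable_zpow_sq_mul_zpow_abs hP0 hP1 hB).of_nonneg_of_le (fun _ => norm_nonneg _)
    (norm_thetaSeries_term_le hP0 (by simp) (by simp))

lemma hasSum_thetaSeries {P : ℝ} (hP0 : 0 < P) (hP1 : P < 1) {z : ℂ} (hz : z ≠ 0) :
    HasSum (fun m : ℤ => (P : ℂ) ^ (m ^ 2) * z ^ m) (thetaSeries P z) :=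
  (summable_norm_thetaSeries hP0 hP1 hz).of_norm.hasSum

lemma differentiableOn_thetaSeries {P : ℝ} (hP0 : 0 < P) (hP1 : P < 1) :
    DifferentiableOn ℂ (thetaSeries P) {0}ᶜ := by
  intro z hz
  have hz' : 0 < ‖z‖ := norm_pos_iff.mpr hz
  set U : Set ℂ := {w | ‖z‖ / 2 < ‖w‖ ∧ ‖w‖ < 2 * ‖z‖} with hU
  have hUo : IsOpen U :=
    (isOpen_lt continuous_const continuous_norm).inter (isOpen_lt continuous_norm continuous_const)
  have hzU : z ∈ U := ⟨by linarith, by linarith⟩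
  have hU0 : ∀ w ∈ U, w ≠ 0 := fun w hw => norm_pos_iff.mp (lt_trans (by positivity) hw.1)
  have hB : 0 < 2 * ‖z‖ + (‖z‖ / 2)⁻¹ := by positivity
  have   := Complex.differentiableOn_tsum_of_summable_norm (summable_zpow_sq_mul_zpow_abs hP0 hP1 hB)
    (F := fun (m : ℤ) (w : ℂ) => (P : ℂ) ^ (m ^ 2) * w ^ m) (U := U) ?_ hUo ?_
  · exact (this.differentiableAt (hUo.mem_nhds hzU)).differentiableWithinAt
  · intro m w hw
    exact ((differentiableAt_zpow.mpr (.inl (hU0 w hw))).const_mul _).differentiableWithinAt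
  · intro m w hw
    have hw' : 0 < ‖z‖ / 2 := by positivity
    refine norm_thetaSeries_term_le hP0 ?_ ?_ m
    · linarith [hw.2, inv_pos.mpr hw']
    · linarith [inv_anti₀ hw' hw.1.le]

lemma thetaSeries_sq_mul {P : ℝ} (hP0 : 0 < P) {z : ℂ} (hz : z ≠ 0) :
    thetaSeries P ((P : ℂ) ^ 2 * z) = (P : ℂ)⁻¹ * z⁻¹ * thetaSeries P z := by
  have hP : (P : ℂ) ≠ 0 := by exact_mod_cast hP0.ne'
  rw [thetaSeries, thetaSeries, ← (Equiv.addRight (1 : ℤ)).tsum_eq fun m => (P : ℂ) ^ (m ^ 2) * z ^ m,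
    ← tsum_mul_left]
  refine tsum_congr fun m => ?_
  rw [Equiv.coe_addRight, zpow_add_one₀ hz, add_sq, zpow_add₀ hP, zpow_add₀ hP, mul_zpow,
    ← zpow_natCast (P : ℂ) 2, ← zpow_mul]
  field_simp
  norm_num

lemma circleMap_zero_ne_zero {R : ℝ} (hR : 0 < R) (t : ℝ) : circleMap 0 R t ≠ 0 :=
  circleMap_ne_center hR.ne'

/-- The Laurent coefficients of a function on the punctured plane. -/
noncomputable def laurentCoeff (n : ℤ) (f : ℂ → ℂ) : ℂ := ∮ z in C(0, 1), f z * z ^ (-n - 1)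

variable {f g : ℂ → ℂ}

lemma differentiableOn_mul_zpow (hf : DifferentiableOn ℂ f {0}ᶜ) (n : ℤ) :
    DifferentiableOn ℂ (fun z => f z * z ^ n) {0}ᶜ :=
  hf.mul fun _ hz => (differentiableAt_zpow.mpr (.inl hz)).differentiableWithinAt

lemma circleIntegrable_of_differentiableOn (hf : DifferentiableOn ℂ f {0}ᶜ) {R : ℝ} (hR : 0 < R) :
    CircleIntegrable f 0 R :=
  (hf.continuousOn.mono fun z hz => by
    rintro rfl
    simp only [mem_sphere_iff_norm, sub_zero, norm_zero] at hz
    exact hR.ne hz).circleIntegrable hR.le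

lemma circleIntegral_eq_of_differentiableOn (hf : DifferentiableOn ℂ f {0}ᶜ) {r R : ℝ}
    (hr : 0 < r) (hR : 0 < R) : (∮ z in C(0, R), f z) = ∮ z in C(0, r), f z := by
  wlog h : r ≤ R generalizing r R
  · exact (this hR hr (le_of_not_ge h)).symm
  refine Complex.circleIntegral_eq_of_differentiable_on_annulus_off_countable hr h
    Set.countable_empty (hf.continuousOn.mono ?_) ?_
  · rintro z ⟨-, hz⟩ rfl
    simp [hr] at hz
  · rintro z ⟨⟨-, hz⟩, -⟩
    refine hf.differentiableAt (isOpen_compl_singleton.mem_nhds ?_)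
    rintro rfl
    simp [hr.le] at hz

lemma laurentCoeff_eq (hf : DifferentiableOn ℂ f {0}ᶜ) {R : ℝ} (hR : 0 < R) (n : ℤ) :
    laurentCoeff n f = ∮ z in C(0, R), f z * z ^ (-n - 1) :=
  circleIntegral_eq_of_differentiableOn (differentiableOn_mul_zpow hf _) hR one_pos

lemma laurentCoeff_sum {ι : Type*} (s : Finset ι) (c : ι → ℂ) (F : ι → ℂ → ℂ)
    (hF : ∀ i ∈ s, DifferentiableOn ℂ (F i) {0}ᶜ) (n : ℤ) :
    laurentCoeff n (fun z => ∑ i ∈ s, c i * F i z) = ∑ i ∈ s, c i * laurentCoeff n (F i) := by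
  simp only [laurentCoeff, Finset.sum_mul, mul_assoc]
  rw [circleIntegral.integral_fun_sum]
  · simp only [circleIntegral.integral_const_mul]
  · intro i hi
    exact (circleIntegrable_of_differentiableOn
      ((differentiableOn_mul_zpow (hF i hi) (-n - 1)).const_mul (c i)) one_pos)

lemma laurentCoeff_sub (hf : DifferentiableOn ℂ f {0}ᶜ) (hg : DifferentiableOn ℂ g {0}ᶜ) (n : ℤ) :
    laurentCoeff n (fun z => f z - g z) = laurentCoeff n f - laurentCoeff n g := by
  simp only [laurentCoeff, sub_mul]
  exact circleIntegral.integral_sub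
    (circleIntegrable_of_differentiableOn (differentiableOn_mul_zpow hf _) one_pos)
    (circleIntegrable_of_differentiableOn (differentiableOn_mul_zpow hg _) one_pos)

lemma eq_zero_of_laurentCoeff_eq_zero (hf : DifferentiableOn ℂ f {0}ᶜ)
    (h : ∀ n, laurentCoeff n f = 0) {w : ℂ} (hw : w ≠ 0) : f w = 0 := by
  have hR : 0 < ‖w‖ := norm_pos_iff.mpr hw
  have : Fact (0 < 2 * Real.pi) := ⟨Real.two_pi_pos⟩
  let F : C(AddCircle (2 * Real.pi), ℂ) :=
    ⟨fun t => f (‖w‖ * (AddCircle.toCircle t : ℂ)), by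
      refine hf.continuousOn.comp_continuous
        (continuous_const.mul (continuous_subtype_val.comp AddCircle.continuous_toCircle))
        fun t => ?_
      simp [hw]⟩
  have hF : ∀ t : ℝ, F t = f (circleMap 0 ‖w‖ t) := by
    intro t
    simp only [F, ContinuousMap.coe_mk, circleMap, zero_add, AddCircle.toCircle_apply_mk,
      Circle.coe_exp]
    congr 4
    push_cast
    field_simp
  have hc : ∀ n : ℤ, fourierCoeff F n = 0 := by
    intro n
    have h1 := h n
    rw [laurentCoeff_eq hf hR, circleIntegral] at h1
    rw [fourierCoeff_eq_intervalIntegral F n 0, zero_add]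
    have h2 : ∀ t : ℝ, deriv (circleMap 0 ‖w‖) t • (f (circleMap 0 ‖w‖ t) *
        circleMap 0 ‖w‖ t ^ (-n - 1)) =
        (Complex.I * (‖w‖ : ℂ) ^ (-n)) * (fourier (-n) (t : AddCircle (2 * Real.pi)) • F t) := by
      intro t
      have hw0 : (‖w‖ : ℂ) ≠ 0 := by exact_mod_cast hR.ne'
      have hm := circleMap_zero_ne_zero hR t
      rw [hF, deriv_circleMap, zpow_sub_one₀ hm, fourier_coe_apply, smul_eq_mul, smul_eq_mul]
      have h3 : circleMap 0 ‖w‖ t ^ (-n) = (‖w‖ : ℂ) ^ (-n) *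
          Complex.exp (2 * Real.pi * Complex.I * (-n : ℤ) * t / (2 * Real.pi : ℝ)) := by
        rw [circleMap, zero_add, mul_zpow, ← Complex.exp_int_mul]
        congr 2
        push_cast
        have : (Real.pi : ℂ) ≠ 0 := by exact_mod_cast Real.pi_ne_zero
        field_simp
      rw [h3]
      field_simp
    simp_rw [h2] at h1
    rw [intervalIntegral.integral_const_mul] at h1
    have h4 : (Complex.I * (‖w‖ : ℂ) ^ (-n)) ≠ 0 :=
      mul_ne_zero Complex.I_ne_zero (zpow_ne_zero _ (by exact_mod_cast hR.ne'))
    rw [(mul_eq_zero.mp h1).resolve_left h4, smul_zero]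
  have hs := has_pointwise_sum_fourier_series_of_summable (f := F)
    (by rw [show fourierCoeff F = fun _ => 0 from funext hc]; exact summable_zero)
    ((w.arg : ℝ) : AddCircle (2 * Real.pi))
  simp only [hc, zero_smul] at hs
  have := hs.unique hasSum_zero
  rw [hF] at this
  rwa [circleMap, zero_add, Complex.norm_mul_exp_arg_mul_I] at this

lemma laurentCoeff_of_quasiperiodic (hf : DifferentiableOn ℂ f {0}ᶜ) {q : ℝ} (hq : 0 < q) {c : ℂ}
    {h : ℤ} (hqp : ∀ z ≠ 0, f (q * z) * z ^ h = c * f z) (n : ℤ) :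
    c * laurentCoeff n f = (q : ℂ) ^ (n - h) * laurentCoeff (n - h) f := by
  have hq' : (q : ℂ) ≠ 0 := by exact_mod_cast hq.ne'
  rw [laurentCoeff_eq hf hq (n - h), laurentCoeff, circleIntegral, circleIntegral,
    ← intervalIntegral.integral_const_mul, ← intervalIntegral.integral_const_mul]
  refine intervalIntegral.integral_congr fun t _ => ?_
  have hm := circleMap_zero_ne_zero one_pos t
  have hcm : circleMap 0 q t = q * circleMap 0 1 t := by simp [circleMap]
  simp only [deriv_circleMap, smul_eq_mul]
  rw [hcm, show -(n - h) - 1 = h + (-n - 1) by ring, mul_zpow, zpow_add₀ hm,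
    show n - h = -(h + (-n - 1)) - 1 by ring, zpow_sub_one₀ hq', zpow_neg]
  have := hqp _ hm
  rw [mul_comm (q : ℂ)] at this ⊢
  field_simp
  linear_combination (-1) * this

end Laurent

section JacobiTripleProduct

open Filter Topology

lemma hasSum_pentagonal {x : ℝ} (hx0 : 0 < x) (hx1 : x < 1) :
    HasSum (fun k : ℤ => (-1 : ℝ) ^ k * x ^ pentagonal k) (∏' n : ℕ, (1 - x ^ (n + 1))) := by
  have hprod : ∀ k n : ℕ, 0 ≤ ∏ i ∈ Finset.range (n + 1), (1 - x ^ (k + i + 1)) ∧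
      ∏ i ∈ Finset.range (n + 1), (1 - x ^ (k + i + 1)) ≤ 1 := fun k n =>
    ⟨Finset.prod_nonneg fun i _ => sub_nonneg.mpr (pow_le_one₀ hx0.le hx1.le),
      Finset.prod_le_one (fun i _ => sub_nonneg.mpr (pow_le_one₀ hx0.le hx1.le))
        fun i _ => sub_le_self _ (by positivity)⟩
  have hgeo := summable_geometric_of_lt_one hx0.le hx1
  have hterm : ∀ k n : ℕ, 0 ≤ x ^ ((k + 1) * n) * ∏ i ∈ Finset.range (n + 1), (1 - x ^ (k + i + 1)) ∧
      x ^ ((k + 1) * n) * ∏ i ∈ Finset.range (n + 1), (1 - x ^ (k + i + 1)) ≤ x ^ n := fun k n => by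
    refine ⟨mul_nonneg (by positivity) (hprod k n).1, ?_⟩
    refine (mul_le_of_le_one_right (by positivity) (hprod k n).2).trans ?_
    exact pow_le_pow_of_le_one hx0.le hx1.le (by nlinarith)
  have hsum : ∀ k : ℕ, Summable
      (fun n ↦ x ^ ((k + 1) * n) * ∏ i ∈ Finset.range (n + 1), (1 - x ^ (k + i + 1))) :=
    fun k => hgeo.of_nonneg_of_le (fun n => (hterm k n).1) fun n => (hterm k n).2
  have hpn : ∀ k : ℤ, (k.natAbs : ℕ) ≤ pentagonal k := by
    intro k
    have := two_mul_natCast_pentagonal k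
    zify
    rcases le_or_gt 0 k with h | h
    · rw [abs_of_nonneg h]
      rcases h.eq_or_lt with rfl | h
      · simp
      · nlinarith
    · rw [abs_of_neg h]
      nlinarith
  have hs1 : Summable fun k : ℤ => (-1 : ℝ) ^ k * x ^ pentagonal k := by
    have hb : ∀ k : ℤ, ‖(-1 : ℝ) ^ k * x ^ pentagonal k‖ ≤ x ^ k.natAbs := fun k => by
      rw [norm_mul, norm_zpow, norm_neg, norm_one, one_zpow, one_mul, norm_pow, Real.norm_eq_abs,
        abs_of_pos hx0]
      exact pow_le_pow_of_le_one hx0.le hx1.le (hpn k)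
    refine Summable.of_norm_bounded (g := fun k : ℤ => x ^ k.natAbs) ?_ hb
    exact Summable.of_nat_of_neg (by simpa using hgeo) (by simpa using hgeo)
  have hs2 := (Equiv.neg ℤ).summable_iff.mpr hs1
  have hn1 := hs2.comp_injective (i := fun n : ℕ => (n : ℤ)) Nat.cast_injective
  have hn2 := hs2.comp_injective (i := fun n : ℕ => -((n : ℤ) + 1)) fun a b h => by
    simpa using h
  have heq : ∀ k : ℕ, (-1 : ℝ) ^ k * (x ^ pentagonal (-k) - x ^ pentagonal (k + 1)) =
      (-1 : ℝ) ^ (-(k : ℤ)) * x ^ pentagonal (-(k : ℤ)) +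
        (-1 : ℝ) ^ ((k : ℤ) + 1) * x ^ pentagonal ((k : ℤ) + 1) := fun k => by
    rw [zpow_neg, zpow_add_one₀ (by norm_num), zpow_natCast]
    rcases neg_one_pow_eq_or ℝ k with h | h <;> rw [h] <;> ring
  have hpent := Pentagonal.tprod_one_sub_pow (x := x)
    (tendsto_pow_atTop_nhds_zero_of_lt_one hx0.le hx1) hsum
    (fun k => by
      have := multipliable_qPoch_real hx0 hx1 (x ^ (k + 1))
      refine this.congr fun n => ?_
      rw [← pow_add, add_comm, add_assoc])
    (by
      simp_rw [heq]
      refine Summable.add ?_ ?_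
      · simpa only [Function.comp_def, Equiv.neg_apply] using hn1
      · simpa only [Function.comp_def, Equiv.neg_apply, neg_neg] using hn2)
    (by
      have h1 : ∀ k : ℕ, ∑' (n : ℕ), x ^ ((k + 1) * n) *
          ∏ i ∈ Finset.range (n + 1), (1 - x ^ (k + i + 1)) ≤ ∑' n : ℕ, x ^ n := fun k =>
        (hsum k).tsum_le_tsum (fun n => (hterm k n).2) hgeo
      have h0 : ∀ k : ℕ, 0 ≤ ∑' (n : ℕ), x ^ ((k + 1) * n) *
          ∏ i ∈ Finset.range (n + 1), (1 - x ^ (k + i + 1)) := fun k =>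
        tsum_nonneg fun n => (hterm k n).1
      have h2 : Tendsto (fun k : ℕ => x ^ k * ∑' n : ℕ, x ^ n) atTop (𝓝 0) := by
        simpa using (tendsto_pow_atTop_nhds_zero_of_lt_one hx0.le hx1).mul_const (∑' n : ℕ, x ^ n)
      refine squeeze_zero_norm (fun k => ?_) h2
      rw [norm_mul, norm_mul, norm_pow, norm_neg, norm_one, one_pow, one_mul, norm_pow,
        Real.norm_eq_abs, abs_of_pos hx0, Real.norm_eq_abs, abs_of_nonneg (h0 k)]
      refine mul_le_mul (pow_le_pow_of_le_one hx0.le hx1.le ?_) (h1 k) (h0 k) (by positivity)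
      rw [Nat.le_div_iff_mul_le two_pos]
      nlinarith)
  rw [hpent]
  have h3 := hn1.hasSum.of_nat_of_neg_add_one hn2.hasSum
  have h4 := (Equiv.neg ℤ).hasSum_iff.mp h3
  rw [← hn1.tsum_add hn2] at h4
  simp only [Function.comp_apply, Equiv.neg_apply, neg_neg] at h4
  simp_rw [heq]
  exact h4

lemma eq_zero_of_quasiperiodic_one {f : ℂ → ℂ} (hf : DifferentiableOn ℂ f {0}ᶜ) {q : ℝ}
    (hq : 0 < q) {c : ℂ} (hc : c ≠ 0) (hqp : ∀ z ≠ 0, f (q * z) * z = c * f z)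
    (h0 : laurentCoeff 0 f = 0) {z : ℂ} (hz : z ≠ 0) : f z = 0 := by
  have hq' : (q : ℂ) ≠ 0 := by exact_mod_cast hq.ne'
  have key := laurentCoeff_of_quasiperiodic hf hq (h := 1) (by simpa using hqp)
  refine eq_zero_of_laurentCoeff_eq_zero hf (fun n => ?_) hz
  induction n using Int.induction_on with
  | zero => exact h0
  | succ n ih =>
    have := key (n + 1)
    rw [add_sub_cancel_right, ih, mul_zero] at this
    exact (mul_eq_zero.mp this).resolve_left hc
  | pred n ih =>
    have := key (-n)
    rw [ih, mul_zero] at this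
    exact (mul_eq_zero.mp this.symm).resolve_left (zpow_ne_zero _ hq')

lemma norm_ofReal_lt_one {a : ℝ} (h0 : 0 < a) (h1 : a < 1) : ‖(a : ℂ)‖ < 1 := by
  rwa [Complex.norm_real, Real.norm_eq_abs, abs_of_pos h0]

lemma thetaSeries_pentagonal {s : ℝ} (hs0 : 0 < s) (hs1 : s < 1) :
    thetaSeries (s ^ 3) (-(s : ℂ)⁻¹) = qPoch ((s : ℂ) ^ 2) (s ^ 2) := by
  have hs : (s : ℂ) ≠ 0 := by exact_mod_cast hs0.ne'
  have h2 : s ^ 2 < 1 := pow_lt_one₀ hs0.le hs1 two_ne_zero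
  have h := (hasSum_pentagonal (pow_pos hs0 2) h2).map Complex.ofRealHom Complex.continuous_ofReal
  have h3 := qPoch_ofReal (pow_pos hs0 2) h2 (s ^ 2)
  push_cast at h3
  rw [h3, thetaSeries]
  refine HasSum.tsum_eq ?_
  convert h using 1
  · ext m
    have := two_mul_natCast_pentagonal m
    simp only [Function.comp_apply, Complex.ofRealHom_eq_coe]
    push_cast
    rw [neg_eq_neg_one_mul, mul_zpow, ← pow_mul, ← zpow_natCast (s : ℂ) (2 * _)]
    push_cast
    rw [this, inv_zpow', mul_left_comm, ← zpow_natCast (s : ℂ) 3, ← zpow_mul, ← zpow_add₀ hs]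
    congr 2
    push_cast
    ring
  · simp only [Complex.ofRealHom_eq_coe, pow_succ']

/-- The Jacobi triple product identity. -/
theorem thetaSeries_eq_prod {P : ℝ} (hP0 : 0 < P) (hP1 : P < 1) {z : ℂ} (hz : z ≠ 0) :
    thetaSeries P z = qPoch ((P : ℂ) ^ 2) (P ^ 2) * qPoch (-(P * z)) (P ^ 2) *
      qPoch (-(P * z⁻¹)) (P ^ 2) := by
  have hP : (P : ℂ) ≠ 0 := by exact_mod_cast hP0.ne'
  have hQ0 := pow_pos hP0 2
  have hQ1 : P ^ 2 < 1 := pow_lt_one₀ hP0.le hP1 two_ne_zero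
  set K : ℂ → ℂ := fun z => qPoch (-(P * z)) (P ^ 2) * qPoch (-(P * z⁻¹)) (P ^ 2) with hK
  have hKd : DifferentiableOn ℂ K {0}ᶜ := by
    intro w hw
    refine (DifferentiableAt.mul ?_ ?_).differentiableWithinAt
    · exact (differentiable_qPoch hQ0 hQ1 _).comp w (by fun_prop)
    · exact (differentiable_qPoch hQ0 hQ1 _).comp w
        (((differentiableAt_inv hw).const_mul _).neg)
  have hKq : ∀ w ≠ 0, K ((P ^ 2 : ℝ) * w) * w = (P : ℂ)⁻¹ * K w := by
    intro w hw
    simp only [hK]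
    rw [qPoch_eq_one_sub_mul hQ0 hQ1 (-(P * w)),
      qPoch_eq_one_sub_mul hQ0 hQ1 (-((P : ℂ) * (((P ^ 2 : ℝ) : ℂ) * w)⁻¹))]
    have e1 : -((P : ℂ) * (((P ^ 2 : ℝ) : ℂ) * w)⁻¹) * ((P ^ 2 : ℝ) : ℂ) = -(P * w⁻¹) := by
      push_cast
      field_simp
    have e2 : -((P : ℂ) * w) * ((P ^ 2 : ℝ) : ℂ) = -(P * ((P ^ 2 : ℝ) * w)) := by ring
    rw [e1, e2]
    generalize qPoch (-((P : ℂ) * w⁻¹)) (P ^ 2) = A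
    generalize qPoch (-((P : ℂ) * (((P ^ 2 : ℝ) : ℂ) * w))) (P ^ 2) = B
    push_cast
    field_simp
    ring
  have hTq : ∀ w ≠ 0, thetaSeries P ((P ^ 2 : ℝ) * w) * w = (P : ℂ)⁻¹ * thetaSeries P w := by
    intro w hw
    push_cast
    rw [thetaSeries_sq_mul hP0 hw]
    field_simp
  have hTd := differentiableOn_thetaSeries hP0 hP1
  obtain ⟨s, hs0, hsP⟩ : ∃ s : ℝ, 0 < s ∧ s ^ 3 = P :=
    ⟨P ^ ((1 : ℝ) / 3), by positivity, by
      rw [← Real.rpow_natCast, ← Real.rpow_mul hP0.le]; norm_num⟩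
  have hs1 : s < 1 := by
    by_contra! h
    have := one_le_pow₀ h (n := 3)
    linarith
  have hs : (s : ℂ) ≠ 0 := by exact_mod_cast hs0.ne'
  have hs' : -(s : ℂ)⁻¹ ≠ 0 := neg_ne_zero.mpr (inv_ne_zero hs)
  have hPs : (P : ℂ) = (s : ℂ) ^ 3 := by rw [← hsP]; push_cast; rfl
  have hK1 : K (-(s : ℂ)⁻¹) = qPoch ((s : ℂ) ^ 2) (P ^ 2) * qPoch ((s : ℂ) ^ 4) (P ^ 2) := by
    simp only [hK]
    congr 2
    · rw [hPs]; field_simp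
    · rw [hPs, inv_neg, inv_inv]; ring
  have hs2 : s ^ 2 < 1 := pow_lt_one₀ hs0.le hs1 two_ne_zero
  have hs4 : s ^ 4 < 1 := pow_lt_one₀ hs0.le hs1 (by norm_num)
  have hK0 : K (-(s : ℂ)⁻¹) ≠ 0 := by
    rw [hK1]
    refine mul_ne_zero (qPoch_ne_zero hQ0 hQ1 ?_) (qPoch_ne_zero hQ0 hQ1 ?_)
    · exact_mod_cast norm_ofReal_lt_one (by positivity) hs2
    · exact_mod_cast norm_ofReal_lt_one (by positivity) hs4
  have hb : laurentCoeff 0 K ≠ 0 := fun h =>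
    hK0 (eq_zero_of_quasiperiodic_one hKd hQ0 (inv_ne_zero hP) hKq h hs')
  set a := laurentCoeff 0 (thetaSeries P)
  set b := laurentCoeff 0 K
  have hcoef : laurentCoeff 0 (fun w => b * thetaSeries P w - a * K w) = 0 := by
    rw [laurentCoeff_sub (hTd.const_mul b) (hKd.const_mul a)]
    have h1 := laurentCoeff_sum {()} (fun _ => b) (fun _ => thetaSeries P) (fun _ _ => hTd) 0
    have h2 := laurentCoeff_sum {()} (fun _ => a) (fun _ => K) (fun _ _ => hKd) 0
    simp only [Finset.sum_singleton] at h1 h2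
    rw [h1, h2]
    exact sub_eq_zero.mpr (mul_comm b a)
  have hprop : ∀ w ≠ 0, b * thetaSeries P w - a * K w = 0 := fun w hw =>
    eq_zero_of_quasiperiodic_one ((hTd.const_mul b).sub (hKd.const_mul a)) hQ0 (inv_ne_zero hP)
      (fun w hw => by
        simp only [Pi.sub_apply]
        linear_combination b * hTq w hw - a * hKq w hw) hcoef hw
  have hC : b * qPoch ((P : ℂ) ^ 2) (P ^ 2) = a := by
    have h1 := hprop _ hs'
    have h2 := thetaSeries_pentagonal hs0 hs1
    have h3 := qPoch_eq_prod_range (pow_pos hs0 2) hs2 ((s : ℂ) ^ 2) (h := 3) (by norm_num)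
    have h4 : (s ^ 2) ^ 3 = P ^ 2 := by rw [← hsP]; ring
    have h5 : (s : ℂ) ^ 2 * ((s ^ 2 : ℝ) : ℂ) ^ 1 = (s : ℂ) ^ 4 := by push_cast; ring
    have h6 : (s : ℂ) ^ 2 * ((s ^ 2 : ℝ) : ℂ) ^ 2 = (P : ℂ) ^ 2 := by rw [hPs]; push_cast; ring
    simp only [Finset.prod_range_succ, Finset.prod_range_zero, h4, h5, h6, pow_zero, mul_one,
      one_mul] at h3
    rw [hsP] at h2
    rw [h2, ← h3, ← hK1] at h1
    refine mul_right_cancel₀ hK0 ?_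
    linear_combination h1
  refine mul_left_cancel₀ hb ?_
  have := hprop z hz
  rw [← hC] at this
  simp only [hK] at this
  linear_combination this

end JacobiTripleProduct

section SymplecticDeterminant

open Polynomial in
lemma natDegree_S_and_monic (n : ℕ) :
    (Chebyshev.S ℂ n).natDegree = n ∧ (Chebyshev.S ℂ n).Monic := by
  induction n using Nat.twoStepInduction with
  | zero => simp
  | one => simp [monic_X]
  | more n h1 h2 =>
    have hrec : Chebyshev.S ℂ ((n + 2 : ℕ) : ℤ) =
        X * Chebyshev.S ℂ ((n + 1 : ℕ) : ℤ) - Chebyshev.S ℂ (n : ℤ) := by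
      have := Chebyshev.S_add_two ℂ (n : ℤ)
      push_cast
      exact this
    have hm : (X * Chebyshev.S ℂ ((n + 1 : ℕ) : ℤ)).Monic := monic_X.mul h2.2
    have hd : (X * Chebyshev.S ℂ ((n + 1 : ℕ) : ℤ)).natDegree = n + 2 := by
      rw [monic_X.natDegree_mul h2.2, natDegree_X, h2.1]; ring
    have hlt : (Chebyshev.S ℂ (n : ℤ)).degree < (X * Chebyshev.S ℂ ((n + 1 : ℕ) : ℤ)).degree := by
      refine degree_lt_degree ?_
      rw [hd, h1.1]; omega
    rw [hrec]
    refine ⟨?_, hm.sub_of_left hlt⟩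
    rw [natDegree_sub_eq_left_of_natDegree_lt (by rw [hd, h1.1]; omega), hd]

lemma pow_succ_sub_inv_pow_succ {x : ℂ} (hx : x ≠ 0) (n : ℕ) :
    x ^ (n + 1) - x⁻¹ ^ (n + 1) = (x - x⁻¹) * (Polynomial.Chebyshev.S ℂ n).eval (x + x⁻¹) := by
  induction n using Nat.twoStepInduction with
  | zero => simp
  | one => simp; ring
  | more n h1 h2 =>
    have := Polynomial.Chebyshev.S_add_two ℂ (n : ℤ)
    push_cast at h2 ⊢
    rw [this, Polynomial.eval_sub, Polynomial.eval_mul, Polynomial.eval_X, mul_sub,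
      mul_left_comm, ← h2, ← h1]
    have hxx : x * x⁻¹ = 1 := mul_inv_cancel₀ hx
    generalize x⁻¹ = y at hxx ⊢
    linear_combination (y ^ (n + 1) - x ^ (n + 1)) * hxx

lemma det_pow_succ_sub_inv_pow_succ {n : ℕ} {x : Fin n → ℂ} (hx : ∀ i, x i ≠ 0) :
    (Matrix.of fun i j : Fin n => x i ^ ((j : ℕ) + 1) - (x i)⁻¹ ^ ((j : ℕ) + 1)).det =
      (∏ i, (x i - (x i)⁻¹)) *
        ∏ i, ∏ j ∈ Finset.Ioi i, ((x j + (x j)⁻¹) - (x i + (x i)⁻¹)) := by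
  have h := Matrix.det_eval_matrixOfPolynomials_eq_det_vandermonde (fun i => x i + (x i)⁻¹)
    (fun j : Fin n => Polynomial.Chebyshev.S ℂ (j : ℕ)) (fun j => (natDegree_S_and_monic j).1)
    (fun j => (natDegree_S_and_monic j).2)
  rw [Matrix.det_vandermonde] at h
  rw [h, ← Matrix.det_mul_column]
  congr 1
  ext i j
  simp only [Matrix.of_apply, pow_succ_sub_inv_pow_succ (hx i)]

end SymplecticDeterminant

section Interpolation

/-- Holomorphic functions on the punctured plane that are odd under inversion and
quasi-periodic of degree `2l + 1` under multiplication by `p²`. -/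
structure QuasiOdd (p : ℝ) (l : ℕ) (f : ℂ → ℂ) : Prop where
  diff : DifferentiableOn ℂ f {0}ᶜ
  quasi : ∀ z ≠ 0, f ((p ^ 2 : ℝ) * z) * z ^ (2 * l + 1) = ((p : ℂ) ^ (2 * l + 1))⁻¹ * f z
  odd : ∀ z ≠ 0, f z⁻¹ = -f z

variable {p : ℝ} {l : ℕ} {f g : ℂ → ℂ}

lemma laurentCoeff_neg_of_odd (hodd : ∀ z ≠ 0, f z⁻¹ = -f z) (n : ℤ) :
    laurentCoeff (-n) f = -laurentCoeff n f := by
  have key : ∀ m : ℤ, laurentCoeff m f =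
      ∫ t in (0 : ℝ)..2 * Real.pi, Complex.I * (f (circleMap 0 1 t) * circleMap 0 1 t ^ (-m)) := by
    intro m
    refine intervalIntegral.integral_congr fun t _ => ?_
    have hm := circleMap_zero_ne_zero one_pos t
    simp only [deriv_circleMap, smul_eq_mul, zpow_sub_one₀ hm]
    field_simp
  rw [key, key, ← intervalIntegral.integral_neg]
  have h := intervalIntegral.integral_comp_sub_left
    (fun t => Complex.I * (f (circleMap 0 1 t) * circleMap 0 1 t ^ (- -n)))
    (a := 0) (b := 2 * Real.pi) (2 * Real.pi)
  rw [sub_self, sub_zero] at h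
  rw [← h]
  refine intervalIntegral.integral_congr fun t _ => ?_
  have hm := circleMap_zero_ne_zero one_pos t
  have hi : circleMap 0 1 (2 * Real.pi - t) = (circleMap 0 1 t)⁻¹ := by
    simp only [circleMap, zero_add, Complex.ofReal_one, one_mul, ← Complex.exp_neg]
    push_cast
    rw [sub_mul, Complex.exp_sub, Complex.exp_two_pi_mul_I, Complex.exp_neg, one_div]
  simp only [hi, hodd _ hm, neg_neg, inv_zpow', neg_mul, mul_neg]

lemma QuasiOdd.sub_sum {ι : Type*} (s : Finset ι) (c : ι → ℂ) {F : ι → ℂ → ℂ}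
    (hf : QuasiOdd p l f) (hF : ∀ i, QuasiOdd p l (F i)) :
    QuasiOdd p l fun z => f z - ∑ i ∈ s, c i * F i z where
  diff := hf.diff.sub (DifferentiableOn.fun_sum fun i _ => ((hF i).diff.const_mul (c i)))
  quasi z hz := by
    rw [sub_mul, hf.quasi z hz, mul_sub, Finset.sum_mul, Finset.mul_sum]
    congr 1
    exact Finset.sum_congr rfl fun i _ => by linear_combination c i * (hF i).quasi z hz
  odd z hz := by
    simp only [hf.odd z hz, fun i => (hF i).odd z hz, mul_neg, Finset.sum_neg_distrib]
    ring

lemma QuasiOdd.zero : QuasiOdd p l fun _ => 0 := ⟨differentiableOn_const _, by simp, by simp⟩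

lemma QuasiOdd.eq_zero (hp : 0 < p) (hf : QuasiOdd p l f)
    (h : ∀ k : Fin l, laurentCoeff ((k : ℤ) + 1) f = 0) {z : ℂ} (hz : z ≠ 0) : f z = 0 := by
  have hp' : (p : ℂ) ≠ 0 := by exact_mod_cast hp.ne'
  have hc : ((p : ℂ) ^ (2 * l + 1))⁻¹ ≠ 0 := inv_ne_zero (pow_ne_zero _ hp')
  have key := laurentCoeff_of_quasiperiodic hf.diff (pow_pos hp 2) (h := ((2 * l + 1 : ℕ) : ℤ))
    (c := ((p : ℂ) ^ (2 * l + 1))⁻¹) (by simpa only [zpow_natCast] using hf.quasi)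
  have step : ∀ n, laurentCoeff n f = 0 ↔ laurentCoeff (n - (2 * l + 1 : ℕ)) f = 0 := by
    intro n
    have hk := key n
    constructor <;> intro h0
    · rw [h0, mul_zero] at hk
      refine (mul_eq_zero.mp hk.symm).resolve_left (zpow_ne_zero _ ?_)
      push_cast
      exact pow_ne_zero _ hp'
    · rw [h0, mul_zero] at hk
      exact (mul_eq_zero.mp hk).resolve_left hc
  have hneg := laurentCoeff_neg_of_odd hf.odd
  have hz0 : laurentCoeff 0 f = 0 := by
    have := hneg 0
    rw [neg_zero] at this
    linear_combination this / 2
  have hpos : ∀ n : ℕ, n ≤ l → laurentCoeff n f = 0 := by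
    intro n hn
    rcases n with _ | n
    · simpa using hz0
    · simpa using h ⟨n, hn⟩
  have hbase : ∀ r : ℤ, |r| ≤ l → laurentCoeff r f = 0 := by
    intro r hr
    rcases abs_cases r with ⟨h1, h2⟩ | ⟨h1, h2⟩
    · lift r to ℕ using h2
      exact hpos r (by omega)
    · obtain ⟨n, rfl⟩ : ∃ n : ℕ, r = -n := ⟨r.natAbs, by omega⟩
      rw [hneg, hpos n (by omega), neg_zero]
  have hall : ∀ r : ℤ, |r| ≤ l → ∀ m : ℤ, laurentCoeff (r + (2 * l + 1 : ℕ) * m) f = 0 := by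
    intro r hr m
    induction m using Int.induction_on with
    | zero => simpa using hbase r hr
    | succ m ih =>
      rw [step]
      convert ih using 2
      ring
    | pred m ih =>
      rw [step] at ih
      convert ih using 2
      ring
  refine eq_zero_of_laurentCoeff_eq_zero hf.diff (fun n => ?_) hz
  have h1 := Int.emod_add_mul_ediv (n + l) (2 * l + 1 : ℕ)
  have h2 := Int.emod_nonneg (n + l) (b := (2 * l + 1 : ℕ)) (by positivity)
  have h3 := Int.emod_lt_of_pos (n + l) (b := (2 * l + 1 : ℕ)) (by positivity)
  have := hall ((n + l) % (2 * l + 1 : ℕ) - l) (by rw [abs_le]; push_cast at *; constructor <;> linarith)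
    ((n + l) / (2 * l + 1 : ℕ))
  convert this using 2
  linarith

/-- The basis of theta functions of the space described by `QuasiOdd`. -/
noncomputable def oddTheta (p : ℝ) (l : ℕ) (a : ℕ) (x : ℂ) : ℂ :=
  x ^ a * thetaSeries (p ^ (2 * l + 1)) (p ^ (2 * a) * x ^ (2 * l + 1)) -
    x⁻¹ ^ a * thetaSeries (p ^ (2 * l + 1)) (p ^ (2 * a) * x⁻¹ ^ (2 * l + 1))

lemma quasiOdd_oddTheta (hp0 : 0 < p) (hp1 : p < 1) (a : ℕ) : QuasiOdd p l (oddTheta p l a) := by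
  have hp' : (p : ℂ) ≠ 0 := by exact_mod_cast hp0.ne'
  have hP0 := pow_pos hp0 (2 * l + 1)
  have hP1 : p ^ (2 * l + 1) < 1 := pow_lt_one₀ hp0.le hp1 (by omega)
  set T : ℂ → ℂ := fun x => x ^ a * thetaSeries (p ^ (2 * l + 1)) (p ^ (2 * a) * x ^ (2 * l + 1))
    with hT
  have hTd : DifferentiableOn ℂ T {0}ᶜ := by
    intro z hz
    refine DifferentiableAt.differentiableWithinAt ?_
    refine (by fun_prop : DifferentiableAt ℂ (fun x : ℂ => x ^ a) z).mul ?_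
    refine DifferentiableAt.comp z (((differentiableOn_thetaSeries hP0 hP1).differentiableAt
      (isOpen_compl_singleton.mem_nhds ?_))) (by fun_prop)
    exact mul_ne_zero (pow_ne_zero _ hp') (pow_ne_zero _ hz)
  have hTq : ∀ z ≠ 0, T ((p ^ 2 : ℝ) * z) * z ^ (2 * l + 1) = ((p : ℂ) ^ (2 * l + 1))⁻¹ * T z := by
    intro z hz
    have h1 := thetaSeries_sq_mul hP0 (z := p ^ (2 * a) * z ^ (2 * l + 1))
      (mul_ne_zero (pow_ne_zero _ hp') (pow_ne_zero _ hz))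
    have h2 : (p : ℂ) ^ (2 * a) * (((p ^ 2 : ℝ) : ℂ) * z) ^ (2 * l + 1) =
        ((p ^ (2 * l + 1) : ℝ) : ℂ) ^ 2 * (p ^ (2 * a) * z ^ (2 * l + 1)) := by
      push_cast
      ring
    simp only [hT]
    rw [h2, h1]
    push_cast
    field_simp
    ring
  have hTo : ∀ x, oddTheta p l a x = T x - T x⁻¹ := fun x => rfl
  refine ⟨?_, ?_, ?_⟩
  · refine hTd.sub fun z hz => DifferentiableAt.differentiableWithinAt ?_
    exact (hTd.differentiableAt (isOpen_compl_singleton.mem_nhds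
      (inv_ne_zero hz : z⁻¹ ≠ 0))).comp z (differentiableAt_inv hz)
  · intro z hz
    have hq : ((p ^ 2 : ℝ) : ℂ) ≠ 0 := by push_cast; exact pow_ne_zero _ hp'
    have h3 := hTq (((p ^ 2 : ℝ) : ℂ) * z)⁻¹ (inv_ne_zero (mul_ne_zero hq hz))
    rw [mul_inv, mul_inv_cancel_left₀ hq, ← mul_inv] at h3
    have h4 : T (((p ^ 2 : ℝ) : ℂ) * z)⁻¹ * z ^ (2 * l + 1) =
        ((p : ℂ) ^ (2 * l + 1))⁻¹ * T z⁻¹ := by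
      rw [inv_pow, mul_pow, Complex.ofReal_pow] at h3
      rw [Complex.ofReal_pow]
      generalize T z⁻¹ = V at h3 ⊢
      generalize T (((p : ℂ) ^ 2) * z)⁻¹ = U at h3 ⊢
      field_simp at h3 ⊢
      refine mul_right_cancel₀ (pow_ne_zero (2 * l + 1) hp') ?_
      rw [h3]
      ring
    rw [hTo, hTo, sub_mul, hTq z hz, h4, mul_sub]
  · intro z _
    rw [hTo, hTo, inv_inv]
    ring

end Interpolation

section MultivariateInterpolation

lemma eq_sum_interpolation_of_forall_update {ι : Type*} [Fintype ι] {L : ι → ℂ → ℂ} {y : ι → ℂ}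
    (hy : ∀ k, y k ≠ 0) {V : (ℂ → ℂ) → Prop}
    (hL : ∀ f, V f → ∀ t ≠ 0, f t = ∑ k, L k t * f (y k)) {n : ℕ} (P : (Fin n → ℂ) → ℂ)
    (hP : ∀ x : Fin n → ℂ, (∀ i, x i ≠ 0) → ∀ i, V fun t => P (Function.update x i t))
    (x : Fin n → ℂ) (hx : ∀ i, x i ≠ 0) :
    P x = ∑ k : Fin n → ι, (∏ i, L (k i) (x i)) * P fun i => y (k i) := by
  induction n with
  | zero =>
    simp only [Finset.univ_eq_empty, Finset.prod_empty, one_mul, Fintype.sum_unique]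
    congr 1
    exact Subsingleton.elim _ _
  | succ n ih =>
    have h0 := hL _ (hP x hx 0) (x 0) (hx 0)
    simp only [Function.update_eq_self] at h0
    rw [h0, ← (Fin.consEquiv fun _ => ι).sum_comp, Fintype.sum_prod_type]
    refine Finset.sum_congr rfl fun k _ => ?_
    have hu : Function.update x 0 (y k) = Fin.cons (y k) (Fin.tail x) := by
      rw [← Fin.cons_self_tail x, Fin.update_cons_zero, Fin.tail_cons]
    rw [hu, ih (fun x' => P (Fin.cons (y k) x')) _ (Fin.tail x) (fun i => hx i.succ),
      Finset.mul_sum]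
    · refine Finset.sum_congr rfl fun k' _ => ?_
      have hc : (fun i => y ((Fin.cons k k' : Fin (n + 1) → ι) i)) =
          Fin.cons (y k) fun i => y (k' i) := by
        ext i
        refine Fin.cases ?_ (fun i => ?_) i <;> simp
      simp only [Fin.consEquiv_apply, hc, Fin.prod_univ_succ, Fin.cons_zero, Fin.cons_succ,
        Fin.tail]
      ring
    · intro x' hx' i
      simp only [Fin.cons_update]
      exact hP _ (fun j => Fin.cases (by simpa using hy k) (fun j => by simpa using hx' j) j) _

end MultivariateInterpolation

section OneVariableInterpolation

variable {p : ℝ} {l : ℕ} {f g : ℂ → ℂ}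

lemma oddTheta_of_pow_eq_one {y : ℂ} (hy : y ^ (2 * l + 1) = 1) (a : ℕ) :
    oddTheta p l a y = (y ^ a - y⁻¹ ^ a) * thetaSeries (p ^ (2 * l + 1)) (p ^ (2 * a)) := by
  rw [oddTheta, inv_pow y (2 * l + 1), hy, inv_one, mul_one]
  ring

lemma thetaSeries_eq_prod_pow (hp0 : 0 < p) (hp1 : p < 1) {h a : ℕ} (ha : a ≤ h) (hh : 0 < h) :
    thetaSeries (p ^ h) (p ^ a) = qPoch (p ^ (2 * h)) (p ^ (2 * h)) *
      qPoch (-(p ^ (h + a))) (p ^ (2 * h)) * qPoch (-(p ^ (h - a))) (p ^ (2 * h)) := by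
  have hp' : (p : ℂ) ≠ 0 := by exact_mod_cast hp0.ne'
  have hPP : (p ^ h) ^ 2 = p ^ (2 * h) := by ring
  have e1 : ((p ^ h : ℝ) : ℂ) ^ 2 = (p : ℂ) ^ (2 * h) := by push_cast; ring
  have e2 : ((p ^ h : ℝ) : ℂ) * (p : ℂ) ^ a = (p : ℂ) ^ (h + a) := by push_cast; ring
  have e3 : ((p ^ h : ℝ) : ℂ) * ((p : ℂ) ^ a)⁻¹ = (p : ℂ) ^ (h - a) := by
    rw [pow_sub₀ _ hp' ha]; push_cast; rfl
  rw [thetaSeries_eq_prod (pow_pos hp0 _) (pow_lt_one₀ hp0.le hp1 hh.ne')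
    (pow_ne_zero _ hp'), hPP, e1, e2, e3]

lemma thetaSeries_pow_ne_zero (hp0 : 0 < p) (hp1 : p < 1) {h a : ℕ} (ha : a < h) :
    thetaSeries (p ^ h) (p ^ a) ≠ 0 := by
  have hP0 := pow_pos hp0 (2 * h)
  have hP1 : p ^ (2 * h) < 1 := pow_lt_one₀ hp0.le hp1 (by omega)
  have hn : ∀ b : ℕ, b ≠ 0 → ‖(p : ℂ) ^ b‖ < 1 := fun b hb => by
    exact_mod_cast norm_ofReal_lt_one (pow_pos hp0 b) (pow_lt_one₀ hp0.le hp1 hb)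
  rw [thetaSeries_eq_prod_pow hp0 hp1 ha.le (by omega)]
  refine mul_ne_zero (mul_ne_zero ?_ ?_) ?_ <;> refine qPoch_ne_zero hP0 hP1 ?_
  · exact hn _ (by omega)
  · rw [norm_neg]; exact hn _ (by omega)
  · rw [norm_neg]; exact hn _ (by omega)

/-- The matrix `x_i^{j+1} - x_i^{-(j+1)}`. -/
noncomputable def oddPowMatrix {n l : ℕ} (x : Fin n → ℂ) : Matrix (Fin n) (Fin l) ℂ :=
  Matrix.of fun i j => x i ^ ((j : ℕ) + 1) - (x i)⁻¹ ^ ((j : ℕ) + 1)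

/-- The matrix of the functions `oddTheta p l (j + 1)` at the points `x_i`. -/
noncomputable def oddThetaMatrix (p : ℝ) {l : ℕ} (x : Fin l → ℂ) : Matrix (Fin l) (Fin l) ℂ :=
  Matrix.of fun i j => oddTheta p l ((j : ℕ) + 1) (x i)

/-- The interpolation nodes, powers of a root of unity. -/
def rootNode {l : ℕ} (ω : ℂ) (i : Fin l) : ℂ := ω ^ ((i : ℕ) + 1)

variable {ω : ℂ}

lemma rootNode_ne_zero (hω : IsPrimitiveRoot ω (2 * l + 1)) (i : Fin l) : rootNode ω i ≠ 0 :=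
  pow_ne_zero _ (hω.ne_zero (by omega))

lemma rootNode_pow (hω : IsPrimitiveRoot ω (2 * l + 1)) (i : Fin l) :
    rootNode ω i ^ (2 * l + 1) = 1 := by
  rw [rootNode, ← pow_mul, mul_comm, pow_mul, hω.pow_eq_one, one_pow]

lemma add_inv_sub_add_inv {x y : ℂ} (hx : x ≠ 0) (hy : y ≠ 0) :
    (y + y⁻¹) - (x + x⁻¹) = (y - x) * (x * y - 1) * (x * y)⁻¹ := by
  field_simp
  ring

lemma det_oddPowMatrix_rootNode_ne_zero (hω : IsPrimitiveRoot ω (2 * l + 1)) :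
    (oddPowMatrix (rootNode ω) : Matrix (Fin l) (Fin l) ℂ).det ≠ 0 := by
  have hne : ∀ a : ℕ, 0 < a → a < 2 * l + 1 → ω ^ a - 1 ≠ 0 := fun a ha hal =>
    sub_ne_zero.mpr (hω.pow_ne_one_of_pos_of_lt ha.ne' hal)
  have hω0 : ω ≠ 0 := hω.ne_zero (by omega)
  rw [oddPowMatrix, det_pow_succ_sub_inv_pow_succ (rootNode_ne_zero hω)]
  refine mul_ne_zero (Finset.prod_ne_zero_iff.mpr fun i _ => ?_)
    (Finset.prod_ne_zero_iff.mpr fun i _ => Finset.prod_ne_zero_iff.mpr fun j hj => ?_)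
  · have : rootNode ω i - (rootNode ω i)⁻¹ =
        (ω ^ (2 * ((i : ℕ) + 1)) - 1) * (rootNode ω i)⁻¹ := by
      rw [rootNode]
      field_simp
      ring
    rw [this]
    exact mul_ne_zero (hne _ (by omega) (by omega)) (inv_ne_zero (rootNode_ne_zero hω i))
  · have hij : (i : ℕ) < j := Fin.lt_def.mp (Finset.mem_Ioi.mp hj)
    rw [add_inv_sub_add_inv (rootNode_ne_zero hω i) (rootNode_ne_zero hω j)]
    refine mul_ne_zero (mul_ne_zero ?_ ?_)
      (inv_ne_zero (mul_ne_zero (rootNode_ne_zero hω i) (rootNode_ne_zero hω j)))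
    · have : rootNode ω j - rootNode ω i =
          (ω ^ ((j : ℕ) - i) - 1) * rootNode ω i := by
        rw [rootNode, rootNode, sub_mul, ← pow_add, one_mul]
        congr 2
        omega
      rw [this]
      exact mul_ne_zero (hne _ (by omega) (by omega)) (rootNode_ne_zero hω i)
    · rw [rootNode, rootNode, ← pow_add]
      exact hne _ (by omega) (by omega)

lemma oddThetaMatrix_rootNode (hω : IsPrimitiveRoot ω (2 * l + 1)) :
    oddThetaMatrix p (rootNode ω : Fin l → ℂ) = oddPowMatrix (rootNode ω) *
      Matrix.diagonal fun j : Fin l =>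
        thetaSeries (p ^ (2 * l + 1)) (p ^ (2 * ((j : ℕ) + 1))) := by
  ext i j
  rw [Matrix.mul_diagonal]
  exact oddTheta_of_pow_eq_one (rootNode_pow hω i) _

lemma isUnit_det_oddThetaMatrix_rootNode (hp0 : 0 < p) (hp1 : p < 1)
    (hω : IsPrimitiveRoot ω (2 * l + 1)) :
    IsUnit (oddThetaMatrix p (rootNode ω : Fin l → ℂ)).det := by
  rw [oddThetaMatrix_rootNode hω, Matrix.det_mul, Matrix.det_diagonal, isUnit_iff_ne_zero]
  exact mul_ne_zero (det_oddPowMatrix_rootNode_ne_zero hω)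
    (Finset.prod_ne_zero_iff.mpr fun j _ => thetaSeries_pow_ne_zero hp0 hp1 (by omega))

lemma QuasiOdd.exists_eq_sum (hp0 : 0 < p) (hp1 : p < 1) (hω : IsPrimitiveRoot ω (2 * l + 1))
    (hf : QuasiOdd p l f) :
    ∃ c : Fin l → ℂ, ∀ z ≠ 0, f z = ∑ j, c j * oddTheta p l ((j : ℕ) + 1) z := by
  set A : Matrix (Fin l) (Fin l) ℂ :=
    Matrix.of fun k j => laurentCoeff ((k : ℤ) + 1) (oddTheta p l ((j : ℕ) + 1)) with hA
  have hF : ∀ j : Fin l, QuasiOdd p l (oddTheta p l ((j : ℕ) + 1)) := fun j =>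
    quasiOdd_oddTheta hp0 hp1 _
  have hcoef : ∀ {g : ℂ → ℂ} (_ : QuasiOdd p l g) (c : Fin l → ℂ) (k : Fin l),
      laurentCoeff ((k : ℤ) + 1) (fun z => g z - ∑ j, c j * oddTheta p l ((j : ℕ) + 1) z) =
        laurentCoeff ((k : ℤ) + 1) g - (A.mulVec c) k := by
    intro g hg c k
    rw [laurentCoeff_sub hg.diff (DifferentiableOn.fun_sum fun i _ => (hF i).diff.const_mul (c i)),
      laurentCoeff_sum _ _ _ fun i _ => (hF i).diff]
    simp only [hA, Matrix.mulVec, dotProduct, Matrix.of_apply, mul_comm]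
  have hdet : A.det ≠ 0 := by
    intro h0
    obtain ⟨v, hv0, hv⟩ := Matrix.exists_mulVec_eq_zero_iff.mpr h0
    refine hv0 ?_
    refine Matrix.eq_zero_of_mulVec_eq_zero
      (isUnit_det_oddThetaMatrix_rootNode (l := l) hp0 hp1 hω).ne_zero ?_
    ext i
    have hz := (QuasiOdd.zero.sub_sum (Finset.univ : Finset (Fin l)) v hF).eq_zero hp0
      (fun k => by rw [hcoef QuasiOdd.zero, hv]; simp [laurentCoeff, circleIntegral]) (rootNode_ne_zero hω i)
    rw [zero_sub, neg_eq_zero] at hz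
    simpa only [oddThetaMatrix, Matrix.mulVec, dotProduct, Matrix.of_apply, mul_comm,
      Pi.zero_apply] using hz
  refine ⟨A⁻¹.mulVec fun k : Fin l => laurentCoeff ((k : ℤ) + 1) f, fun z hz => ?_⟩
  refine sub_eq_zero.mp ((hf.sub_sum Finset.univ _ hF).eq_zero hp0 (fun k => ?_) hz)
  rw [hcoef hf, Matrix.mulVec_mulVec, Matrix.mul_nonsing_inv _ (isUnit_iff_ne_zero.mpr hdet),
    Matrix.one_mulVec, sub_self]

lemma QuasiOdd.eq_sum_interpolation (hp0 : 0 < p) (hp1 : p < 1)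
    (hω : IsPrimitiveRoot ω (2 * l + 1)) (hf : QuasiOdd p l f) {t : ℂ} (ht : t ≠ 0) :
    f t = ∑ k : Fin l, (∑ j : Fin l, oddTheta p l ((j : ℕ) + 1) t *
      (oddThetaMatrix p (rootNode ω))⁻¹ j k) * f (rootNode ω k) := by
  obtain ⟨c, hc⟩ := hf.exists_eq_sum hp0 hp1 hω
  set M := oddThetaMatrix p (rootNode ω : Fin l → ℂ) with hM
  have hv : (fun k : Fin l => f (rootNode ω k)) = M.mulVec c := by
    ext k
    rw [hc _ (rootNode_ne_zero hω k)]
    simp only [hM, oddThetaMatrix, Matrix.mulVec, dotProduct, Matrix.of_apply, mul_comm]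
  have hc' : M⁻¹.mulVec (fun k : Fin l => f (rootNode ω k)) = c := by
    rw [hv, Matrix.mulVec_mulVec,
      Matrix.nonsing_inv_mul _ (isUnit_det_oddThetaMatrix_rootNode hp0 hp1 hω), Matrix.one_mulVec]
  rw [hc t ht]
  simp_rw [Finset.sum_mul]
  rw [Finset.sum_comm]
  refine Finset.sum_congr rfl fun j _ => ?_
  simp_rw [mul_assoc]
  rw [← Finset.mul_sum, mul_comm]
  congr 1
  exact (congrFun hc' j).symm

end OneVariableInterpolation

section ProductSide

variable {p : ℝ} {l : ℕ}

/-- The one-variable factor of the product side. -/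
noncomputable def prodA (p : ℝ) (x : ℂ) : ℂ :=
  qPoch (p ^ 4 * x ^ 2) (p ^ 4) * qPoch (p ^ 4 * x⁻¹ ^ 2) (p ^ 4) *
    qPoch (p * x) (p ^ 2) * qPoch (p * x⁻¹) (p ^ 2)

/-- The two-variable factor of the product side. -/
noncomputable def prodG (p : ℝ) (x y : ℂ) : ℂ :=
  qPoch (p ^ 2 * (x * y)) (p ^ 2) * qPoch (p ^ 2 * (x * y)⁻¹) (p ^ 2) *
    (qPoch (p ^ 2 * (x * y⁻¹)) (p ^ 2) * qPoch (p ^ 2 * (x⁻¹ * y)) (p ^ 2))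

/-- The product side without its denominator factors. -/
noncomputable def prodQ (p : ℝ) {l : ℕ} (x : Fin l → ℂ) : ℂ :=
  (∏ i, prodA p (x i)) * ∏ i, ∏ j ∈ Finset.Ioi i, prodG p (x i) (x j)

/-- The one-variable factor of the product side, including the long root. -/
noncomputable def oddA (p : ℝ) (x : ℂ) : ℂ := (x - x⁻¹) * prodA p x

/-- The two-variable factor of the product side, including the short roots. -/
noncomputable def altG (p : ℝ) (x y : ℂ) : ℂ := ((y + y⁻¹) - (x + x⁻¹)) * prodG p x y

/-- The full product side. -/
noncomputable def prodP (p : ℝ) {l : ℕ} (x : Fin l → ℂ) : ℂ :=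
  (∏ i, oddA p (x i)) * ∏ i, ∏ j ∈ Finset.Ioi i, altG p (x i) (x j)

lemma prodP_eq {x : Fin l → ℂ} (hx : ∀ i, x i ≠ 0) :
    prodP p x = (oddPowMatrix x : Matrix (Fin l) (Fin l) ℂ).det * prodQ p x := by
  rw [oddPowMatrix, det_pow_succ_sub_inv_pow_succ hx]
  simp only [prodP, prodQ, oddA, altG, Finset.prod_mul_distrib]
  ring

lemma differentiableAt_qPoch_comp (hp0 : 0 < p) (hp1 : p < 1) {u : ℂ → ℂ} {z : ℂ}
    (hu : DifferentiableAt ℂ u z) : DifferentiableAt ℂ (fun z => qPoch (u z) p) z :=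
  DifferentiableAt.comp z (differentiable_qPoch hp0 hp1 (u z)) hu

lemma differentiableAt_oddA (hp0 : 0 < p) (hp1 : p < 1) {z : ℂ} (hz : z ≠ 0) :
    DifferentiableAt ℂ (oddA p) z := by
  have h2 := pow_pos hp0 2
  have h4 := pow_pos hp0 4
  have h2' : p ^ 2 < 1 := pow_lt_one₀ hp0.le hp1 two_ne_zero
  have h4' : p ^ 4 < 1 := pow_lt_one₀ hp0.le hp1 (by norm_num)
  unfold oddA prodA
  refine .fun_mul (by fun_prop (disch := exact hz)) (.fun_mul (.fun_mul (.fun_mul ?_ ?_) ?_) ?_) <;>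
    refine differentiableAt_qPoch_comp ‹_› ‹_› ?_ <;> fun_prop (disch := exact hz)

lemma differentiableAt_altG (hp0 : 0 < p) (hp1 : p < 1) {y z : ℂ} (hy : y ≠ 0) (hz : z ≠ 0) :
    DifferentiableAt ℂ (fun z => altG p z y) z := by
  have h2 := pow_pos hp0 2
  have h2' : p ^ 2 < 1 := pow_lt_one₀ hp0.le hp1 two_ne_zero
  have hzy := mul_ne_zero hz hy
  unfold altG prodG
  refine .fun_mul (by fun_prop (disch := exact hz)) (.fun_mul (.fun_mul ?_ ?_) (.fun_mul ?_ ?_)) <;>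
    refine differentiableAt_qPoch_comp ‹_› ‹_› ?_ <;> fun_prop (disch := assumption)

lemma oddA_inv (z : ℂ) : oddA p z⁻¹ = -oddA p z := by
  simp only [oddA, prodA, inv_inv]
  ring

lemma altG_inv (y z : ℂ) : altG p z⁻¹ y = altG p z y := by
  simp only [altG, prodG, inv_inv, mul_inv]
  ring

lemma altG_symm (y z : ℂ) : altG p z y = -altG p y z := by
  simp only [altG, prodG, mul_comm z, mul_comm z⁻¹]
  ring

lemma oddA_sq_mul (hp0 : 0 < p) (hp1 : p < 1) {z : ℂ} (hz : z ≠ 0) :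
    oddA p ((p ^ 2 : ℝ) * z) * z ^ 3 = ((p : ℂ) ^ 3)⁻¹ * oddA p z := by
  have hp' : (p : ℂ) ≠ 0 := by exact_mod_cast hp0.ne'
  have h2 := pow_pos hp0 2
  have h4 := pow_pos hp0 4
  have h2' : p ^ 2 < 1 := pow_lt_one₀ hp0.le hp1 two_ne_zero
  have h4' : p ^ 4 < 1 := pow_lt_one₀ hp0.le hp1 (by norm_num)
  have e1 := qPoch_eq_one_sub_mul h4 h4' (p ^ 4 * z ^ 2)
  have e2 := qPoch_eq_one_sub_mul h4 h4' (z⁻¹ ^ 2)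
  have e3 := qPoch_eq_one_sub_mul h2 h2' (p * z)
  have e4 := qPoch_eq_one_sub_mul h2 h2' ((p : ℂ)⁻¹ * z⁻¹)
  have f1 : (p : ℂ) ^ 4 * z ^ 2 * (p ^ 4 : ℝ) = p ^ 4 * ((p ^ 2 : ℝ) * z) ^ 2 := by
    push_cast; ring
  have f2 : z⁻¹ ^ 2 * ((p ^ 4 : ℝ) : ℂ) = p ^ 4 * z⁻¹ ^ 2 := by push_cast; ring
  have f2' : (p : ℂ) ^ 4 * (((p ^ 2 : ℝ) : ℂ) * z)⁻¹ ^ 2 = z⁻¹ ^ 2 := by push_cast; field_simp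
  have f3 : (p : ℂ) * z * (p ^ 2 : ℝ) = p * ((p ^ 2 : ℝ) * z) := by ring
  have f4 : (p : ℂ)⁻¹ * z⁻¹ * ((p ^ 2 : ℝ) : ℂ) = p * z⁻¹ := by push_cast; field_simp
  have f4' : (p : ℂ) * (((p ^ 2 : ℝ) : ℂ) * z)⁻¹ = (p : ℂ)⁻¹ * z⁻¹ := by push_cast; field_simp
  rw [f1] at e1
  rw [f2] at e2
  rw [f3] at e3
  rw [f4] at e4
  simp only [oddA, prodA, f2', f4', e1, e2, e3, e4]
  generalize qPoch (p ^ 4 * ((p ^ 2 : ℝ) * z) ^ 2) (p ^ 4) = a1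
  generalize qPoch (p ^ 4 * z⁻¹ ^ 2) (p ^ 4) = a2
  generalize qPoch (p * ((p ^ 2 : ℝ) * z)) (p ^ 2) = a3
  generalize qPoch (p * z⁻¹) (p ^ 2) = a4
  push_cast
  field_simp
  ring

lemma altG_sq_mul (hp0 : 0 < p) (hp1 : p < 1) {y z : ℂ} (hy : y ≠ 0) (hz : z ≠ 0) :
    altG p ((p ^ 2 : ℝ) * z) y * z ^ 2 = ((p : ℂ) ^ 2)⁻¹ * altG p z y := by
  have hp' : (p : ℂ) ≠ 0 := by exact_mod_cast hp0.ne'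
  have h2 := pow_pos hp0 2
  have h2' : p ^ 2 < 1 := pow_lt_one₀ hp0.le hp1 two_ne_zero
  have e1 := qPoch_eq_one_sub_mul h2 h2' (p ^ 2 * (z * y))
  have e2 := qPoch_eq_one_sub_mul h2 h2' (z * y)⁻¹
  have e3 := qPoch_eq_one_sub_mul h2 h2' (p ^ 2 * (z * y⁻¹))
  have e4 := qPoch_eq_one_sub_mul h2 h2' (z⁻¹ * y)
  have f1 : (p : ℂ) ^ 2 * (z * y) * (p ^ 2 : ℝ) = p ^ 2 * ((p ^ 2 : ℝ) * z * y) := by ring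
  have f2 : (z * y)⁻¹ * ((p ^ 2 : ℝ) : ℂ) = p ^ 2 * (z * y)⁻¹ := by push_cast; ring
  have f2' : (p : ℂ) ^ 2 * (((p ^ 2 : ℝ) : ℂ) * z * y)⁻¹ = (z * y)⁻¹ := by push_cast; field_simp
  have f3 : (p : ℂ) ^ 2 * (z * y⁻¹) * (p ^ 2 : ℝ) = p ^ 2 * ((p ^ 2 : ℝ) * z * y⁻¹) := by ring
  have f4 : z⁻¹ * y * ((p ^ 2 : ℝ) : ℂ) = p ^ 2 * (z⁻¹ * y) := by push_cast; ring
  have f4' : (p : ℂ) ^ 2 * ((((p ^ 2 : ℝ) : ℂ) * z)⁻¹ * y) = z⁻¹ * y := by push_cast; field_simp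
  rw [f1] at e1
  rw [f2] at e2
  rw [f3] at e3
  rw [f4] at e4
  simp only [altG, prodG, f2', f4', e1, e2, e3, e4]
  generalize qPoch (p ^ 2 * ((p ^ 2 : ℝ) * z * y)) (p ^ 2) = a1
  generalize qPoch (p ^ 2 * (z * y)⁻¹) (p ^ 2) = a2
  generalize qPoch (p ^ 2 * ((p ^ 2 : ℝ) * z * y⁻¹)) (p ^ 2) = a3
  generalize qPoch (p ^ 2 * (z⁻¹ * y)) (p ^ 2) = a4
  push_cast
  field_simp
  ring

lemma quasiOdd_oddA_mul_prod_altG (hp0 : 0 < p) (hp1 : p < 1) {ι : Type*} (S : Finset ι)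
    {y : ι → ℂ} (hy : ∀ i, y i ≠ 0) (hS : S.card + 1 = l) (C : ℂ) :
    QuasiOdd p l fun t => C * (oddA p t * ∏ i ∈ S, altG p t (y i)) where
  diff t ht := by
    refine DifferentiableAt.differentiableWithinAt ?_
    exact ((differentiableAt_oddA hp0 hp1 ht).fun_mul (DifferentiableAt.fun_finsetProd fun i _ =>
      differentiableAt_altG hp0 hp1 (hy i) ht)).const_mul C
  quasi t ht := by
    have h1 : (∏ i ∈ S, altG p ((p ^ 2 : ℝ) * t) (y i)) * (t ^ 2) ^ S.card =
        (((p : ℂ) ^ 2)⁻¹) ^ S.card * ∏ i ∈ S, altG p t (y i) := by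
      rw [← Finset.prod_const, ← Finset.prod_const, ← Finset.prod_mul_distrib,
        ← Finset.prod_mul_distrib]
      exact Finset.prod_congr rfl fun i _ => altG_sq_mul hp0 hp1 (hy i) ht
    have e1 : 2 * l + 1 = 3 + 2 * S.card := by omega
    have e2 : ((p : ℂ) ^ (2 * l + 1))⁻¹ = ((p : ℂ) ^ 3)⁻¹ * ((p : ℂ) ^ 2)⁻¹ ^ S.card := by
      rw [e1, pow_add, pow_mul, mul_inv, inv_pow]
    rw [e2, e1, pow_add, pow_mul]
    calc _ = C * ((oddA p ((p ^ 2 : ℝ) * t) * t ^ 3) *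
        ((∏ i ∈ S, altG p ((p ^ 2 : ℝ) * t) (y i)) * (t ^ 2) ^ S.card)) := by ring
      _ = _ := by rw [h1, oddA_sq_mul hp0 hp1 ht]; ring
  odd t _ := by
    simp only [oddA_inv, altG_inv]
    ring

lemma prodP_comp_perm (σ : Equiv.Perm (Fin l)) (x : Fin l → ℂ) :
    (prodP p fun i => x (σ i)) = (σ.sign : ℤ) * prodP p x := by
  have h := σ.prod_Ioi_comp_eq_sign_mul_prod (f := fun i j => altG p (x i) (x j))
    fun i j => altG_symm _ _
  rw [prodP, h, Equiv.prod_comp σ fun i => oddA p (x i), prodP]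
  ring

lemma quasiOdd_prodP_update (hp0 : 0 < p) (hp1 : p < 1) (x : Fin l → ℂ) (hx : ∀ i, x i ≠ 0)
    (i : Fin l) : QuasiOdd p l fun t => prodP p (Function.update x i t) := by
  obtain _ | n := l
  · exact i.elim0
  set σ : Equiv.Perm (Fin (n + 1)) := Equiv.swap 0 i with hσ
  have hss : ((σ.sign : ℤ) : ℂ) * ((σ.sign : ℤ) : ℂ) = 1 := by
    rw [← Int.cast_mul, ← Units.val_mul, Int.units_mul_self, Units.val_one, Int.cast_one]
  have hne : ∀ j : Fin n, σ j.succ ≠ i := fun j h => by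
    have : σ j.succ = σ 0 := by rw [h, hσ, Equiv.swap_apply_left]
    exact Fin.succ_ne_zero j (σ.injective this)
  have key : ∀ t, prodP p (Function.update x i t) =
      (((σ.sign : ℤ) : ℂ) * ((∏ j : Fin n, oddA p (x (σ j.succ))) *
        ∏ a : Fin n, ∏ b ∈ Finset.Ioi a, altG p (x (σ a.succ)) (x (σ b.succ)))) *
      (oddA p t * ∏ j : Fin n, altG p t (x (σ j.succ))) := by
    intro t
    have h := prodP_comp_perm (p := p) σ (Function.update x i t)
    have h0 : Function.update x i t (σ 0) = t := by simp [hσ]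
    have h1 : ∀ j : Fin n, Function.update x i t (σ j.succ) = x (σ j.succ) := fun j =>
      Function.update_of_ne (hne j) _ _
    rw [prodP, Fin.prod_univ_succ, Fin.prod_univ_succ, Fin.Ioi_zero_eq_map, Finset.prod_map] at h
    simp only [h0, h1, Fin.coe_succEmb, Fin.prod_Ioi_succ] at h
    calc _ = ((σ.sign : ℤ) : ℂ) * (((σ.sign : ℤ) : ℂ) * prodP p (Function.update x i t)) := by
          rw [← mul_assoc, hss, one_mul]
      _ = _ := by rw [← h]; ring
  simp_rw [key]
  exact quasiOdd_oddA_mul_prod_altG hp0 hp1 _ (fun j => hx _) (by simp) _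

lemma prodP_comp_of_not_injective {ι : Type*} (y : ι → ℂ) {k : Fin l → ι}
    (hk : ¬ Function.Injective k) : prodP p (fun i => y (k i)) = 0 := by
  obtain ⟨a, b, hab, hne⟩ := Function.not_injective_iff.mp hk
  wlog h : a < b generalizing a b
  · exact this b a hab.symm hne.symm (lt_of_le_of_ne (not_lt.mp h) hne.symm)
  rw [prodP]
  refine mul_eq_zero_of_right _ (Finset.prod_eq_zero (Finset.mem_univ a)
    (Finset.prod_eq_zero (Finset.mem_Ioi.mpr h) ?_))
  rw [altG, hab, sub_self, zero_mul]

variable {ω : ℂ}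

lemma prodP_comp_rootNode (hω : IsPrimitiveRoot ω (2 * l + 1)) (k : Fin l → Fin l) :
    prodP p (fun i => rootNode ω (k i)) =
      (oddPowMatrix (fun i => rootNode ω (k i)) : Matrix (Fin l) (Fin l) ℂ).det *
        prodQ p (rootNode ω : Fin l → ℂ) := by
  by_cases hk : Function.Injective k
  · obtain ⟨σ, rfl⟩ : ∃ σ : Equiv.Perm (Fin l), k = σ :=
      ⟨Equiv.ofBijective k (Finite.injective_iff_bijective.mp hk), rfl⟩
    rw [prodP_comp_perm, prodP_eq (rootNode_ne_zero hω), ← mul_assoc]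
    congr 1
    exact (Matrix.det_permute σ (oddPowMatrix (rootNode ω))).symm
  · rw [prodP_comp_of_not_injective _ hk]
    obtain ⟨a, b, hab, hne⟩ := Function.not_injective_iff.mp hk
    rw [Matrix.det_zero_of_row_eq hne, zero_mul]
    ext j
    simp only [oddPowMatrix, Matrix.of_apply, hab]

lemma det_mul_eq_sum {R ι : Type*} [CommRing R] [Fintype ι] {n : ℕ} (A : Matrix (Fin n) ι R)
    (B : Matrix ι (Fin n) R) :
    (A * B).det = ∑ k : Fin n → ι, (∏ i, A i (k i)) * (Matrix.of fun i j => B (k i) j).det := by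
  have h1 : (A * B) = fun i => ∑ k, A i k • B k := by
    ext i j
    simp [Matrix.mul_apply]
  have h2 := (Matrix.detRowAlternating (n := Fin n) (R := R)).toMultilinearMap.map_sum
    fun i k => A i k • B k
  rw [h1]
  refine h2.trans (Finset.sum_congr rfl fun k _ => ?_)
  exact (Matrix.detRowAlternating (n := Fin n) (R := R)).toMultilinearMap.map_smul_univ
    (fun i => A i (k i)) fun i => B (k i)

theorem prodP_mul_prod_thetaSeries (hp0 : 0 < p) (hp1 : p < 1)
    (hω : IsPrimitiveRoot ω (2 * l + 1)) {x : Fin l → ℂ} (hx : ∀ i, x i ≠ 0) :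
    prodP p x * ∏ j : Fin l, thetaSeries (p ^ (2 * l + 1)) (p ^ (2 * ((j : ℕ) + 1))) =
      prodQ p (rootNode ω : Fin l → ℂ) * (oddThetaMatrix p x).det := by
  set D : Matrix (Fin l) (Fin l) ℂ := Matrix.diagonal fun j : Fin l =>
    thetaSeries (p ^ (2 * l + 1)) (p ^ (2 * ((j : ℕ) + 1))) with hD
  set M := oddThetaMatrix p (rootNode ω : Fin l → ℂ) with hM
  have hMu : IsUnit M.det := isUnit_det_oddThetaMatrix_rootNode hp0 hp1 hω
  have hMD : M = oddPowMatrix (rootNode ω) * D := oddThetaMatrix_rootNode hω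
  have h1 := eq_sum_interpolation_of_forall_update (rootNode_ne_zero hω)
    (L := fun (k : Fin l) t => ∑ j : Fin l, oddTheta p l ((j : ℕ) + 1) t * M⁻¹ j k)
    (fun f (hf : QuasiOdd p l f) t ht => hf.eq_sum_interpolation hp0 hp1 hω ht) (prodP p)
    (quasiOdd_prodP_update hp0 hp1) x hx
  have h2 : prodP p x = prodQ p (rootNode ω : Fin l → ℂ) *
      (oddThetaMatrix p x * M⁻¹ * oddPowMatrix (rootNode ω)).det := by
    rw [h1, det_mul_eq_sum, Finset.mul_sum]
    refine Finset.sum_congr rfl fun k _ => ?_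
    rw [prodP_comp_rootNode hω]
    simp only [Matrix.mul_apply, oddThetaMatrix, Matrix.of_apply]
    rw [mul_comm (Matrix.det _), ← mul_assoc, mul_comm _ (prodQ p _), mul_assoc]
    rfl
  rw [h2, ← Matrix.det_diagonal, ← hD, mul_assoc, ← Matrix.det_mul, mul_assoc, ← hMD,
    Matrix.nonsing_inv_mul_cancel_right _ _ hMu]

end ProductSide

section PiSeries

open Filter Topology

lemma summable_norm_pi_and_hasSum_pi {ι : Type*} {n : ℕ} {f : Fin n → ι → ℂ}
    (hf : ∀ j, Summable fun m => ‖f j m‖) :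
    (Summable fun m : Fin n → ι => ‖∏ j, f j (m j)‖) ∧
      HasSum (fun m : Fin n → ι => ∏ j, f j (m j)) (∏ j, ∑' m, f j m) := by
  induction n with
  | zero => exact ⟨(hasSum_unique _).summable, by simp [hasSum_unique]⟩
  | succ n ih =>
    obtain ⟨h1, h2⟩ := ih (f := fun j => f j.succ) fun j => hf j.succ
    have hs := (hf 0).mul_norm h1
    have hs' := (hs.of_norm).hasSum
    rw [← tsum_mul_tsum_of_summable_norm (hf 0) h1, h2.tsum_eq] at hs'
    constructor
    · rw [← (Fin.consEquiv fun _ : Fin (n + 1) => ι).summable_iff]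
      simpa [Function.comp_def, Fin.prod_univ_succ, Fin.consEquiv] using hs
    · rw [← (Fin.consEquiv fun _ : Fin (n + 1) => ι).hasSum_iff]
      simpa [Function.comp_def, Fin.prod_univ_succ, Fin.consEquiv] using hs'

lemma summable_pi_of_nonneg {ι : Type*} {n : ℕ} {f : Fin n → ι → ℝ} (h0 : ∀ j m, 0 ≤ f j m)
    (hf : ∀ j, Summable (f j)) : Summable fun m : Fin n → ι => ∏ j, f j (m j) := by
  refine (summable_norm_pi_and_hasSum_pi (f := fun j m => (f j m : ℂ)) fun j => ?_).1.congr
    fun m => ?_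
  · simpa [abs_of_nonneg (h0 _ _)] using hf j
  · simp [abs_of_nonneg (h0 _ _)]

lemma hasSum_det {ι : Type*} {n : ℕ} {f : Fin n → Fin n → ι → ℂ}
    (hf : ∀ i j, Summable fun m => ‖f i j m‖) :
    HasSum (fun m : Fin n → ι => (Matrix.of fun i j => f i j (m j)).det)
      (Matrix.of fun i j => ∑' m, f i j m).det := by
  simp only [Matrix.det_apply, Matrix.of_apply]
  exact hasSum_sum fun σ _ =>
    (summable_norm_pi_and_hasSum_pi (f := fun j => f (σ j) j) fun j => hf _ _).2.const_smul _

end PiSeries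

section ThetaExpansion

open Filter Topology

variable {p : ℝ} {l : ℕ}

/-- The exponents occurring in the expansion of the theta functions `oddTheta`. -/
def oddExp {l : ℕ} (m : Fin l → ℤ) (j : Fin l) : ℤ := ((j : ℤ) + 1) + (2 * l + 1) * m j

/-- The weight of the exponents `oddExp m`. -/
noncomputable def oddWeight (p : ℝ) {l : ℕ} (m : Fin l → ℤ) : ℝ :=
  ∏ j : Fin l, (p ^ (2 * l + 1)) ^ (m j ^ 2) * (p ^ (2 * ((j : ℕ) + 1))) ^ m j

lemma hasSum_oddTheta (hp0 : 0 < p) (hp1 : p < 1) {a : ℕ} {x : ℂ} (hx : x ≠ 0) :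
    (Summable fun m : ℤ => ‖((p ^ (2 * l + 1) : ℝ) : ℂ) ^ (m ^ 2) * ((p ^ (2 * a) : ℝ) : ℂ) ^ m *
      (x ^ ((a : ℤ) + (2 * l + 1) * m) - x⁻¹ ^ ((a : ℤ) + (2 * l + 1) * m))‖) ∧
    HasSum (fun m : ℤ => ((p ^ (2 * l + 1) : ℝ) : ℂ) ^ (m ^ 2) * ((p ^ (2 * a) : ℝ) : ℂ) ^ m *
      (x ^ ((a : ℤ) + (2 * l + 1) * m) - x⁻¹ ^ ((a : ℤ) + (2 * l + 1) * m)))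
      (oddTheta p l a x) := by
  have hp' : (p : ℂ) ≠ 0 := by exact_mod_cast hp0.ne'
  have hP0 := pow_pos hp0 (2 * l + 1)
  have hP1 : p ^ (2 * l + 1) < 1 := pow_lt_one₀ hp0.le hp1 (by omega)
  have e : ∀ y : ℂ, y ≠ 0 → ∀ m : ℤ, y ^ a * (((p ^ (2 * l + 1) : ℝ) : ℂ) ^ (m ^ 2) *
      (p ^ (2 * a) * y ^ (2 * l + 1)) ^ m) = ((p ^ (2 * l + 1) : ℝ) : ℂ) ^ (m ^ 2) *
      ((p ^ (2 * a) : ℝ) : ℂ) ^ m * y ^ ((a : ℤ) + (2 * l + 1) * m) := by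
    intro y hy m
    have hl : y ^ ((2 * l + 1 : ℤ)) = y ^ (2 * l + 1) := mod_cast zpow_natCast y (2 * l + 1)
    rw [zpow_add₀ hy, zpow_mul, mul_zpow, hl, zpow_natCast]
    push_cast
    ring
  have hz : ∀ y : ℂ, y ≠ 0 → (p : ℂ) ^ (2 * a) * y ^ (2 * l + 1) ≠ 0 := fun y hy =>
    mul_ne_zero (pow_ne_zero _ hp') (pow_ne_zero _ hy)
  have h1 := fun y hy => (hasSum_thetaSeries hP0 hP1 (hz y hy)).mul_left (y ^ a)
  have h2 := fun y hy => (summable_norm_thetaSeries hP0 hP1 (hz y hy)).mul_left ‖y ^ a‖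
  have hx' := inv_ne_zero hx
  constructor
  · refine ((h2 x hx).add (h2 _ hx')).of_nonneg_of_le (fun _ => norm_nonneg _) fun m => ?_
    rw [mul_sub, ← e x hx, ← e _ hx', ← norm_mul, ← norm_mul]
    exact norm_sub_le _ _
  · refine ((h1 x hx).sub (h1 _ hx')).congr_fun fun m => ?_
    rw [mul_sub, ← e x hx, ← e _ hx']

lemma hasSum_det_oddThetaMatrix (hp0 : 0 < p) (hp1 : p < 1) {ξ : ℂ} (hξ : ξ ≠ 0) :
    HasSum (fun m : Fin l → ℤ => (oddWeight p m : ℂ) *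
      (oddPowMatrix fun i => ξ ^ oddExp m i : Matrix (Fin l) (Fin l) ℂ).det)
      (oddThetaMatrix p fun i : Fin l => ξ ^ ((i : ℕ) + 1)).det := by
  have h := hasSum_det (n := l) (f := fun i j (m : ℤ) => ((p ^ (2 * l + 1) : ℝ) : ℂ) ^ (m ^ 2) *
    ((p ^ (2 * ((j : ℕ) + 1)) : ℝ) : ℂ) ^ m *
      ((ξ ^ ((i : ℕ) + 1)) ^ ((((j : ℕ) + 1 : ℕ) : ℤ) + (2 * l + 1) * m) -
        (ξ ^ ((i : ℕ) + 1))⁻¹ ^ ((((j : ℕ) + 1 : ℕ) : ℤ) + (2 * l + 1) * m)))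
    fun i j => (hasSum_oddTheta hp0 hp1 (pow_ne_zero _ hξ)).1
  simp only [(hasSum_oddTheta hp0 hp1 (pow_ne_zero _ hξ)).2.tsum_eq] at h
  refine h.congr_fun fun m => ?_
  rw [oddWeight, ← Matrix.det_transpose]
  push_cast
  rw [← Matrix.det_mul_row]
  congr 1
  ext i j
  simp only [oddPowMatrix, Matrix.transpose_apply, Matrix.of_apply, oddExp]
  simp only [← zpow_natCast, ← zpow_mul, ← zpow_neg_one]
  push_cast
  congr 2 <;> ring_nf

end ThetaExpansion

section LimitAtIdentity

open Filter Topology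

variable {p : ℝ} {l : ℕ}

/-- The Weyl numerator of `C_l` scaled by `s`, up to constants. -/
noncomputable def sinProd {l : ℕ} (s : ℝ) (v : Fin l → ℝ) : ℝ :=
  (∏ i, Real.sin (s * v i) / s) *
    ∏ i, ∏ j ∈ Finset.Ioi i, (2 * Real.cos (s * v j) - 2 * Real.cos (s * v i)) / s ^ 2

/-- The product of the positive roots of `C_l`, up to constants. -/
noncomputable def polyProd {l : ℕ} (v : Fin l → ℝ) : ℝ :=
  (∏ i, v i) * ∏ i, ∏ j ∈ Finset.Ioi i, (v i ^ 2 - v j ^ 2)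

lemma exp_sub_inv (x : ℝ) : Complex.exp (x * Complex.I) - (Complex.exp (x * Complex.I))⁻¹ =
    2 * Complex.I * (Real.sin x : ℝ) := by
  rw [← Complex.exp_neg, ← neg_mul, Complex.exp_mul_I, Complex.exp_mul_I, Complex.cos_neg,
    Complex.sin_neg, Complex.ofReal_sin]
  ring

lemma exp_add_inv (x : ℝ) : Complex.exp (x * Complex.I) + (Complex.exp (x * Complex.I))⁻¹ =
    ((2 * Real.cos x : ℝ) : ℂ) := by
  rw [← Complex.exp_neg, ← neg_mul, Complex.exp_mul_I, Complex.exp_mul_I, Complex.cos_neg,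
    Complex.sin_neg]
  push_cast
  ring

lemma det_oddPowMatrix_exp {s : ℝ} (hs : s ≠ 0) (v : Fin l → ℝ) :
    (oddPowMatrix fun i => Complex.exp (((s * v i : ℝ) : ℂ) * Complex.I) :
      Matrix (Fin l) (Fin l) ℂ).det =
      ((2 * Complex.I * s) ^ l * ∏ i : Fin l, ∏ _j ∈ Finset.Ioi i, (s : ℂ) ^ 2) *
        (sinProd s v : ℝ) := by
  have hs' : (s : ℂ) ≠ 0 := by exact_mod_cast hs
  rw [oddPowMatrix, det_pow_succ_sub_inv_pow_succ fun i => Complex.exp_ne_zero _]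
  simp only [exp_sub_inv, exp_add_inv, sinProd]
  have e1 : (2 * Complex.I * (s : ℂ)) ^ l * ∏ i : Fin l, ((Real.sin (s * v i) / s : ℝ) : ℂ) =
      ∏ i : Fin l, 2 * Complex.I * (Real.sin (s * v i) : ℝ) := by
    have : (2 * Complex.I * (s : ℂ)) ^ l = ∏ _i : Fin l, 2 * Complex.I * (s : ℂ) := by simp
    rw [this, ← Finset.prod_mul_distrib]
    refine Finset.prod_congr rfl fun i _ => ?_
    rw [Complex.ofReal_div]
    field_simp
  have e2 : (∏ i : Fin l, ∏ _j ∈ Finset.Ioi i, (s : ℂ) ^ 2) * ∏ i : Fin l, ∏ j ∈ Finset.Ioi i,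
      (((2 * Real.cos (s * v j) - 2 * Real.cos (s * v i)) / s ^ 2 : ℝ) : ℂ) =
      ∏ i : Fin l, ∏ j ∈ Finset.Ioi i,
        (((2 * Real.cos (s * v j) : ℝ) : ℂ) - ((2 * Real.cos (s * v i) : ℝ) : ℂ)) := by
    rw [← Finset.prod_mul_distrib]
    refine Finset.prod_congr rfl fun i _ => ?_
    rw [← Finset.prod_mul_distrib]
    refine Finset.prod_congr rfl fun j _ => ?_
    rw [Complex.ofReal_div, Complex.ofReal_pow, mul_div_cancel₀ _ (pow_ne_zero 2 hs'),
      Complex.ofReal_sub]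
  rw [← e1, ← e2, Complex.ofReal_mul, Complex.ofReal_prod, Complex.ofReal_prod]
  simp only [Complex.ofReal_prod]
  ring

lemma tendsto_sin_mul_div (a : ℝ) :
    Tendsto (fun s : ℝ => Real.sin (s * a) / s) (𝓝[≠] 0) (𝓝 a) := by
  have h : HasDerivAt (fun s : ℝ => Real.sin (s * a)) a 0 := by
    simpa using ((hasDerivAt_id (0 : ℝ)).mul_const a).sin
  have := h.tendsto_slope_zero
  simpa [div_eq_inv_mul] using this

lemma tendsto_cos_sub_cos_div (a b : ℝ) :
    Tendsto (fun s : ℝ => (2 * Real.cos (s * b) - 2 * Real.cos (s * a)) / s ^ 2) (𝓝[≠] 0)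
      (𝓝 (a ^ 2 - b ^ 2)) := by
  have h := fun a : ℝ => (tendsto_sin_mul_div (a / 2)).pow 2
  have := ((h a).sub (h b)).const_mul 4
  have e : 4 * ((a / 2) ^ 2 - (b / 2) ^ 2) = a ^ 2 - b ^ 2 := by ring
  rw [e] at this
  refine this.congr fun s => ?_
  have hc : ∀ a : ℝ, Real.cos (s * a) = 1 - 2 * Real.sin (s * (a / 2)) ^ 2 := by
    intro a
    rw [← Real.cos_two_mul_eq_one_sub]
    ring_nf
  rw [hc, hc]
  ring

lemma tendsto_sinProd (v : Fin l → ℝ) :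
    Tendsto (fun s : ℝ => sinProd s v) (𝓝[≠] 0) (𝓝 (polyProd v)) :=
  (tendsto_finsetProd _ fun _ _ => tendsto_sin_mul_div _).mul
    (tendsto_finsetProd _ fun _ _ => tendsto_finsetProd _ fun _ _ => tendsto_cos_sub_cos_div _ _)

lemma abs_sin_mul_div_le (s a : ℝ) : |Real.sin (s * a) / s| ≤ 1 + a ^ 2 := by
  have h1 : |Real.sin (s * a) / s| ≤ |a| := by
    rcases eq_or_ne s 0 with rfl | hs
    · simp
    rw [abs_div, div_le_iff₀ (abs_pos.mpr hs), mul_comm |a|, ← abs_mul]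
    exact Real.abs_sin_le_abs
  nlinarith [sq_nonneg (|a| - 1), sq_abs a, abs_nonneg a]

lemma abs_cos_sub_cos_div_le (s a b : ℝ) :
    |(2 * Real.cos (s * b) - 2 * Real.cos (s * a)) / s ^ 2| ≤ (1 + a ^ 2) + (1 + b ^ 2) := by
  rcases eq_or_ne s 0 with rfl | hs
  · simp; positivity
  rw [abs_div, abs_of_pos (by positivity : 0 < s ^ 2), div_le_iff₀ (by positivity), abs_le]
  have h1 := Real.one_sub_sq_div_two_le_cos (x := s * a)
  have h2 := Real.one_sub_sq_div_two_le_cos (x := s * b)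
  have h3 := Real.cos_le_one (s * a)
  have h4 := Real.cos_le_one (s * b)
  constructor <;> nlinarith [sq_nonneg s, sq_nonneg (s * a), sq_nonneg (s * b)]

lemma exists_abs_sinProd_le (l : ℕ) : ∃ (C : ℝ) (N : ℕ), ∀ (s : ℝ) (v : Fin l → ℝ),
    |sinProd s v| ≤ C * ∏ k, (1 + v k ^ 2) ^ N := by
  refine ⟨∏ i : Fin l, ∏ _j ∈ Finset.Ioi i, 2, 1 + ∑ i : Fin l, (Finset.Ioi i).card,
    fun s v => ?_⟩
  set Q : ℝ := ∏ k, (1 + v k ^ 2) with hQ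
  have hle : ∀ i, 1 + v i ^ 2 ≤ Q := fun i => by
    rw [hQ, ← Finset.mul_prod_erase _ _ (Finset.mem_univ i)]
    refine le_mul_of_one_le_right (by positivity) ?_
    exact Finset.one_le_prod fun k _ => by nlinarith [sq_nonneg (v k)]
  have e : (∏ i : Fin l, ∏ _j ∈ Finset.Ioi i, (2 : ℝ)) * (∏ k, (1 + v k ^ 2) ^
      (1 + ∑ i : Fin l, (Finset.Ioi i).card)) =
      Q * ∏ i : Fin l, ∏ _j ∈ Finset.Ioi i, (2 * Q) := by
    simp only [Finset.prod_pow, ← hQ, Finset.prod_const, mul_pow, Finset.prod_mul_distrib]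
    rw [pow_add, pow_one, Finset.prod_pow_eq_pow_sum, Finset.prod_pow_eq_pow_sum]
    ring
  rw [e, sinProd, abs_mul, Finset.abs_prod, Finset.abs_prod]
  gcongr with i _
  · exact Finset.prod_le_prod (fun _ _ => abs_nonneg _) fun i _ => abs_sin_mul_div_le _ _
  · rw [Finset.abs_prod]
    refine Finset.prod_le_prod (fun _ _ => abs_nonneg _) fun j _ =>
      (abs_cos_sub_cos_div_le _ _ _).trans ?_
    linarith [hle i, hle j]

lemma one_add_sq_le_two_mul_exp (x : ℝ) : 1 + x ^ 2 ≤ 2 * Real.exp |x| := by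
  have := Real.quadratic_le_exp_of_nonneg (abs_nonneg x)
  rw [sq_abs] at this
  nlinarith [abs_nonneg x]

lemma summable_zpow_mul_one_add_sq {P R : ℝ} (hP0 : 0 < P) (hP1 : P < 1) (hR : 0 < R)
    (a b : ℝ) (N : ℕ) :
    Summable fun m : ℤ => P ^ (m ^ 2) * R ^ m * (1 + (a + b * m) ^ 2) ^ N := by
  set B : ℝ := max R R⁻¹ with hB
  have hB0 : 0 < B := lt_max_of_lt_left hR
  have hs := (summable_zpow_sq_mul_zpow_abs hP0 hP1
    (mul_pos hB0 (Real.exp_pos (N * |b|)))).mul_left (2 ^ N * Real.exp (N * |a|))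
  refine hs.of_nonneg_of_le (fun m => by positivity) fun m => ?_
  have h1 : R ^ m ≤ B ^ |m| := by
    rcases le_or_gt 0 m with hm | hm
    · rw [abs_of_nonneg hm]
      exact zpow_le_zpow_left₀ hm hR.le (le_max_left _ _)
    · rw [abs_of_neg hm, ← inv_inv R, inv_zpow, ← zpow_neg]
      exact zpow_le_zpow_left₀ (by omega) (inv_nonneg.mpr hR.le) (le_max_right _ _)
  have h2 : (1 + (a + b * m) ^ 2) ^ N ≤ 2 ^ N * Real.exp (N * |a|) * Real.exp (N * |b|) ^ |m| := by
    calc (1 + (a + b * m) ^ 2) ^ N ≤ (2 * Real.exp |a + b * m|) ^ N := by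
          gcongr; exact one_add_sq_le_two_mul_exp _
      _ ≤ (2 * Real.exp (|a| + |b| * |(m : ℝ)|)) ^ N := by
          gcongr; exact (abs_add_le _ _).trans_eq (by rw [abs_mul])
      _ = _ := by
          rw [← Real.rpow_intCast, ← Real.exp_mul, mul_pow, ← Real.exp_nat_mul, mul_assoc, ← Real.exp_add]
          push_cast
          ring_nf
  calc _ ≤ P ^ (m ^ 2) * B ^ |m| * (2 ^ N * Real.exp (N * |a|) * Real.exp (N * |b|) ^ |m|) := by
        gcongr
    _ = _ := by rw [mul_zpow]; ring

lemma oddWeight_pos (hp0 : 0 < p) (m : Fin l → ℤ) : 0 < oddWeight p m :=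
  Finset.prod_pos fun j _ => by positivity

lemma summable_oddWeight_mul (hp0 : 0 < p) (hp1 : p < 1) (N : ℕ) :
    Summable fun m : Fin l → ℤ => oddWeight p m * ∏ k, (1 + (oddExp m k : ℝ) ^ 2) ^ N := by
  have hP0 := pow_pos hp0 (2 * l + 1)
  have hP1 : p ^ (2 * l + 1) < 1 := pow_lt_one₀ hp0.le hp1 (by omega)
  have := summable_pi_of_nonneg (n := l) (f := fun j (m : ℤ) => (p ^ (2 * l + 1)) ^ (m ^ 2) *
    (p ^ (2 * ((j : ℕ) + 1))) ^ m * (1 + (((j : ℝ) + 1) + (2 * l + 1) * m) ^ 2) ^ N)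
    (fun j m => by positivity)
    (fun j => summable_zpow_mul_one_add_sq hP0 hP1 (pow_pos hp0 _) _ _ N)
  refine this.congr fun m => ?_
  rw [Finset.prod_mul_distrib, oddWeight]
  simp only [oddExp]
  push_cast
  rfl

lemma polyProd_abs_le_of_sinProd_abs_le {C : ℝ} {N : ℕ} (h : ∀ (s : ℝ) (v : Fin l → ℝ),
    |sinProd s v| ≤ C * ∏ k, (1 + v k ^ 2) ^ N) (v : Fin l → ℝ) :
    |polyProd v| ≤ C * ∏ k, (1 + v k ^ 2) ^ N :=
  le_of_tendsto (tendsto_sinProd v).abs (.of_forall fun s => h s v)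

lemma summable_oddWeight_mul_polyProd (hp0 : 0 < p) (hp1 : p < 1) :
    Summable fun m : Fin l → ℤ => |oddWeight p m * polyProd fun i => (oddExp m i : ℝ)| := by
  obtain ⟨C, N, h⟩ := exists_abs_sinProd_le l
  refine ((summable_oddWeight_mul hp0 hp1 N).mul_left C).of_nonneg_of_le (fun _ => abs_nonneg _)
    fun m => ?_
  rw [abs_mul, abs_of_pos (oddWeight_pos hp0 m), mul_left_comm]
  gcongr
  exacts [(oddWeight_pos hp0 m).le, polyProd_abs_le_of_sinProd_abs_le h _]

lemma tendsto_tsum_sinProd (hp0 : 0 < p) (hp1 : p < 1) :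
    Tendsto (fun s : ℝ => ∑' m : Fin l → ℤ, oddWeight p m * sinProd s fun i => (oddExp m i : ℝ))
      (𝓝[≠] 0) (𝓝 (∑' m : Fin l → ℤ, oddWeight p m * polyProd fun i => (oddExp m i : ℝ))) := by
  obtain ⟨C, N, h⟩ := exists_abs_sinProd_le l
  refine tendsto_tsum_of_dominated_convergence ((summable_oddWeight_mul hp0 hp1 N).mul_left C)
    (fun m => (tendsto_sinProd _).const_mul _) (.of_forall fun s m => ?_)
  rw [Real.norm_eq_abs, abs_mul, abs_of_pos (oddWeight_pos hp0 m), mul_left_comm]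
  gcongr
  exacts [(oddWeight_pos hp0 m).le, h _ _]

end LimitAtIdentity

section LimitIdentity

open Filter Topology

variable {p : ℝ} {l : ℕ} {ω : ℂ}

lemma differentiable_prodQ_exp (hp0 : 0 < p) (hp1 : p < 1) (v : Fin l → ℝ) :
    Differentiable ℂ fun s : ℂ => prodQ p fun i => Complex.exp (s * v i * Complex.I) := by
  have h2 := pow_pos hp0 2
  have h4 := pow_pos hp0 4
  have h2' : p ^ 2 < 1 := pow_lt_one₀ hp0.le hp1 two_ne_zero
  have h4' : p ^ 4 < 1 := pow_lt_one₀ hp0.le hp1 (by norm_num)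
  intro s
  simp only [prodQ, prodA, prodG, ← Complex.exp_neg]
  refine .fun_mul (.fun_finsetProd fun i _ => .fun_mul (.fun_mul (.fun_mul ?_ ?_) ?_) ?_)
    (.fun_finsetProd fun i _ => .fun_finsetProd fun j _ =>
      .fun_mul (.fun_mul ?_ ?_) (.fun_mul ?_ ?_)) <;>
    refine differentiableAt_qPoch_comp ‹_› ‹_› ?_
  all_goals try simp only [← Complex.exp_add, ← Complex.exp_neg]
  all_goals fun_prop

lemma polyProd_mul_prodQ_one (hp0 : 0 < p) (hp1 : p < 1) (hω : IsPrimitiveRoot ω (2 * l + 1)) :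
    ((polyProd fun i : Fin l => ((i : ℕ) + 1 : ℝ) : ℝ) : ℂ) * prodQ p (fun _ : Fin l => 1) *
      ∏ j : Fin l, thetaSeries (p ^ (2 * l + 1)) (p ^ (2 * ((j : ℕ) + 1))) =
    prodQ p (rootNode ω : Fin l → ℂ) *
      ((∑' m : Fin l → ℤ, oddWeight p m * polyProd fun i => (oddExp m i : ℝ) : ℝ) : ℂ) := by
  set v : Fin l → ℝ := fun i => (i : ℕ) + 1 with hv
  set T := ∏ j : Fin l, thetaSeries (p ^ (2 * l + 1)) (p ^ (2 * ((j : ℕ) + 1)))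
  have key : ∀ s : ℝ, s ≠ 0 → ((sinProd s v : ℝ) : ℂ) *
      prodQ p (fun i => Complex.exp (s * v i * Complex.I)) * T = prodQ p (rootNode ω : Fin l → ℂ) *
      ((∑' m : Fin l → ℤ, oddWeight p m * sinProd s fun i => (oddExp m i : ℝ) : ℝ) : ℂ) := by
    intro s hs
    have hs' : (s : ℂ) ≠ 0 := by exact_mod_cast hs
    have h1 := prodP_mul_prod_thetaSeries hp0 hp1 hω
      (x := fun i : Fin l => Complex.exp (((s * v i : ℝ) : ℂ) * Complex.I))
      fun i => Complex.exp_ne_zero _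
    have h2 := (hasSum_det_oddThetaMatrix (l := l) hp0 hp1
      (Complex.exp_ne_zero ((s : ℂ) * Complex.I))).tsum_eq
    have e1 : (fun i : Fin l => Complex.exp ((s : ℂ) * Complex.I) ^ ((i : ℕ) + 1)) =
        fun i : Fin l => Complex.exp (((s * v i : ℝ) : ℂ) * Complex.I) := by
      ext i
      rw [← Complex.exp_nat_mul, hv]
      push_cast
      ring_nf
    have e2 : ∀ m : Fin l → ℤ, (fun i : Fin l => Complex.exp ((s : ℂ) * Complex.I) ^ oddExp m i) =
        fun i : Fin l => Complex.exp (((s * (oddExp m i : ℝ) : ℝ) : ℂ) * Complex.I) := by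
      intro m
      ext i
      rw [← Complex.exp_int_mul]
      push_cast
      ring_nf
    set K : ℂ := (2 * Complex.I * s) ^ l * ∏ i : Fin l, ∏ _j ∈ Finset.Ioi i, (s : ℂ) ^ 2 with hK
    have hK0 : K ≠ 0 := mul_ne_zero (by simp [hs'])
      (Finset.prod_ne_zero_iff.mpr fun i _ => Finset.prod_ne_zero_iff.mpr fun j _ => by simp [hs'])
    rw [e1] at h2
    simp only [e2, det_oddPowMatrix_exp hs, ← hK] at h2
    rw [prodP_eq fun i => Complex.exp_ne_zero _, det_oddPowMatrix_exp hs, ← hK, ← h2] at h1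
    simp only [mul_left_comm _ K] at h1
    rw [tsum_mul_left] at h1
    refine mul_left_cancel₀ hK0 ?_
    push_cast at h1 ⊢
    linear_combination h1
  have hQ : Tendsto (fun s : ℝ => prodQ p fun i => Complex.exp (s * v i * Complex.I)) (𝓝[≠] 0)
      (𝓝 (prodQ p fun _ : Fin l => 1)) := by
    have := ((differentiable_prodQ_exp hp0 hp1 v).continuous.comp
      Complex.continuous_ofReal).tendsto (0 : ℝ)
    simp only [Function.comp_def, Complex.ofReal_zero, zero_mul, Complex.exp_zero] at this
    exact this.mono_left nhdsWithin_le_nhds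
  have hL := (((Complex.continuous_ofReal.tendsto _).comp (tendsto_sinProd v)).mul hQ).mul_const T
  have hR := ((Complex.continuous_ofReal.tendsto _).comp
    (tendsto_tsum_sinProd (l := l) hp0 hp1)).const_mul (prodQ p (rootNode ω : Fin l → ℂ))
  refine tendsto_nhds_unique_of_eventuallyEq hL hR ?_
  filter_upwards [self_mem_nhdsWithin] with s hs
  exact key s hs

end LimitIdentity

section FiniteProducts

lemma prod_range_two_mul_add_one {M : Type*} [CommMonoid M] (l : ℕ) (f : ℕ → M) :
    ∏ r ∈ Finset.range (2 * l + 1), f r =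
      f l * ∏ j : Fin l, f (l + ((j : ℕ) + 1)) * f (l - ((j : ℕ) + 1)) := by
  have h : 2 * l + 1 = l + (1 + l) := by omega
  rw [h, Finset.prod_range_add, Finset.prod_range_add, Finset.prod_range_one, Finset.prod_mul_distrib,
    Fin.prod_univ_eq_prod_range (fun j => f (l + (j + 1))),
    Fin.prod_univ_eq_prod_range (fun j => f (l - (j + 1))), ← Finset.prod_range_reflect f l]
  have e : ∏ j ∈ Finset.range l, f (l - 1 - j) = ∏ j ∈ Finset.range l, f (l - (j + 1)) :=
    Finset.prod_congr rfl fun j _ => by congr 1; omega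
  simp only [e, add_zero, add_comm 1]
  rw [mul_comm, mul_assoc]

lemma prod_range_rootNode {l : ℕ} {ω : ℂ} (hω : ω ^ (2 * l + 1) = 1) (f : ℂ → ℂ) :
    ∏ k ∈ Finset.range (2 * l + 1), f (ω ^ k) =
      f 1 * ∏ i : Fin l, f (rootNode ω i) * f (rootNode ω i)⁻¹ := by
  have h : ω ^ (l + 1) * ω ^ l = 1 := by rw [← pow_add, ← hω]; congr 1; omega
  have h0 : ω ≠ 0 := by
    rintro rfl
    simp at hω
  have key : ∀ j : Fin l, ω ^ (2 * l + 1 - ((j : ℕ) + 1)) = (ω ^ ((j : ℕ) + 1))⁻¹ := fun j => by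
    rw [pow_sub₀ _ h0 (by omega), hω, one_mul]
  rw [Finset.prod_range_succ', pow_zero, mul_comm, two_mul, Finset.prod_range_add]
  congr 1
  rw [Finset.prod_mul_distrib, ← Fin.prod_univ_eq_prod_range (fun i => f (ω ^ (i + 1)))]
  congr 1
  rw [← Finset.prod_range_reflect, ← Fin.prod_univ_eq_prod_range (fun i => f (ω ^ (l + (l - 1 - i) + 1)))]
  refine Finset.prod_congr rfl fun j _ => ?_
  rw [rootNode, ← key]
  congr 2
  omega

lemma prod_prod_eq_diag_mul_sq {M : Type*} [CommMonoid M] {l : ℕ} (f : Fin l → Fin l → M)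
    (hf : ∀ i j, f i j = f j i) :
    ∏ i, ∏ j, f i j = (∏ i, f i i) * (∏ i, ∏ j ∈ Finset.Ioi i, f i j) ^ 2 := by
  have h1 : ∀ i, ∏ j, f i j = f i i * ((∏ j ∈ Finset.Iio i, f i j) * ∏ j ∈ Finset.Ioi i, f i j) := by
    intro i
    rw [← Finset.prod_union (Finset.disjoint_left.mpr fun j h h' =>
      lt_asymm (Finset.mem_Iio.mp h) (Finset.mem_Ioi.mp h')), ← Finset.mul_prod_erase _ _ (Finset.mem_univ i)]
    congr 2
    ext j
    simp [lt_or_lt_iff_ne]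
  have h2 : ∏ i, ∏ j ∈ Finset.Iio i, f i j = ∏ i, ∏ j ∈ Finset.Ioi i, f i j := by
    rw [Finset.prod_comm' (s' := fun j => Finset.Ioi j) (t' := Finset.univ) (by simp)]
    exact Finset.prod_congr rfl fun i _ => Finset.prod_congr rfl fun j _ => hf _ _
  simp only [h1, Finset.prod_mul_distrib, h2, sq]

end FiniteProducts

section ProductEvaluation

variable {p : ℝ} {l : ℕ} {ω : ℂ}

lemma prod_qPoch_mul_rootNode {q : ℝ} (hq0 : 0 < q) (hq1 : q < 1)
    (hω : IsPrimitiveRoot ω (2 * l + 1)) (a : ℂ) :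
    qPoch a q * ∏ i : Fin l, qPoch (a * rootNode ω i) q * qPoch (a * (rootNode ω i)⁻¹) q =
      qPoch (a ^ (2 * l + 1)) (q ^ (2 * l + 1)) := by
  rw [← qPoch_pow_eq_prod_roots hq0 hq1 a (by omega) hω,
    prod_range_rootNode hω.pow_eq_one fun z => qPoch (a * z) q, mul_one]

lemma rootNode_sq (i : Fin l) : rootNode ω i ^ 2 = rootNode (ω ^ 2) i := by
  rw [rootNode, rootNode, ← pow_mul, ← pow_mul, mul_comm]

lemma isPrimitiveRoot_sq (hω : IsPrimitiveRoot ω (2 * l + 1)) :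
    IsPrimitiveRoot (ω ^ 2) (2 * l + 1) :=
  hω.pow_of_coprime 2 (by simp)

lemma prod_prodA_rootNode (hp0 : 0 < p) (hp1 : p < 1) (hω : IsPrimitiveRoot ω (2 * l + 1)) :
    (∏ i : Fin l, prodA p (rootNode ω i)) * (qPoch (p ^ 4) (p ^ 4) * qPoch p (p ^ 2)) =
      qPoch (p ^ (4 * (2 * l + 1))) (p ^ (4 * (2 * l + 1))) *
        qPoch (p ^ (2 * l + 1)) (p ^ (2 * (2 * l + 1))) := by
  have h2 := pow_pos hp0 2
  have h4 := pow_pos hp0 4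
  have h2' : p ^ 2 < 1 := pow_lt_one₀ hp0.le hp1 two_ne_zero
  have h4' : p ^ 4 < 1 := pow_lt_one₀ hp0.le hp1 (by norm_num)
  have e1 := prod_qPoch_mul_rootNode h4 h4' (isPrimitiveRoot_sq hω) (p ^ 4)
  have e2 := prod_qPoch_mul_rootNode h2 h2' hω p
  rw [← pow_mul, ← pow_mul] at e1
  rw [← pow_mul] at e2
  rw [← e1, ← e2]
  simp only [prodA, inv_pow, rootNode_sq, Finset.prod_mul_distrib]
  ring

lemma prodG_eq (x y : ℂ) : prodG p x y =
    (qPoch (p ^ 2 * x * y) (p ^ 2) * qPoch (p ^ 2 * x * y⁻¹) (p ^ 2)) *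
      (qPoch (p ^ 2 * x⁻¹ * y) (p ^ 2) * qPoch (p ^ 2 * x⁻¹ * y⁻¹) (p ^ 2)) := by
  rw [prodG, mul_inv]
  simp only [← mul_assoc]
  ring

lemma prodG_comm (x y : ℂ) : prodG p x y = prodG p y x := by
  rw [prodG, prodG, mul_comm y x, mul_comm y x⁻¹, mul_comm y⁻¹ x]
  ring

lemma prod_prod_prodG_rootNode_sq (hp0 : 0 < p) (hp1 : p < 1)
    (hω : IsPrimitiveRoot ω (2 * l + 1)) :
    (∏ i : Fin l, ∏ j ∈ Finset.Ioi i, prodG p (rootNode ω i) (rootNode ω j)) ^ 2 *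
      (qPoch (p ^ 2) (p ^ 2) ^ l * qPoch (p ^ (2 * (2 * l + 1))) (p ^ (2 * (2 * l + 1)))) ^ 2 =
      (qPoch (p ^ (2 * (2 * l + 1))) (p ^ (2 * (2 * l + 1))) ^ l * qPoch (p ^ 2) (p ^ 2)) ^ 2 := by
  have h2 := pow_pos hp0 2
  have h2' : p ^ 2 < 1 := pow_lt_one₀ hp0.le hp1 two_ne_zero
  set φ := qPoch (p ^ 2) (p ^ 2) with hφ
  set Ψ := qPoch (p ^ (2 * (2 * l + 1))) (p ^ (2 * (2 * l + 1))) with hΨ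
  have hY : ∀ y : ℂ, y ^ (2 * l + 1) = 1 → qPoch (p ^ 2 * y) (p ^ 2) *
      ∏ j : Fin l, qPoch (p ^ 2 * y * rootNode ω j) (p ^ 2) *
        qPoch (p ^ 2 * y * (rootNode ω j)⁻¹) (p ^ 2) = Ψ := fun y hy => by
    rw [prod_qPoch_mul_rootNode h2 h2' hω, mul_pow, hy, mul_one, ← pow_mul, ← pow_mul]
  have hy := fun i : Fin l => rootNode_pow hω i
  have hy' : ∀ i : Fin l, (rootNode ω i)⁻¹ ^ (2 * l + 1) = 1 := fun i => by
    rw [inv_pow, hy, inv_one]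
  have hone : φ * ∏ i : Fin l, qPoch (p ^ 2 * rootNode ω i) (p ^ 2) *
      qPoch (p ^ 2 * (rootNode ω i)⁻¹) (p ^ 2) = Ψ := by
    simpa using hY 1 (one_pow _)
  have hfull : (∏ i : Fin l, ∏ j : Fin l, prodG p (rootNode ω i) (rootNode ω j)) *
      ∏ i : Fin l, qPoch (p ^ 2 * rootNode ω i) (p ^ 2) *
      qPoch (p ^ 2 * (rootNode ω i)⁻¹) (p ^ 2) = Ψ ^ (2 * l) := by
    rw [← Finset.prod_mul_distrib]
    have : Ψ ^ (2 * l) = ∏ _i : Fin l, Ψ * Ψ := by simp [pow_mul, sq]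
    rw [this]
    refine Finset.prod_congr rfl fun i _ => ?_
    simp only [prodG_eq, Finset.prod_mul_distrib]
    have a1 := hY _ (hy i)
    have a2 := hY _ (hy' i)
    simp only [Finset.prod_mul_distrib] at a1 a2
    have a3 := congrArg₂ (· * ·) a1 a2
    beta_reduce at a3
    linear_combination a3
  have hdiag : φ * ∏ i : Fin l, prodG p (rootNode ω i) (rootNode ω i) = φ ^ (2 * l) * Ψ := by
    have e := prod_qPoch_mul_rootNode h2 h2' (isPrimitiveRoot_sq hω) (p ^ 2)
    rw [← pow_mul, ← pow_mul, ← hφ, ← hΨ] at e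
    have : φ ^ (2 * l) = ∏ _i : Fin l, φ ^ 2 := by simp [pow_mul]
    rw [← e, this, mul_left_comm, ← Finset.prod_mul_distrib]
    congr 1
    refine Finset.prod_congr rfl fun i _ => ?_
    have h0 := rootNode_ne_zero hω i
    rw [prodG, mul_inv_cancel₀ h0, inv_mul_cancel₀ h0, mul_one, ← sq, rootNode_sq, ← hφ]
    ring
  rw [prod_prod_eq_diag_mul_sq _ fun i j => prodG_comm _ _] at hfull
  generalize (∏ i : Fin l, ∏ j ∈ Finset.Ioi i, prodG p (rootNode ω i) (rootNode ω j)) = B at *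
  generalize (∏ i : Fin l, prodG p (rootNode ω i) (rootNode ω i)) = D at *
  generalize (∏ i : Fin l, qPoch (p ^ 2 * rootNode ω i) (p ^ 2) *
      qPoch (p ^ 2 * (rootNode ω i)⁻¹) (p ^ 2)) = E at *
  calc _ = B ^ 2 * (φ ^ (2 * l) * Ψ) * Ψ := by ring
    _ = (D * B ^ 2 * E) * φ ^ 2 := by rw [← hdiag, ← hone]; ring
    _ = _ := by rw [hfull]; ring

lemma prodG_of_norm_eq_one (hp0 : 0 < p) (hp1 : p < 1) {x y : ℂ} (hx : ‖x‖ = 1) (hy : ‖y‖ = 1) :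
    ∃ b : ℝ, 0 ≤ b ∧ prodG p x y = b := by
  have h2 := pow_pos hp0 2
  have h2' : p ^ 2 < 1 := pow_lt_one₀ hp0.le hp1 two_ne_zero
  have key : ∀ z : ℂ, ‖z‖ = 1 → qPoch (p ^ 2 * z) (p ^ 2) * qPoch (p ^ 2 * z⁻¹) (p ^ 2) =
      ((Complex.normSq (qPoch (p ^ 2 * z) (p ^ 2)) : ℝ) : ℂ) := by
    intro z hz
    rw [Complex.inv_eq_conj hz, ← Complex.mul_conj, ← qPoch_conj h2 h2']
    simp
  refine ⟨_, mul_nonneg (Complex.normSq_nonneg (qPoch (p ^ 2 * (x * y)) (p ^ 2)))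
    (Complex.normSq_nonneg (qPoch (p ^ 2 * (x * y⁻¹)) (p ^ 2))), ?_⟩
  have e : x⁻¹ * y = (x * y⁻¹)⁻¹ := by rw [mul_inv, inv_inv]
  rw [prodG, e, key _ (by simp [hx, hy]), key _ (by simp [hx, hy])]
  push_cast
  rfl

lemma qPoch_self_pos {q : ℝ} (hq0 : 0 < q) (hq1 : q < 1) :
    ∃ b : ℝ, 0 < b ∧ qPoch q q = b := by
  refine ⟨_, ?_, qPoch_ofReal hq0 hq1 q⟩
  refine lt_of_le_of_ne ?_ ?_
  · refine (multipliable_qPoch_real hq0 hq1 q).hasProd.nonneg fun n => ?_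
    have : q ^ n ≤ 1 := pow_le_one₀ hq0.le hq1.le
    nlinarith
  · intro h
    have h1 := qPoch_ne_zero hq0 hq1 (norm_ofReal_lt_one hq0 hq1)
    rw [qPoch_ofReal hq0 hq1, ← h] at h1
    simp at h1

lemma prod_prod_prodG_rootNode (hp0 : 0 < p) (hp1 : p < 1)
    (hω : IsPrimitiveRoot ω (2 * l + 1)) :
    (∏ i : Fin l, ∏ j ∈ Finset.Ioi i, prodG p (rootNode ω i) (rootNode ω j)) *
      (qPoch (p ^ 2) (p ^ 2) ^ l * qPoch (p ^ (2 * (2 * l + 1))) (p ^ (2 * (2 * l + 1)))) =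
      qPoch (p ^ (2 * (2 * l + 1))) (p ^ (2 * (2 * l + 1))) ^ l * qPoch (p ^ 2) (p ^ 2) := by
  have hn : ∀ i : Fin l, ‖rootNode ω i‖ = 1 := fun i => by
    rw [rootNode, norm_pow, hω.norm'_eq_one (by omega), one_pow]
  have hsq := prod_prod_prodG_rootNode_sq hp0 hp1 hω
  obtain ⟨f, hf, ef⟩ := qPoch_self_pos (pow_pos hp0 2) (pow_lt_one₀ hp0.le hp1 two_ne_zero)
  obtain ⟨g, hg, eg⟩ := qPoch_self_pos (pow_pos hp0 (2 * (2 * l + 1)))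
    (pow_lt_one₀ hp0.le hp1 (by omega))
  choose b hb eb using fun i j : Fin l => prodG_of_norm_eq_one hp0 hp1 (hn i) (hn j)
  push_cast at ef eg
  simp only [ef, eg, eb] at hsq ⊢
  norm_cast at hsq ⊢
  rw [← mul_pow] at hsq
  have hB : 0 ≤ ∏ i : Fin l, ∏ j ∈ Finset.Ioi i, b i j :=
    Finset.prod_nonneg fun i _ => Finset.prod_nonneg fun j _ => hb i j
  exact (pow_left_inj₀ (by positivity) (by positivity) two_ne_zero).mp hsq

lemma prodQ_one :
    prodQ p (fun _ : Fin l => 1) * qPoch (p ^ 2) (p ^ 2) ^ (2 * l) =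
      (qPoch (p ^ 4) (p ^ 4) ^ 2 * qPoch p (p ^ 2) ^ 2) ^ l * qPoch (p ^ 2) (p ^ 2) ^ (2 * l * l) := by
  set φ := qPoch (p ^ 2) (p ^ 2) with hφ
  have h := prod_prod_eq_diag_mul_sq (fun _ _ : Fin l => φ ^ 2) fun _ _ => rfl
  have hA : prodA p 1 = qPoch (p ^ 4) (p ^ 4) ^ 2 * qPoch p (p ^ 2) ^ 2 := by
    simp only [prodA, inv_one, one_pow, mul_one]
    ring
  have hG : prodG p 1 1 = (φ ^ 2) ^ 2 := by
    simp only [prodG, inv_one, mul_one, ← hφ]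
    ring
  simp only [prodQ, hA, hG, Finset.prod_pow] at h ⊢
  simp only [Finset.prod_const, Finset.card_univ, Fintype.card_fin] at h ⊢
  rw [mul_assoc, mul_comm _ (φ ^ (2 * l))]
  congr 1
  have e : φ ^ (2 * l * l) = ((φ ^ l) ^ l) ^ 2 := by ring
  rw [e, h]
  ring

lemma prod_thetaSeries (hp0 : 0 < p) (hp1 : p < 1) :
    (∏ j : Fin l, thetaSeries (p ^ (2 * l + 1)) (p ^ (2 * ((j : ℕ) + 1)))) *
      qPoch (-(p ^ (2 * l + 1))) (p ^ (2 * (2 * l + 1))) =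
      qPoch (p ^ (2 * (2 * l + 1))) (p ^ (2 * (2 * l + 1))) ^ l * qPoch (-p) (p ^ 2) := by
  have h2 := pow_pos hp0 2
  have h2' : p ^ 2 < 1 := pow_lt_one₀ hp0.le hp1 two_ne_zero
  rw [← qPoch_eq_prod_range h2 h2' (-p) (by omega : 0 < 2 * l + 1), prod_range_two_mul_add_one]
  have e : ∀ r : ℕ, qPoch (-(p : ℂ) * ((p ^ 2 : ℝ) : ℂ) ^ r) ((p ^ 2) ^ (2 * l + 1)) =
      qPoch (-(p ^ (2 * r + 1))) (p ^ (2 * (2 * l + 1))) := fun r => by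
    rw [← pow_mul]
    congr 1
    push_cast
    ring
  simp only [e]
  rw [mul_left_comm, mul_comm]
  congr 1
  have : ∀ Ψ : ℂ, Ψ ^ l = ∏ _j : Fin l, Ψ := fun Ψ => by simp
  rw [this, ← Finset.prod_mul_distrib]
  refine Finset.prod_congr rfl fun j _ => ?_
  have a1 : 2 * l + 1 + 2 * ((j : ℕ) + 1) = 2 * (l + ((j : ℕ) + 1)) + 1 := by omega
  have a2 : 2 * l + 1 - 2 * ((j : ℕ) + 1) = 2 * (l - ((j : ℕ) + 1)) + 1 := by omega
  rw [thetaSeries_eq_prod_pow hp0 hp1 (by omega) (by omega), mul_assoc, a1, a2]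

lemma tsum_oddWeight_mul_polyProd (hp0 : 0 < p) (hp1 : p < 1) :
    ((∑' m : Fin l → ℤ, oddWeight p m * polyProd fun i => (oddExp m i : ℝ) : ℝ) : ℂ) *
      qPoch (p ^ 2) (p ^ 2) ^ l =
      ((polyProd fun i : Fin l => ((i : ℕ) + 1 : ℝ) : ℝ) : ℂ) *
        ((qPoch (p ^ 4) (p ^ 4) ^ 2 * qPoch p (p ^ 2) ^ 2) ^ l *
          qPoch (p ^ 2) (p ^ 2) ^ (2 * l * l)) := by
  obtain ⟨ω, hω⟩ : ∃ ω : ℂ, IsPrimitiveRoot ω (2 * l + 1) :=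
    ⟨_, Complex.isPrimitiveRoot_exp (2 * l + 1) (by omega)⟩
  have h1 := polyProd_mul_prodQ_one hp0 hp1 hω
  have hA := prod_prodA_rootNode hp0 hp1 hω
  have hB := prod_prod_prodG_rootNode hp0 hp1 hω
  have hQ := prodQ_one (p := p) (l := l)
  have hT := prod_thetaSeries (l := l) hp0 hp1
  have e1 := qPoch_euler hp0 hp1
  have e2 := qPoch_euler (pow_pos hp0 (2 * l + 1)) (pow_lt_one₀ hp0.le hp1 (by omega))
  have c2 : 2 * (2 * l + 1) = (2 * l + 1) * 2 := mul_comm _ _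
  have c4 : 4 * (2 * l + 1) = (2 * l + 1) * 4 := mul_comm _ _
  push_cast at e2
  simp only [← pow_mul, ← c2, ← c4] at e2
  have n1 : qPoch (p ^ 2) (p ^ 2) ≠ 0 := by
    have := qPoch_ne_zero (pow_pos hp0 2) (pow_lt_one₀ hp0.le hp1 two_ne_zero)
      (norm_ofReal_lt_one (pow_pos hp0 2) (pow_lt_one₀ hp0.le hp1 two_ne_zero))
    simpa using this
  have n2 : qPoch (p ^ (2 * (2 * l + 1))) (p ^ (2 * (2 * l + 1))) ≠ 0 := by
    have := qPoch_ne_zero (pow_pos hp0 (2 * (2 * l + 1))) (pow_lt_one₀ hp0.le hp1 (by omega))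
      (norm_ofReal_lt_one (pow_pos hp0 (2 * (2 * l + 1))) (pow_lt_one₀ hp0.le hp1 (by omega)))
    simpa using this
  rw [show prodQ p (rootNode ω : Fin l → ℂ) = _ * _ from rfl] at h1
  generalize ((∑' m : Fin l → ℤ, oddWeight p m * polyProd fun i => (oddExp m i : ℝ) : ℝ) : ℂ) = S at *
  generalize ((polyProd fun i : Fin l => ((i : ℕ) + 1 : ℝ) : ℝ) : ℂ) = w at *
  generalize qPoch (p ^ 2) (p ^ 2) = φ at *
  generalize qPoch (p ^ (2 * (2 * l + 1))) (p ^ (2 * (2 * l + 1))) = Ψ at *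
  generalize (∏ i : Fin l, prodA p (rootNode ω i)) = A at *
  generalize (∏ i : Fin l, ∏ j ∈ Finset.Ioi i, prodG p (rootNode ω i) (rootNode ω j)) = B at *
  generalize (∏ j : Fin l, thetaSeries (p ^ (2 * l + 1)) (p ^ (2 * ((j : ℕ) + 1)))) = T at *
  generalize prodQ p (fun _ : Fin l => 1) = Q at *
  generalize qPoch (-(p ^ (2 * l + 1))) (p ^ (2 * (2 * l + 1))) = D at *
  generalize qPoch (p ^ 4) (p ^ 4) = φ₄ at *
  generalize qPoch p (p ^ 2) = c at *
  have key : S = w * Q * φ ^ l := by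
    refine mul_right_cancel₀ (mul_ne_zero (mul_ne_zero (pow_ne_zero l n2) n1) n2) ?_
    linear_combination -S * Ψ * hB + S * B * φ ^ l * Ψ * e2 - S * B * φ ^ l * Ψ * D * hA -
      φ ^ l * Ψ * D * φ₄ * c * h1 + w * Q * φ ^ l * Ψ * φ₄ * c * hT - w * Q * φ ^ l * Ψ * Ψ ^ l * e1
  rw [key, ← hQ]
  ring

end ProductEvaluation

section RootSystem

variable {l : ℕ}

lemma eps_apply {n : ℕ} (i j : Fin n) : eps i j = if j = i then 1 else 0 := by
  simp [eps, Pi.single_apply]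

@[to_additive]
lemma prod_filter_fst_lt_snd {M : Type*} [CommMonoid M] {l : ℕ} (f : Fin l → Fin l → M) :
    ∏ r ∈ Finset.univ.filter (fun r : Fin l × Fin l => r.1 < r.2), f r.1 r.2 =
      ∏ i, ∏ j ∈ Finset.Ioi i, f i j := by
  rw [Finset.prod_filter, Fintype.prod_prod_type]
  refine Finset.prod_congr rfl fun i _ => ?_
  rw [← Finset.prod_filter]
  refine Finset.prod_congr ?_ fun _ _ => rfl
  ext j
  simp

lemma sum_eps {n : ℕ} (i : Fin n) : ∑ k, eps i k = 1 := by
  simp [eps_apply]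

lemma injOn_eps_sub : Set.InjOn (fun r : Fin l × Fin l => eps r.1 - eps r.2)
    (Finset.univ.filter fun r : Fin l × Fin l => r.1 < r.2) := by
  rintro ⟨a, b⟩ hab ⟨c, d⟩ hcd h
  simp only [Finset.coe_filter, Finset.mem_univ, true_and, Set.mem_ofPred_eq] at hab hcd
  have h1 := congrFun h a
  have h2 := congrFun h b
  simp only [Pi.sub_apply, eps_apply] at h1 h2
  rw [if_pos trivial, if_neg hab.ne] at h1
  rw [if_pos trivial, if_neg hab.ne'] at h2
  have hac : a = c := by
    by_contra hne
    rw [if_neg hne] at h1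
    split_ifs at h1 <;> norm_num at h1
  have hbd : b = d := by
    by_contra hne
    rw [if_neg hne] at h2
    split_ifs at h2 <;> norm_num at h2
  rw [hac, hbd]

lemma injOn_eps_add : Set.InjOn (fun r : Fin l × Fin l => eps r.1 + eps r.2)
    (Finset.univ.filter fun r : Fin l × Fin l => r.1 < r.2) := by
  rintro ⟨a, b⟩ hab ⟨c, d⟩ hcd h
  simp only [Finset.coe_filter, Finset.mem_univ, true_and, Set.mem_ofPred_eq] at hab hcd
  have h1 := congrFun h a
  have h2 := congrFun h b
  simp only [Pi.add_apply, eps_apply] at h1 h2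
  rw [if_pos trivial, if_neg hab.ne] at h1
  rw [if_pos trivial, if_neg hab.ne'] at h2
  have ha : a = c ∨ a = d := by
    by_contra! hne
    rw [if_neg hne.1, if_neg hne.2] at h1
    norm_num at h1
  have hb : b = c ∨ b = d := by
    by_contra! hne
    rw [if_neg hne.1, if_neg hne.2] at h2
    norm_num at h2
  simp only [Prod.mk.injEq]
  omega

lemma injective_two_smul_eps : Function.Injective fun i : Fin l => (2 : ℝ) • eps i := by
  intro a b h
  have h1 := congrFun h a
  simp only [Pi.smul_apply, eps_apply, smul_eq_mul] at h1
  by_contra hab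
  simp [hab] at h1

@[to_additive]
lemma prod_posC {M : Type*} [CommMonoid M] (f : (Fin l → ℝ) → M) :
    ∏ α ∈ posC l, f α = (∏ i, ∏ j ∈ Finset.Ioi i, f (eps i - eps j)) *
      (∏ i, ∏ j ∈ Finset.Ioi i, f (eps i + eps j)) * ∏ i : Fin l, f ((2 : ℝ) • eps i) := by
  have hs : ∀ (u v : Fin l → ℝ), u = v → ∑ k, u k = ∑ k, v k := fun u v h => by rw [h]
  rw [posC, Finset.prod_union, Finset.prod_union, Finset.prod_image injOn_eps_sub,
    Finset.prod_image injOn_eps_add, Finset.prod_image injective_two_smul_eps.injOn,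
    prod_filter_fst_lt_snd fun i j => f (eps i - eps j),
    prod_filter_fst_lt_snd fun i j => f (eps i + eps j)]
  · rw [Finset.disjoint_left]
    intro v h1 h2
    simp only [Finset.mem_image] at h1 h2
    obtain ⟨r, -, rfl⟩ := h1
    obtain ⟨r', -, h⟩ := h2
    have := hs _ _ h
    simp [Finset.sum_add_distrib, Finset.sum_sub_distrib, sum_eps] at this
  · rw [Finset.disjoint_left]
    intro v h1 h2
    simp only [Finset.mem_image, Finset.mem_union, Finset.mem_filter] at h1 h2
    obtain ⟨i, -, rfl⟩ := h2
    rcases h1 with ⟨r, -, h⟩ | ⟨r, hr, h⟩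
    · have := hs _ _ h
      simp [Finset.sum_sub_distrib, ← Finset.mul_sum, sum_eps] at this
    · have := congrFun h r.1
      have hne : r.1 ≠ r.2 := hr.2.ne
      simp only [Pi.add_apply, Pi.smul_apply, eps_apply, smul_eq_mul, if_neg hne] at this
      split_ifs at this <;> norm_num at *

lemma rhoC_apply (k : Fin l) : rhoC l k = (l : ℝ) - (k : ℕ) := by
  have h : ∀ i : Fin l, (∑ j ∈ Finset.Ioi i, (eps i - eps j)) + ∑ j ∈ Finset.Ioi i, (eps i + eps j) =
      (2 * ((l : ℝ) - 1 - (i : ℕ))) • eps i := by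
    intro i
    rw [← Finset.sum_add_distrib]
    have : ∀ j : Fin l, eps i - eps j + (eps i + eps j) = (2 : ℝ) • eps i := fun j => by
      rw [two_smul]; abel
    simp only [this, Finset.sum_const, Fin.card_Ioi]
    rw [← Nat.cast_smul_eq_nsmul ℝ, smul_smul, Nat.sub_sub, Nat.cast_sub (by omega)]
    congr 1
    push_cast
    ring
  rw [rhoC, sum_posC, ← Finset.sum_add_distrib, ← Finset.sum_add_distrib]
  simp only [h, ← add_smul, Pi.smul_apply, Finset.sum_apply, eps_apply, smul_eq_mul]
  simp
  ring

lemma ip_eps {n : ℕ} (v : Fin n → ℝ) (i : Fin n) : ip v (eps i) = v i := by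
  simp [ip, eps_apply]

lemma ip_eps_sub {n : ℕ} (v : Fin n → ℝ) (i j : Fin n) : ip v (eps i - eps j) = v i - v j := by
  rw [← ip_eps v i, ← ip_eps v j]
  simp [ip, mul_sub]

lemma ip_eps_add {n : ℕ} (v : Fin n → ℝ) (i j : Fin n) : ip v (eps i + eps j) = v i + v j := by
  rw [← ip_eps v i, ← ip_eps v j]
  simp [ip, mul_add, Finset.sum_add_distrib]

lemma ip_two_smul_eps {n : ℕ} (v : Fin n → ℝ) (i : Fin n) : ip v ((2 : ℝ) • eps i) = 2 * v i := by
  rw [← ip_eps v i]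
  simp only [ip, Finset.mul_sum, Pi.smul_apply, smul_eq_mul]
  exact Finset.sum_congr rfl fun _ _ => by ring

lemma prod_posC_ip (v : Fin l → ℝ) : ∏ α ∈ posC l, ip v α = 2 ^ l * polyProd v := by
  rw [prod_posC]
  simp only [ip_eps_sub, ip_eps_add, ip_two_smul_eps, ← Finset.prod_mul_distrib, polyProd, sq_sub_sq]
  simp only [Finset.prod_mul_distrib]
  simp
  ring

lemma dC_eq (v : Fin l → ℝ) : dC l v = polyProd (v + rhoC l) / polyProd (rhoC l) := by
  rw [dC, Finset.prod_div_distrib, prod_posC_ip, prod_posC_ip]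
  exact mul_div_mul_left _ _ (by positivity)

lemma mem_corootLatC {v : Fin l → ℝ} : v ∈ corootLatC l ↔ ∃ m : Fin l → ℤ, v = fun i => (m i : ℝ) := by
  have hone : ∀ i : Fin l, eps i = fun k => (((if k = i then 1 else 0 : ℤ)) : ℝ) := fun i => by
    ext k
    simp [eps_apply]
  constructor
  · intro h
    induction h using AddSubgroup.closure_induction with
    | mem x hx =>
      obtain ⟨α, hα, rfl⟩ := hx
      have key : ∀ α ∈ posC l, ∃ m : Fin l → ℤ, (2 / ip α α) • α = fun i => (m i : ℝ) := by
        intro α hα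
        simp only [posC, Finset.mem_union, Finset.mem_image, Finset.mem_filter, Finset.mem_univ,
          true_and] at hα
        rcases hα with (⟨⟨i, j⟩, hij, rfl⟩ | ⟨⟨i, j⟩, hij, rfl⟩) | ⟨i, rfl⟩
        · have : ip (eps i - eps j) (eps i - eps j) = 2 := by
            rw [ip_eps_sub]
            simp [eps_apply, hij.ne, hij.ne']
            norm_num
          refine ⟨fun k => (if k = i then 1 else 0) - (if k = j then 1 else 0), ?_⟩
          rw [this, hone i, hone j]
          ext k
          simp
        · have : ip (eps i + eps j) (eps i + eps j) = 2 := by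
            rw [ip_eps_add]
            simp [eps_apply, hij.ne, hij.ne']
            norm_num
          refine ⟨fun k => (if k = i then 1 else 0) + (if k = j then 1 else 0), ?_⟩
          rw [this, hone i, hone j]
          ext k
          simp
        · have : ip ((2 : ℝ) • eps i) ((2 : ℝ) • eps i) = 4 := by
            rw [ip_two_smul_eps]
            simp [eps_apply]
            norm_num
          refine ⟨fun k => if k = i then 1 else 0, ?_⟩
          rw [this, ← hone, smul_smul]
          norm_num
      rcases hα with hα | hα
      · exact key α hα
      · obtain ⟨m, hm⟩ := key _ hα
        refine ⟨-m, ?_⟩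
        have e : ip (-α) (-α) = ip α α := by simp [ip]
        rw [e, smul_neg] at hm
        rw [← neg_neg ((2 / ip α α) • α), hm]
        ext k
        simp
    | zero => exact ⟨0, by ext; simp⟩
    | add x y _ _ hx hy =>
      obtain ⟨m, rfl⟩ := hx
      obtain ⟨n, rfl⟩ := hy
      exact ⟨m + n, by ext; simp⟩
    | neg x _ hx =>
      obtain ⟨m, rfl⟩ := hx
      exact ⟨-m, by ext; simp⟩
  · rintro ⟨m, rfl⟩
    have e : (fun i => (m i : ℝ)) = ∑ i, m i • eps i := by
      ext k
      simp [eps_apply]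
    rw [e]
    refine sum_mem fun i _ => zsmul_mem ?_ _
    refine AddSubgroup.subset_closure ?_
    refine ⟨(2 : ℝ) • eps i, .inl ?_, ?_⟩
    · simp only [posC, Finset.mem_union, Finset.mem_image, Finset.mem_univ, true_and]
      exact .inr ⟨i, rfl⟩
    · have : ip ((2 : ℝ) • eps i) ((2 : ℝ) • eps i) = 4 := by
        rw [ip_two_smul_eps]
        simp [eps_apply]
        norm_num
      rw [this, smul_smul]
      norm_num

lemma polyProd_comp_rev (v : Fin l → ℝ) : polyProd (fun i => v i.rev) =
    (∏ i : Fin l, ∏ _j ∈ Finset.Ioi i, (-1 : ℝ)) * polyProd v := by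
  have h1 : ∏ i : Fin l, v i.rev = ∏ i, v i := Equiv.prod_comp Fin.revPerm v
  have h2 : ∏ i : Fin l, ∏ j ∈ Finset.Ioi i, (v i.rev ^ 2 - v j.rev ^ 2) =
      ∏ i, ∏ j ∈ Finset.Ioi i, (v j ^ 2 - v i ^ 2) := by
    rw [← prod_filter_fst_lt_snd fun i j : Fin l => v i.rev ^ 2 - v j.rev ^ 2,
      ← prod_filter_fst_lt_snd fun i j : Fin l => v j ^ 2 - v i ^ 2]
    refine Finset.prod_nbij' (fun r => (r.2.rev, r.1.rev)) (fun r => (r.2.rev, r.1.rev)) ?_ ?_ ?_ ?_ ?_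
      <;> simp
  rw [polyProd, polyProd, h1, h2, mul_left_comm]
  congr 1
  simp only [← Finset.prod_mul_distrib]
  exact Finset.prod_congr rfl fun i _ => Finset.prod_congr rfl fun j _ => by ring

lemma polyProd_comp_rev_div (u v : Fin l → ℝ) :
    polyProd (fun i => u i.rev) / polyProd (fun i => v i.rev) = polyProd u / polyProd v := by
  rw [polyProd_comp_rev, polyProd_comp_rev]
  refine mul_div_mul_left _ _ ?_
  exact Finset.prod_ne_zero_iff.mpr fun i _ => Finset.prod_ne_zero_iff.mpr fun j _ => by norm_num

end RootSystem

section Eta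

variable {p q : ℝ} {l : ℕ}

/-- The Euler product `∏_{n ≥ 1} (1 - qⁿ)`. -/
noncomputable def eulerProd (q : ℝ) : ℝ := ∏' n : ℕ, (1 - q ^ (n + 1))

lemma qPoch_self (hq0 : 0 < q) (hq1 : q < 1) : qPoch q q = (eulerProd q : ℂ) := by
  rw [qPoch_ofReal hq0 hq1]
  simp only [eulerProd, pow_succ']

lemma eulerProd_pos (hq0 : 0 < q) (hq1 : q < 1) : 0 < eulerProd q := by
  obtain ⟨b, hb, h⟩ := qPoch_self_pos hq0 hq1
  rw [qPoch_self hq0 hq1, Complex.ofReal_inj] at h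
  rwa [h]

lemma tsum_oddWeight_mul_polyProd_eq (hl : 1 ≤ l) (hp0 : 0 < p) (hp1 : p < 1) :
    ∑' m : Fin l → ℤ, oddWeight p m * polyProd (fun i => (oddExp m i : ℝ)) =
      polyProd (fun i : Fin l => ((i : ℕ) : ℝ) + 1) * (eulerProd p ^ 2 *
        eulerProd (p ^ 2) ^ (2 * (l : ℤ) - 3) * eulerProd ((p ^ 2) ^ 2) ^ 2) ^ l := by
  have hq0 : 0 < p ^ 2 := by positivity
  have hq1 : p ^ 2 < 1 := pow_lt_one₀ hp0.le hp1 two_ne_zero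
  have hr0 : 0 < p ^ 4 := by positivity
  have hr1 : p ^ 4 < 1 := pow_lt_one₀ hp0.le hp1 four_ne_zero
  have key := tsum_oddWeight_mul_polyProd (l := l) hp0 hp1
  have hsplit := qPoch_eq_prod_range hp0 hp1 (p : ℂ) Nat.two_pos
  have e2 : qPoch ((p : ℂ) ^ 2) (p ^ 2) = (eulerProd (p ^ 2) : ℂ) := by
    rw [← qPoch_self hq0 hq1, Complex.ofReal_pow]
  have e4 : qPoch ((p : ℂ) ^ 4) (p ^ 4) = (eulerProd (p ^ 4) : ℂ) := by
    rw [← qPoch_self hr0 hr1, Complex.ofReal_pow]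
  rw [Finset.prod_range_succ, Finset.prod_range_one, pow_zero, mul_one, pow_one, ← pow_two, e2,
    qPoch_self hp0 hp1, qPoch_ofReal hq0 hq1] at hsplit
  rw [e2, e4, qPoch_ofReal hq0 hq1] at key
  rw [← pow_mul]
  norm_num only
  generalize ∏' n : ℕ, (1 - p * (p ^ 2) ^ n) = c at hsplit key
  have hφ := eulerProd_pos hq0 hq1
  generalize eulerProd (p ^ 2) = φ at *
  norm_cast at hsplit key
  rw [← hsplit]
  obtain ⟨k, rfl⟩ := Nat.exists_eq_add_of_le' hl
  have hz : φ ^ 2 * φ ^ (2 * ((k + 1 : ℕ) : ℤ) - 3) * φ = φ ^ (2 * (k + 1)) := by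
    rw [← zpow_natCast, ← zpow_natCast, ← zpow_add₀ hφ.ne', ← zpow_add_one₀ hφ.ne']
    congr 1
    push_cast
    ring
  refine mul_right_cancel₀ (pow_ne_zero (k + 1) hφ.ne') ?_
  have hk : eulerProd (p ^ 4) ^ 2 * c ^ 2 * φ ^ (2 * (k + 1)) =
      (c * φ) ^ 2 * φ ^ (2 * ((k + 1 : ℕ) : ℤ) - 3) * eulerProd (p ^ 4) ^ 2 * φ := by
    rw [← hz]
    ring
  rw [mul_assoc, ← mul_pow, ← hk, mul_pow _ (φ ^ _), ← pow_mul]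
  exact_mod_cast key

lemma eta_pow_mul_eq (hq0 : 0 < q) :
    (eta (q ^ ((1 : ℝ) / 2)) ^ 2 * eta q ^ (2 * (l : ℤ) - 3) * eta (q ^ 2) ^ 2) ^ l =
      q ^ ((l : ℝ) * (l + 1) / 12) * (eulerProd (q ^ ((1 : ℝ) / 2)) ^ 2 *
        eulerProd q ^ (2 * (l : ℤ) - 3) * eulerProd (q ^ 2) ^ 2) ^ l := by
  have hη : ∀ x : ℝ, eta x = x ^ ((1 : ℝ) / 24) * eulerProd x := fun _ => rfl
  simp only [hη, mul_pow, mul_zpow]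
  have h : (((q ^ ((1 : ℝ) / 2)) ^ ((1 : ℝ) / 24)) ^ 2) ^ l *
      ((q ^ ((1 : ℝ) / 24)) ^ (2 * (l : ℤ) - 3)) ^ l * (((q ^ 2) ^ ((1 : ℝ) / 24)) ^ 2) ^ l =
      q ^ ((l : ℝ) * (l + 1) / 12) := by
    rw [← Real.rpow_natCast q 2]
    simp only [← Real.rpow_natCast, ← Real.rpow_intCast, ← Real.rpow_mul hq0.le,
      ← Real.rpow_add hq0]
    congr 1
    push_cast
    ring
  rw [← h]
  ring

lemma sum_succ_sq_div (l : ℕ) : (∑ j : Fin l, (((j : ℕ) : ℝ) + 1) ^ 2) / (2 * (2 * l + 1)) =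
    (l : ℝ) * (l + 1) / 12 := by
  have h : ∑ j : Fin l, (((j : ℕ) : ℝ) + 1) ^ 2 = (l : ℝ) * (l + 1) * (2 * l + 1) / 6 := by
    rw [Fin.sum_univ_eq_sum_range (fun j => ((j : ℝ) + 1) ^ 2)]
    induction l with
    | zero => simp
    | succ k ih =>
      rw [Finset.sum_range_succ, ih]
      push_cast
      ring
  rw [h]
  have : (2 * (l : ℝ) + 1) ≠ 0 := by positivity
  field_simp
  ring

lemma rpow_sum_oddExp_sq (hq0 : 0 < q) (m : Fin l → ℤ) :
    q ^ ((∑ j, (oddExp m j : ℝ) ^ 2) / (2 * (2 * l + 1))) =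
      q ^ ((l : ℝ) * (l + 1) / 12) * oddWeight (q ^ ((1 : ℝ) / 2)) m := by
  have hw : oddWeight (q ^ ((1 : ℝ) / 2)) m =
      q ^ (∑ j, ((2 * l + 1) * (m j : ℝ) ^ 2 / 2 + ((j : ℕ) + 1) * m j)) := by
    rw [oddWeight, Real.rpow_sum_of_pos hq0]
    refine Finset.prod_congr rfl fun j _ => ?_
    simp only [← Real.rpow_natCast, ← Real.rpow_intCast, ← Real.rpow_mul hq0.le,
      ← Real.rpow_add hq0]
    congr 1
    push_cast
    rw [Real.rpow_two]
    ring
  rw [hw, ← Real.rpow_add hq0, ← sum_succ_sq_div, Finset.sum_div, Finset.sum_div,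
    ← Finset.sum_add_distrib]
  congr 1
  refine Finset.sum_congr rfl fun j _ => ?_
  rw [oddExp]
  have : (2 * (l : ℝ) + 1) ≠ 0 := by positivity
  push_cast
  field_simp
  ring

end Eta

section Lattice

variable {l : ℕ}

/-- Integer vectors parametrize `(2l+1)·Q((R')^∨)`, with the coordinates in reverse order. -/
noncomputable def latticeEquiv (l : ℕ) : (Fin l → ℤ) ≃
    {x : Fin l → ℝ // ∃ y ∈ corootLatC l, x = ((2 * l + 1 : ℕ) : ℝ) • y} :=
  Equiv.ofBijective
    (fun m => ⟨((2 * l + 1 : ℕ) : ℝ) • fun i => (m i.rev : ℝ), _,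
      mem_corootLatC.mpr ⟨fun i => m i.rev, rfl⟩, rfl⟩) <| by
    have hc : ((2 * l + 1 : ℕ) : ℝ) ≠ 0 := by positivity
    constructor
    · intro m n h
      have h' := smul_right_injective (Fin l → ℝ) hc (congrArg Subtype.val h)
      ext i
      have := congrFun h' i.rev
      simpa using this
    · rintro ⟨x, y, hy, rfl⟩
      obtain ⟨m, rfl⟩ := mem_corootLatC.mp hy
      exact ⟨fun i => m i.rev, by simp⟩

lemma rhoC_apply_eq_rev (i : Fin l) : rhoC l i = ((i.rev : ℕ) : ℝ) + 1 := by
  rw [rhoC_apply, Fin.val_rev, Nat.cast_sub (by omega)]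
  push_cast
  ring

lemma rhoC_add_latticeEquiv (m : Fin l → ℤ) :
    rhoC l + (latticeEquiv l m).1 = fun i => (oddExp m i.rev : ℝ) := by
  ext i
  simp [rhoC_apply_eq_rev, latticeEquiv, oddExp]

lemma dC_latticeEquiv (m : Fin l → ℤ) : dC l (latticeEquiv l m).1 =
    polyProd (fun i => (oddExp m i : ℝ)) / polyProd fun i : Fin l => ((i : ℕ) : ℝ) + 1 := by
  have h : rhoC l = fun i : Fin l => ((i.rev : ℕ) : ℝ) + 1 := funext rhoC_apply_eq_rev
  rw [dC_eq, add_comm, rhoC_add_latticeEquiv, h]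
  exact polyProd_comp_rev_div (fun i => (oddExp m i : ℝ)) fun i => ((i : ℕ) : ℝ) + 1

lemma ip_latticeEquiv (m : Fin l → ℤ) :
    ip (rhoC l + (latticeEquiv l m).1) (rhoC l + (latticeEquiv l m).1) =
      ∑ j, (oddExp m j : ℝ) ^ 2 := by
  rw [rhoC_add_latticeEquiv, ip]
  simp only [← pow_two]
  exact Equiv.sum_comp Fin.revPerm fun i => (oddExp m i : ℝ) ^ 2

lemma polyProd_succ_ne_zero : polyProd (fun i : Fin l => ((i : ℕ) : ℝ) + 1) ≠ 0 := by
  refine mul_ne_zero (Finset.prod_ne_zero_iff.mpr fun i _ => by positivity)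
    (Finset.prod_ne_zero_iff.mpr fun i _ => Finset.prod_ne_zero_iff.mpr fun j hj => ?_)
  have hij : ((i : ℕ) : ℝ) < (j : ℕ) := by
    exact_mod_cast Finset.mem_Ioi.mp hj
  have h0 : (0 : ℝ) ≤ (i : ℕ) := by positivity
  nlinarith

end Lattice

/-- **Macdonald identity, type `BC_l^{(2)}`.** -/
theorem macdonald_BC (l : ℕ) (hl : 1 ≤ l) (q : ℝ) (hq0 : 0 < q) (hq1 : q < 1) :
    Summable (fun γ : {x : Fin l → ℝ // ∃ y ∈ corootLatC l, x = ((2 * l + 1 : ℕ) : ℝ) • y} =>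
      |dC l γ.1 * q ^ (ip (rhoC l + γ.1) (rhoC l + γ.1) / (2 * (2 * l + 1 : ℕ)))|) ∧
    (eta (q ^ ((1 : ℝ) / 2)) ^ 2 * eta q ^ (2 * (l : ℤ) - 3) * eta (q ^ 2) ^ 2) ^ l =
      ∑' γ : {x : Fin l → ℝ // ∃ y ∈ corootLatC l, x = ((2 * l + 1 : ℕ) : ℝ) • y},
        dC l γ.1 * q ^ (ip (rhoC l + γ.1) (rhoC l + γ.1) / (2 * (2 * l + 1 : ℕ))) := by
  have hp0 : 0 < q ^ ((1 : ℝ) / 2) := Real.rpow_pos_of_pos hq0 _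
  have hp1 : q ^ ((1 : ℝ) / 2) < 1 := Real.rpow_lt_one hq0.le hq1 (by norm_num)
  have hpq : (q ^ ((1 : ℝ) / 2)) ^ 2 = q := by
    rw [← Real.sqrt_eq_rpow, Real.sq_sqrt hq0.le]
  have hterm : ∀ m : Fin l → ℤ, dC l (latticeEquiv l m).1 *
      q ^ (ip (rhoC l + (latticeEquiv l m).1) (rhoC l + (latticeEquiv l m).1) /
        (2 * (2 * l + 1 : ℕ))) =
      (q ^ ((l : ℝ) * (l + 1) / 12) / polyProd fun i : Fin l => ((i : ℕ) : ℝ) + 1) *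
        (oddWeight (q ^ ((1 : ℝ) / 2)) m * polyProd fun i => (oddExp m i : ℝ)) := fun m => by
    have hc : ((2 * l + 1 : ℕ) : ℝ) = 2 * l + 1 := by push_cast; rfl
    rw [dC_latticeEquiv, ip_latticeEquiv, hc, rpow_sum_oddExp_sq hq0]
    ring
  constructor
  · rw [← (latticeEquiv l).summable_iff]
    simp only [Function.comp_def, hterm, abs_mul _ (oddWeight _ _ * _)]
    exact (summable_oddWeight_mul_polyProd hp0 hp1).mul_left _
  · rw [← (latticeEquiv l).tsum_eq]
    simp only [hterm]
    rw [tsum_mul_left, tsum_oddWeight_mul_polyProd_eq hl hp0 hp1, hpq, eta_pow_mul_eq hq0,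
      ← mul_assoc, div_mul_cancel₀ _ polyProd_succ_ne_zero]
end

section
/- (Lemma 2: counting roots of each length via Coxeter orbits.) Let R_f be a reduced irreducible finite root system of rank l with two root lengths, Π_f a set of simple roots, and let h be the Coxeter number of R_f, i.e., the order of a Coxeter element c = s_{α_l}·s_{α_{l−1}}·…·s_{α_1} of the Weyl group W(R_f). Then the number of short roots of R_f equals h·|Π_{f,s}| and the number of long roots of R_f equals h·|Π_{f,l}|, where Π_{f,s} and Π_{f,l} are the sets of short and long simple roots. -/
open scoped BigOperators Classical

/-- A reduced irreducible finite root system spanning a real vector space `V`,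
equipped with a positive definite symmetric bilinear form `I`. -/
structure RootSys (V : Type) [AddCommGroup V] [Module ℝ V] where
  I : V →ₗ[ℝ] V →ₗ[ℝ] ℝ
  symm : ∀ x y : V, I x y = I y x
  posdef : ∀ x : V, x ≠ 0 → 0 < I x x
  R : Finset V
  zero_notmem : (0 : V) ∉ R
  spanning : Submodule.span ℝ (R : Set V) = ⊤
  reduced : ∀ α ∈ R, ∀ c : ℝ, c • α ∈ R → c = 1 ∨ c = -1
  integral : ∀ α ∈ R, ∀ β ∈ R, ∃ n : ℤ, I ((2 / I α α) • α) β = (n : ℝ)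
  reflect : ∀ α ∈ R, ∀ β ∈ R, β - (I ((2 / I α α) • α) β) • α ∈ R
  irred : ∀ R₁ R₂ : Finset V, R₁ ∪ R₂ = R →
    (∀ α ∈ R₁, ∀ β ∈ R₂, I α β = 0) → R₁ = ∅ ∨ R₂ = ∅

/-- A choice of positive roots and simple roots for a finite root system. -/
structure Base {V : Type} [AddCommGroup V] [Module ℝ V] (S : RootSys V) where
  Pos : Finset V
  Pi : Finset V
  pos_sub : Pos ⊆ S.R
  mem_or_neg : ∀ α ∈ S.R, α ∈ Pos ∨ -α ∈ Pos
  not_both : ∀ α ∈ Pos, -α ∉ Pos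
  pi_sub : Pi ⊆ Pos
  indep : LinearIndependent ℝ (fun b : {x // x ∈ Pi} => (b : V))
  decomp : ∀ α ∈ Pos, ∃ c : V → ℕ, α = ∑ b ∈ Pi, (c b : ℝ) • b

variable {V : Type} [AddCommGroup V] [Module ℝ V]

namespace RootSys

variable (S : RootSys V)

/-- The orthogonal reflection in the hyperplane orthogonal to `a`. -/
noncomputable def refl (a : V) : Module.End ℝ V :=
  LinearMap.id - (2 / S.I a a) • (S.I a).smulRight a

lemma refl_apply (a x : V) : S.refl a x = x - (2 * S.I a x / S.I a a) • a := by
  simp only [refl, LinearMap.sub_apply, LinearMap.id_apply, LinearMap.smul_apply,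
    LinearMap.smulRight_apply, smul_smul]
  congr 2
  ring

lemma I_self_eq_zero {x : V} (h : S.I x x = 0) : x = 0 := by
  by_contra hx
  exact (S.posdef x hx).ne' h

lemma ne_zero_of_mem {a : V} (ha : a ∈ S.R) : a ≠ 0 :=
  fun h => S.zero_notmem (h ▸ ha)

lemma I_self_pos {a : V} (ha : a ∈ S.R) : 0 < S.I a a :=
  S.posdef a (S.ne_zero_of_mem ha)

lemma refl_self {a : V} (ha : a ∈ S.R) : S.refl a a = -a := by
  have h := (S.I_self_pos ha).ne'
  rw [S.refl_apply, mul_div_assoc, div_self h, mul_one, two_smul]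
  abel

lemma refl_of_orthogonal {a x : V} (h : S.I a x = 0) : S.refl a x = x := by
  simp [S.refl_apply, h]

lemma refl_refl {a : V} (ha : a ∈ S.R) (x : V) : S.refl a (S.refl a x) = x := by
  conv_lhs => rw [S.refl_apply a x]
  rw [map_sub, map_smul, S.refl_self ha, S.refl_apply]
  simp

lemma refl_mul_refl {a : V} (ha : a ∈ S.R) : S.refl a * S.refl a = 1 :=
  LinearMap.ext fun x => S.refl_refl ha x

lemma I_refl_refl {a : V} (ha : a ∈ S.R) (x y : V) :
    S.I (S.refl a x) (S.refl a y) = S.I x y := by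
  have h := (S.I_self_pos ha).ne'
  simp only [S.refl_apply, map_sub, map_smul, LinearMap.sub_apply, LinearMap.smul_apply,
    smul_eq_mul]
  rw [S.symm x a]
  field_simp
  ring

lemma refl_mem {a x : V} (ha : a ∈ S.R) (hx : x ∈ S.R) : S.refl a x ∈ S.R := by
  have h := S.reflect a ha x hx
  rwa [map_smul, LinearMap.smul_apply, smul_eq_mul, div_mul_eq_mul_div, ← S.refl_apply] at h

lemma neg_mem {a : V} (ha : a ∈ S.R) : -a ∈ S.R :=
  S.refl_self ha ▸ S.refl_mem ha ha

/-- The product of the reflections attached to a list of vectors. -/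
noncomputable def act (L : List V) : Module.End ℝ V := (L.map S.refl).prod

@[simp] lemma act_nil : S.act [] = 1 := rfl

@[simp] lemma act_cons (a : V) (L : List V) : S.act (a :: L) = S.refl a * S.act L := by
  simp [act]

@[simp] lemma act_append (L M : List V) : S.act (L ++ M) = S.act L * S.act M := by
  simp [act]

lemma foldl_eq_act_reverse (L : List V) (x : V) :
    L.foldl (fun y α => y - (2 * S.I α y / S.I α α) • α) x = S.act L.reverse x := by
  induction L generalizing x with
  | nil => rfl
  | cons a L ih => simp [ih, S.refl_apply]

lemma act_mul_act_reverse {L : List V} (hL : ∀ a ∈ L, a ∈ S.R) :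
    S.act L * S.act L.reverse = 1 := by
  induction L with
  | nil => simp
  | cons a L ih =>
    have h := ih fun b hb => hL b (List.mem_cons_of_mem _ hb)
    have ha := S.refl_mul_refl (hL a List.mem_cons_self)
    simp only [List.reverse_cons, act_cons, act_append, act_nil, mul_one]
    rw [mul_assoc, ← mul_assoc (S.act L), h, one_mul, ha]

lemma act_reverse_mul_act {L : List V} (hL : ∀ a ∈ L, a ∈ S.R) :
    S.act L.reverse * S.act L = 1 := by
  simpa using S.act_mul_act_reverse (L := L.reverse) (by simpa using hL)

lemma I_act_act {L : List V} (hL : ∀ a ∈ L, a ∈ S.R) (x y : V) :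
    S.I (S.act L x) (S.act L y) = S.I x y := by
  induction L with
  | nil => simp
  | cons a L ih =>
    rw [act_cons, Module.End.mul_apply, Module.End.mul_apply,
      S.I_refl_refl (hL a List.mem_cons_self), ih fun b hb => hL b (List.mem_cons_of_mem _ hb)]

lemma act_mem {L : List V} (hL : ∀ a ∈ L, a ∈ S.R) {x : V} (hx : x ∈ S.R) :
    S.act L x ∈ S.R := by
  induction L with
  | nil => simpa
  | cons a L ih =>
    exact S.refl_mem (hL a List.mem_cons_self) (ih fun b hb => hL b (List.mem_cons_of_mem _ hb))

lemma act_of_orthogonal {L : List V} {x : V} (h : ∀ a ∈ L, S.I a x = 0) : S.act L x = x := by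
  induction L with
  | nil => rfl
  | cons a L ih =>
    rw [act_cons, Module.End.mul_apply, ih fun b hb => h b (List.mem_cons_of_mem _ hb),
      S.refl_of_orthogonal (h a List.mem_cons_self)]

/-- A vector of `V` that is orthogonal to none of finitely many nonzero vectors. -/
lemma exists_forall_I_ne_zero (T : Finset V) (hT : (0 : V) ∉ T) :
    ∃ x, ∀ v ∈ T, S.I v x ≠ 0 := by
  obtain ⟨x, hx⟩ := Module.Dual.exists_forall_ne_zero_of_forall_exists
    (fun v : T => S.I (v : V)) fun v => ⟨v, fun h =>
      hT (S.I_self_eq_zero h ▸ v.2)⟩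
  exact ⟨x, fun v hv => hx ⟨v, hv⟩⟩

lemma exists_I_eq [FiniteDimensional ℝ V] (f : Module.Dual ℝ V) : ∃ x, S.I x = f := by
  have hinj : Function.Injective S.I := by
    rw [← LinearMap.ker_eq_bot, LinearMap.ker_eq_bot']
    intro x hx
    exact S.I_self_eq_zero (by rw [hx]; rfl)
  exact (LinearMap.injective_iff_surjective_of_finrank_eq_finrank
    Subspace.dual_finrank_eq.symm).1 hinj f

end RootSys

namespace Base

variable {S : RootSys V} (B : Base S)

lemma pi_sub_roots {a : V} (ha : a ∈ B.Pi) : a ∈ S.R := B.pos_sub (B.pi_sub ha)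

lemma mem_span_of_mem {x : V} (hx : x ∈ S.R) : x ∈ Submodule.span ℝ (B.Pi : Set V) := by
  have key : ∀ y ∈ B.Pos, y ∈ Submodule.span ℝ (B.Pi : Set V) := by
    intro y hy
    obtain ⟨c, rfl⟩ := B.decomp y hy
    exact Submodule.sum_mem _ fun b hb => Submodule.smul_mem _ _ (Submodule.subset_span hb)
  rcases B.mem_or_neg x hx with h | h
  · exact key x h
  · simpa using Submodule.neg_mem _ (key _ h)

lemma span_pi : Submodule.span ℝ (B.Pi : Set V) = ⊤ := by
  rw [eq_top_iff, ← S.spanning, Submodule.span_le]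
  exact fun x hx => B.mem_span_of_mem hx

lemma exists_coeff (x : V) : ∃ c : V → ℝ, x = ∑ b ∈ B.Pi, c b • b := by
  have hx : x ∈ Submodule.span ℝ (B.Pi : Set V) := by rw [B.span_pi]; trivial
  obtain ⟨c, -, hc⟩ := Submodule.mem_span_finset.1 hx
  exact ⟨c, hc.symm⟩

lemma eq_zero_of_orthogonal {x : V} (h : ∀ a ∈ B.Pi, S.I a x = 0) : x = 0 := by
  obtain ⟨c, hc⟩ := B.exists_coeff x
  apply S.I_self_eq_zero
  nth_rewrite 1 [hc]
  rw [map_sum, LinearMap.sum_apply]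
  exact Finset.sum_eq_zero fun b hb => by simp [h b hb]

variable [FiniteDimensional ℝ V]

lemma exists_weight (a : V) : ∃ w : V, ∀ b ∈ B.Pi, S.I w b = if b = a then S.I a a / 2 else 0 := by
  let e := Module.Basis.mk B.indep (by
    rw [Subtype.range_coe_subtype]
    simpa using B.span_pi.ge)
  obtain ⟨w, hw⟩ := S.exists_I_eq
    (e.constr ℝ fun b : {x // x ∈ B.Pi} => if (b : V) = a then S.I a a / 2 else 0)
  refine ⟨w, fun b hb => ?_⟩
  have h := e.constr_basis ℝ
    (fun b : {x // x ∈ B.Pi} => if (b : V) = a then S.I a a / 2 else 0) ⟨b, hb⟩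
  rw [← hw] at h
  simpa [e] using h

/-- The fundamental weight attached to a simple root. -/
noncomputable def weight (a : V) : V := (B.exists_weight a).choose

lemma I_weight {a b : V} (hb : b ∈ B.Pi) :
    S.I (B.weight a) b = if b = a then S.I a a / 2 else 0 :=
  (B.exists_weight a).choose_spec b hb

lemma I_weight_sum {a : V} (ha : a ∈ B.Pi) (c : V → ℝ) :
    S.I (B.weight a) (∑ b ∈ B.Pi, c b • b) = c a * (S.I a a / 2) := by
  rw [map_sum, Finset.sum_eq_single_of_mem a ha]
  · simp [B.I_weight ha]
  · intro b hb hba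
    simp [B.I_weight hb, hba]

lemma I_weight_nonneg {a x : V} (ha : a ∈ B.Pi) (hx : x ∈ B.Pos) : 0 ≤ S.I (B.weight a) x := by
  obtain ⟨c, rfl⟩ := B.decomp x hx
  rw [B.I_weight_sum ha fun b => (c b : ℝ)]
  have := S.I_self_pos (B.pi_sub_roots ha)
  positivity

lemma weight_injOn {a b : V} (ha : a ∈ B.Pi) (h : B.weight a = B.weight b) : a = b := by
  by_contra hab
  have h1 := B.I_weight (a := a) ha
  rw [h, B.I_weight ha, if_neg hab, if_pos rfl] at h1
  have := S.I_self_pos (B.pi_sub_roots ha)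
  linarith

lemma mem_pos_of_I_weight_pos {a x : V} (ha : a ∈ B.Pi) (hx : x ∈ S.R)
    (h : 0 < S.I (B.weight a) x) : x ∈ B.Pos := by
  refine (B.mem_or_neg x hx).resolve_right fun hn => ?_
  have := B.I_weight_nonneg ha hn
  rw [map_neg] at this
  linarith

omit [FiniteDimensional ℝ V] in
lemma neg_mem_pos {x : V} (hx : x ∈ S.R) (h : x ∉ B.Pos) : -x ∈ B.Pos :=
  (B.mem_or_neg x hx).resolve_left h

lemma refl_mem_pos {a x : V} (ha : a ∈ B.Pi) (hx : x ∈ B.Pos) (hxa : x ≠ a) :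
    S.refl a x ∈ B.Pos := by
  have haR := B.pi_sub_roots ha
  obtain ⟨b, hb, hba, hpos⟩ : ∃ b ∈ B.Pi, b ≠ a ∧ 0 < S.I (B.weight b) x := by
    by_contra! hcon
    obtain ⟨c, hc⟩ := B.decomp x hx
    have hxc : x = (c a : ℝ) • a := by
      rw [hc]
      refine Finset.sum_eq_single_of_mem a ha fun b hb hba => ?_
      have h1 := hcon b hb hba
      rw [hc, B.I_weight_sum hb fun b => (c b : ℝ)] at h1
      have h2 := S.I_self_pos (B.pi_sub_roots hb)
      have h3 : (c b : ℝ) = 0 := by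
        have : (0 : ℝ) ≤ c b := by positivity
        nlinarith
      rw [h3, zero_smul]
    rcases S.reduced a haR (c a) (hxc ▸ B.pos_sub hx) with h | h
    · exact hxa (by rw [hxc, h, one_smul])
    · have : (0 : ℝ) ≤ c a := by positivity
      linarith
  refine B.mem_pos_of_I_weight_pos hb (S.refl_mem haR (B.pos_sub hx)) ?_
  rw [S.refl_apply, map_sub, map_smul, B.I_weight ha, if_neg hba.symm]
  simpa using hpos

lemma I_nonpos_of_ne {a b : V} (ha : a ∈ B.Pi) (hb : b ∈ B.Pi) (hab : a ≠ b) :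
    S.I a b ≤ 0 := by
  have h := B.I_weight_nonneg ha (B.refl_mem_pos ha (B.pi_sub hb) hab.symm)
  have hpos := S.I_self_pos (B.pi_sub_roots ha)
  rw [S.refl_apply, map_sub, map_smul, B.I_weight ha, B.I_weight hb, if_neg hab.symm,
    if_pos rfl, smul_eq_mul] at h
  field_simp at h
  linarith

/-- A vector is dominant if it pairs nonnegatively with every simple root. -/
def Dominant (x : V) : Prop := ∀ a ∈ B.Pi, 0 ≤ S.I x a

lemma dominant_weight {a : V} : B.Dominant (B.weight a) := by
  intro b hb
  rw [B.I_weight hb]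
  split_ifs with h
  · have := S.I_self_pos (B.pi_sub_roots (h ▸ hb : a ∈ B.Pi))
    positivity
  · rfl

omit [FiniteDimensional ℝ V] in
lemma Dominant.nonneg {x b : V} (hx : B.Dominant x) (hb : b ∈ B.Pos) : 0 ≤ S.I x b := by
  obtain ⟨c, rfl⟩ := B.decomp b hb
  rw [map_sum]
  exact Finset.sum_nonneg fun a ha => by
    have := hx a ha
    simp only [map_smul, smul_eq_mul]
    positivity

/-- Words in the simple reflections. -/
def IsWord (L : List V) : Prop := ∀ a ∈ L, a ∈ B.Pi

omit [FiniteDimensional ℝ V] in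
lemma IsWord.roots {L : List V} (hL : B.IsWord L) : ∀ a ∈ L, a ∈ S.R :=
  fun a ha => B.pi_sub_roots (hL a ha)

lemma exists_deletion {L : List V} (hL : B.IsWord L) {a : V} (ha : a ∈ B.Pi)
    (h : S.act L a ∉ B.Pos) :
    ∃ M, B.IsWord M ∧ M.length < L.length ∧ S.act L * S.refl a = S.act M := by
  induction L with
  | nil => exact absurd (B.pi_sub ha) h
  | cons b L ih =>
    have hL' : B.IsWord L := fun c hc => hL c (List.mem_cons_of_mem _ hc)
    have hb : b ∈ B.Pi := hL b List.mem_cons_self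
    by_cases hp : S.act L a ∈ B.Pos
    · have hab : S.act L a = b := by
        by_contra hne
        exact h (by simpa using B.refl_mem_pos hb hp hne)
      refine ⟨L, hL', by simp, ?_⟩
      have hRa := B.pi_sub_roots ha
      ext x
      have hy : S.refl b (S.act L (S.refl a x)) = S.act L x := by
        rw [S.refl_apply b, ← hab, S.I_act_act hL'.roots, S.I_act_act hL'.roots, ← map_smul,
          ← map_sub, ← S.refl_apply, S.refl_refl hRa]
      simpa using hy
    · obtain ⟨M, hM, hlen, heq⟩ := ih hL' hp
      refine ⟨b :: M, ?_, by simpa using hlen, ?_⟩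
      · intro c hc
        rcases List.mem_cons.1 hc with rfl | hc
        · exact hb
        · exact hM c hc
      · rw [S.act_cons, mul_assoc, heq, S.act_cons]

/-- The dominant chamber is a strict fundamental domain for the Weyl group. -/
lemma act_dominant (n : ℕ) : ∀ {L : List V}, B.IsWord L → L.length = n → ∀ {x : V},
    B.Dominant x → B.Dominant (S.act L x) →
      S.act L x = x ∧ ((∀ a ∈ B.Pi, S.I x a ≠ 0) → S.act L = 1) := by
  induction n using Nat.strong_induction_on with
  | _ n ih =>
  intro L hL hn x hx hLx
  rcases List.eq_nil_or_concat L with rfl | ⟨L, a, rfl⟩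
  · exact ⟨rfl, fun _ => rfl⟩
  rw [List.concat_eq_append] at *
  have hL' : B.IsWord L := fun c hc => hL c (by simp [hc])
  have ha : a ∈ B.Pi := hL a (by simp)
  have haR := B.pi_sub_roots ha
  have hact : S.act (L ++ [a]) = S.act L * S.refl a := by simp
  by_cases h0 : S.I x a = 0
  · have hr : S.act (L ++ [a]) x = S.act L x := by
      rw [hact, Module.End.mul_apply, S.refl_of_orthogonal (by rw [S.symm, h0])]
    rw [hr] at hLx ⊢
    exact ⟨(ih L.length (by simp [← hn]) hL' rfl hx hLx).1, fun h => absurd h0 (h a ha)⟩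
  · have hneg : S.act L a ∉ B.Pos := by
      intro hp
      have h1 := Dominant.nonneg B hLx hp
      have h2 : S.act L a = -S.act (L ++ [a]) a := by
        rw [hact, Module.End.mul_apply, S.refl_self haR, map_neg, neg_neg]
      rw [h2, map_neg, S.I_act_act hL.roots] at h1
      exact h0 (le_antisymm (by linarith) (hx a ha))
    obtain ⟨M, hM, hlen, heq⟩ := B.exists_deletion hL' ha hneg
    rw [hact, heq] at hLx ⊢
    exact ih M.length (by simp at hn; omega) hM rfl hx hLx

lemma exists_act_dominant (n : ℕ) : ∀ x : V, (B.Pos.filter fun b => S.I x b < 0).card = n →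
    ∃ L, B.IsWord L ∧ B.Dominant (S.act L x) := by
  induction n using Nat.strong_induction_on with
  | _ n ih =>
  intro x hx
  by_cases hd : B.Dominant x
  · exact ⟨[], by simp [IsWord], by simpa⟩
  · obtain ⟨a, ha, hneg⟩ : ∃ a ∈ B.Pi, S.I x a < 0 := by
      simpa [Dominant] using hd
    have haR := B.pi_sub_roots ha
    have hlt : (B.Pos.filter fun b => S.I (S.refl a x) b < 0).card < n := by
      rw [← hx]
      have hsub : (B.Pos.filter fun b => S.I (S.refl a x) b < 0).image (S.refl a) ⊂
          B.Pos.filter fun b => S.I x b < 0 := by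
        have hswap : ∀ b, S.I (S.refl a x) b = S.I x (S.refl a b) := fun b => by
          rw [← S.I_refl_refl haR x, S.refl_refl haR]
        refine (Finset.ssubset_iff_of_subset ?_).2
          ⟨a, Finset.mem_filter.2 ⟨B.pi_sub ha, hneg⟩, ?_⟩
        · intro y hy
          obtain ⟨b, hb, rfl⟩ := Finset.mem_image.1 hy
          obtain ⟨hb, hlt⟩ := Finset.mem_filter.1 hb
          rw [hswap] at hlt
          refine Finset.mem_filter.2 ⟨B.refl_mem_pos ha hb ?_, hlt⟩
          rintro rfl
          rw [S.refl_self haR, map_neg] at hlt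
          linarith
        · intro hy
          obtain ⟨b, hb, hba⟩ := Finset.mem_image.1 hy
          have hb' : b = -a := by rw [← S.refl_refl haR b, hba, S.refl_self haR]
          exact B.not_both a (B.pi_sub ha) (hb' ▸ (Finset.mem_filter.1 hb).1)
      rw [← Finset.card_image_of_injective _ (Function.LeftInverse.injective (S.refl_refl haR))]
      exact Finset.card_lt_card hsub
    obtain ⟨L, hL, hdom⟩ := ih _ hlt (S.refl a x) rfl
    refine ⟨L ++ [a], ?_, by simpa using hdom⟩
    intro c hc
    rcases List.mem_append.1 hc with hc | hc
    · exact hL c hc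
    · rw [List.mem_singleton.1 hc]; exact ha

/-- A Weyl group element fixing a vector orthogonal to no root is trivial. -/
lemma act_eq_one_of_regular {L : List V} (hL : B.IsWord L) {u : V} (hu : S.act L u = u)
    (hreg : ∀ a ∈ S.R, S.I a u ≠ 0) : S.act L = 1 := by
  obtain ⟨M, hM, hdom⟩ := B.exists_act_dominant _ u rfl
  have hN : B.IsWord (M ++ L ++ M.reverse) := by
    intro c hc
    simp only [List.mem_append, List.mem_reverse] at hc
    rcases hc with (hc | hc) | hc
    exacts [hM c hc, hL c hc, hM c hc]
  have h1 := S.act_reverse_mul_act hM.roots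
  have hfix : S.act (M ++ L ++ M.reverse) (S.act M u) = S.act M u := by
    rw [← Module.End.mul_apply, S.act_append, mul_assoc, h1, mul_one, S.act_append,
      Module.End.mul_apply, hu]
  have h2 := (B.act_dominant _ hN rfl hdom (by rwa [hfix])).2 (by
    intro a ha h0
    refine hreg (S.act M.reverse a)
      (S.act_mem (by simpa using hM.roots) (B.pi_sub_roots ha)) ?_
    rw [← S.I_act_act hM.roots, ← Module.End.mul_apply, S.act_mul_act_reverse hM.roots,
      S.symm]
    exact h0)
  rw [S.act_append, S.act_append] at h2
  calc S.act L = (S.act M.reverse * S.act M) * S.act L * (S.act M.reverse * S.act M) := by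
        rw [h1, one_mul, mul_one]
    _ = S.act M.reverse * (S.act M * S.act L * S.act M.reverse) * S.act M := by
        simp only [mul_assoc]
    _ = 1 := by rw [h2, mul_one, h1]

lemma I_weight_act {L : List V} (hL : B.IsWord L) {a : V} (ha : a ∉ L) (x : V) :
    S.I (B.weight a) (S.act L x) = S.I (B.weight a) x := by
  have h : S.act L (B.weight a) = B.weight a := S.act_of_orthogonal fun b hb => by
    rw [S.symm, B.I_weight (hL b hb), if_neg (ne_of_mem_of_not_mem hb ha)]
  conv_lhs => rw [← h]
  exact S.I_act_act hL.roots _ _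

lemma eq_zero_of_I_weight {x : V} (h : ∀ a ∈ B.Pi, S.I (B.weight a) x = 0) : x = 0 := by
  obtain ⟨c, rfl⟩ := B.exists_coeff x
  refine Finset.sum_eq_zero fun a ha => ?_
  have h1 := h a ha
  have h2 := S.I_self_pos (B.pi_sub_roots ha)
  rw [B.I_weight_sum ha] at h1
  have h3 : c a = 0 := by
    rcases mul_eq_zero.1 h1 with h | h
    · exact h
    · linarith
  rw [h3, zero_smul]

lemma Dominant.coeff_nonneg {c : V → ℝ} (h : B.Dominant (∑ b ∈ B.Pi, c b • b)) {a : V}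
    (ha : a ∈ B.Pi) : 0 ≤ c a := by
  set p := ∑ b ∈ B.Pi, max (c b) 0 • b with hp
  set n := ∑ b ∈ B.Pi, max (-c b) 0 • b with hn
  have hx : ∑ b ∈ B.Pi, c b • b = p - n := by
    rw [hp, hn, ← Finset.sum_sub_distrib]
    refine Finset.sum_congr rfl fun b _ => ?_
    rw [← sub_smul]
    congr 1
    rcases le_total (c b) 0 with h | h
    · rw [max_eq_right h, max_eq_left (by linarith)]; ring
    · rw [max_eq_left h, max_eq_right (by linarith)]; ring
  rw [hx] at h
  have h1 : 0 ≤ S.I (p - n) n := by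
    nth_rewrite 2 [hn]
    rw [map_sum]
    refine Finset.sum_nonneg fun b hb => ?_
    rw [map_smul, smul_eq_mul]
    exact mul_nonneg (le_max_right _ _) (h b hb)
  have h2 : S.I p n ≤ 0 := by
    rw [hp, map_sum S.I, LinearMap.sum_apply]
    refine Finset.sum_nonpos fun b hb => ?_
    rw [hn, map_sum]
    refine Finset.sum_nonpos fun d hd => ?_
    rw [map_smul, map_smul, LinearMap.smul_apply, smul_eq_mul, smul_eq_mul, ← mul_assoc]
    by_cases hbd : b = d
    · subst hbd
      have : max (-c b) 0 * max (c b) 0 = 0 := by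
        rcases le_total (c b) 0 with h | h
        · rw [max_eq_right h, mul_zero]
        · rw [max_eq_right (a := -c b) (by linarith), zero_mul]
      rw [this, zero_mul]
    · exact mul_nonpos_of_nonneg_of_nonpos
        (mul_nonneg (le_max_right _ _) (le_max_right _ _)) (B.I_nonpos_of_ne hb hd hbd)
  have h3 : n = 0 := by
    by_contra hne
    have := S.posdef n hne
    rw [map_sub, LinearMap.sub_apply] at h1
    linarith
  have h4 := B.I_weight_sum ha fun b => max (-c b) 0
  rw [← hn, h3, map_zero] at h4
  have h5 := S.I_self_pos (B.pi_sub_roots ha)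
  have h6 : max (-c a) 0 = 0 := by
    rcases mul_eq_zero.1 h4.symm with h | h
    · exact h
    · linarith
  have := le_max_left (-c a) 0
  linarith

/-- `L` enumerates the simple roots without repetition. -/
structure IsEnum (L : List V) : Prop where
  nodup : L.Nodup
  mem_iff : ∀ a, a ∈ L ↔ a ∈ B.Pi

omit [FiniteDimensional ℝ V] in
lemma IsEnum.isWord {L : List V} (hL : B.IsEnum L) : B.IsWord L := fun a => (hL.mem_iff a).1

omit [FiniteDimensional ℝ V] in
lemma IsWord.exists_pow {L : List V} (hL : B.IsWord L) (k : ℕ) :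
    ∃ M, B.IsWord M ∧ S.act M = S.act L ^ k := by
  induction k with
  | zero => exact ⟨[], by simp [IsWord], by simp⟩
  | succ k ih =>
    obtain ⟨M, hM, h⟩ := ih
    refine ⟨M ++ L, fun a ha => ?_, by rw [S.act_append, h, pow_succ]⟩
    rcases List.mem_append.1 ha with ha | ha
    exacts [hM a ha, hL a ha]

omit [FiniteDimensional ℝ V] in
lemma IsWord.pow_mem {L : List V} (hL : B.IsWord L) (k : ℕ) {x : V} (hx : x ∈ S.R) :
    (S.act L ^ k) x ∈ S.R := by
  obtain ⟨M, hM, h⟩ := IsWord.exists_pow B hL k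
  exact h ▸ S.act_mem hM.roots hx

omit [FiniteDimensional ℝ V] in
lemma IsWord.I_pow_pow {L : List V} (hL : B.IsWord L) (k : ℕ) (x y : V) :
    S.I ((S.act L ^ k) x) ((S.act L ^ k) y) = S.I x y := by
  obtain ⟨M, hM, h⟩ := IsWord.exists_pow B hL k
  exact h ▸ S.I_act_act hM.roots x y

omit [FiniteDimensional ℝ V] in
lemma IsWord.pow_injective {L : List V} (hL : B.IsWord L) (k : ℕ) :
    Function.Injective (S.act L ^ k) := by
  intro x y hxy
  rw [← sub_eq_zero] at hxy ⊢
  rw [← map_sub] at hxy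
  apply S.I_self_eq_zero
  rw [← IsWord.I_pow_pow B hL k, hxy, map_zero]

omit [FiniteDimensional ℝ V] in
lemma IsWord.isOfFinOrder {L : List V} (hL : B.IsWord L) : IsOfFinOrder (S.act L) := by
  let f : ℕ → (S.R → S.R) := fun k x => ⟨(S.act L ^ k) x, IsWord.pow_mem B hL k x.2⟩
  obtain ⟨i, j, hne, hij⟩ := Finite.exists_ne_map_eq_of_infinite f
  wlog hlt : i < j generalizing i j
  · exact this j i hne.symm hij.symm (by omega)
  refine isOfFinOrder_iff_pow_eq_one.2 ⟨j - i, by omega, ?_⟩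
  refine LinearMap.ext_on S.spanning fun x hx => ?_
  apply IsWord.pow_injective B hL i
  rw [← Module.End.mul_apply, ← pow_add, Nat.add_sub_cancel' hlt.le]
  exact (congrArg Subtype.val (congrFun hij ⟨x, hx⟩)).symm

lemma orthogonal_of_act_eq {L : List V} (hL : B.IsWord L) (hnd : L.Nodup) {x : V}
    (h : S.act L x = x) : ∀ a ∈ L, S.I a x = 0 := by
  induction L with
  | nil => simp
  | cons b L ih =>
    have hL' : B.IsWord L := fun c hc => hL c (List.mem_cons_of_mem _ hc)
    have hb : b ∈ B.Pi := hL b List.mem_cons_self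
    have hbR := B.pi_sub_roots hb
    have hpos := S.I_self_pos hbR
    have h1 : S.act L x = S.refl b x := by
      conv_rhs => rw [← h]
      simp [S.refl_refl hbR]
    have h2 := B.I_weight_act hL' (List.nodup_cons.1 hnd).1 x
    rw [h1, S.refl_apply, map_sub, map_smul, B.I_weight hb, if_pos rfl, smul_eq_mul] at h2
    have h3 : S.I b x = 0 := by
      field_simp at h2
      linarith
    rw [S.refl_of_orthogonal h3] at h1
    intro a ha
    rcases List.mem_cons.1 ha with rfl | ha
    · exact h3
    · exact ih hL' (List.nodup_cons.1 hnd).2 h1 a ha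

/-- A Coxeter element fixes no nonzero vector. -/
lemma IsEnum.eq_zero_of_fixed {L : List V} (hL : B.IsEnum L) {x : V} (h : S.act L x = x) :
    x = 0 :=
  B.eq_zero_of_orthogonal fun a ha =>
    B.orthogonal_of_act_eq hL.isWord hL.nodup h a ((hL.mem_iff a).2 ha)

lemma IsEnum.eq_of_act_sub_eq {L : List V} (hL : B.IsEnum L) {u v x : V}
    (hu : S.act L (u - x) = u) (hv : S.act L (v - x) = v) : u = v := by
  refine sub_eq_zero.1 (hL.eq_zero_of_fixed B ?_)
  rw [← sub_sub_sub_cancel_right u v x, map_sub, hu, hv, sub_sub_sub_cancel_right]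

lemma exists_split_of_act_notMem {L : List V} (hL : B.IsWord L) {x : V} (hx : x ∈ B.Pos)
    (h : S.act L x ∉ B.Pos) : ∃ M a N, L = M ++ a :: N ∧ S.act N x = a := by
  induction L with
  | nil => exact absurd hx h
  | cons b L ih =>
    have hb : b ∈ B.Pi := hL b List.mem_cons_self
    by_cases hp : S.act L x ∈ B.Pos
    · refine ⟨[], b, L, rfl, ?_⟩
      by_contra hne
      exact h (by simpa using B.refl_mem_pos hb hp hne)
    · obtain ⟨M, a, N, rfl, hN⟩ := ih (fun c hc => hL c (List.mem_cons_of_mem _ hc)) hp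
      exact ⟨b :: M, a, N, rfl, hN⟩

lemma act_weight_sub {L M N : List V} {a x : V} (hL : B.IsWord L) (hnd : L.Nodup)
    (hs : L = M ++ a :: N) (hx : S.act N x = a) :
    S.act L (B.weight a - x) = B.weight a := by
  have hfix : ∀ K : List V, (∀ b ∈ K, b ∈ L) → a ∉ K → S.act K (B.weight a) = B.weight a :=
    fun K hK haK => S.act_of_orthogonal fun b hb => by
      rw [S.symm, B.I_weight (hL b (hK b hb)), if_neg (ne_of_mem_of_not_mem hb haK)]
  have ha : a ∈ B.Pi := hL a (by simp [hs])
  have haR := B.pi_sub_roots ha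
  have hpos := S.I_self_pos haR
  have hnd' : (a :: (M ++ N)).Nodup := List.nodup_middle.1 (hs ▸ hnd)
  have haMN : a ∉ M ∧ a ∉ N := by
    have := (List.nodup_cons.1 hnd').1
    simpa [not_or] using this
  have hw : S.refl a (B.weight a) = B.weight a - a := by
    rw [S.refl_apply, S.symm, B.I_weight ha, if_pos rfl, mul_div_cancel₀ _ two_ne_zero,
      div_self hpos.ne', one_smul]
  rw [hs, S.act_append, S.act_cons, Module.End.mul_apply, Module.End.mul_apply, map_sub, hx,
    hfix N (fun b hb => by simp [hs, hb]) haMN.2, map_sub, hw, S.refl_self haR, sub_neg_eq_add,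
    sub_add_cancel, hfix M (fun b hb => by simp [hs, hb]) haMN.1]

/-- For a Coxeter element `c` and a simple root `a`, a root `x` in the Weyl group orbit of `a`
with `x = ω - c⁻¹ ω`, where `ω` is the fundamental weight of `a`. -/
lemma IsEnum.exists_root {L : List V} (hL : B.IsEnum L) {a : V} (ha : a ∈ B.Pi) :
    ∃ x, S.act L (B.weight a - x) = B.weight a ∧ ∃ M, B.IsWord M ∧ x = S.act M a := by
  obtain ⟨M, N, hs⟩ := List.append_of_mem ((hL.mem_iff a).2 ha)
  have hN : B.IsWord N := fun b hb => hL.isWord _ b (by simp [hs, hb])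
  refine ⟨S.act N.reverse a, B.act_weight_sub hL.isWord hL.nodup hs ?_, N.reverse,
    fun b hb => hN b (List.mem_reverse.1 hb), rfl⟩
  rw [← Module.End.mul_apply, S.act_mul_act_reverse hN.roots, Module.End.one_apply]

lemma IsEnum.not_forall_pow_mem_pos {L : List V} (hL : B.IsEnum L) (x : V) :
    ¬ ∀ k, (S.act L ^ k) x ∈ B.Pos := by
  intro h
  have hn := (IsWord.isOfFinOrder B hL.isWord).orderOf_pos
  set n := orderOf (S.act L)
  have hx : x ∈ B.Pos := by simpa using h 0
  have hsum : ∑ k ∈ Finset.range n, (S.act L ^ k) x = 0 := by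
    apply hL.eq_zero_of_fixed
    have := congrArg (fun f : Module.End ℝ V => f x) (mul_geom_sum (S.act L) n)
    simp only [n, pow_orderOf_eq_one, sub_self, sub_mul, one_mul, LinearMap.sub_apply,
      Module.End.mul_apply, LinearMap.sum_apply, LinearMap.zero_apply] at this
    exact sub_eq_zero.1 this
  refine S.ne_zero_of_mem (B.pos_sub hx) (B.eq_zero_of_I_weight fun a ha => ?_)
  have h1 := congrArg (S.I (B.weight a)) hsum
  rw [map_sum, map_zero, Finset.sum_eq_zero_iff_of_nonneg
    fun k _ => B.I_weight_nonneg ha (h k)] at h1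
  simpa using h1 0 (Finset.mem_range.2 hn)

/-- Every orbit of a Coxeter element on the roots passes from positive to negative. -/
lemma IsEnum.exists_descent {L : List V} (hL : B.IsEnum L) {x : V} (hx : x ∈ S.R) :
    ∃ k, (S.act L ^ k) x ∈ B.Pos ∧ S.act L ((S.act L ^ k) x) ∉ B.Pos := by
  by_contra! hcon
  by_cases h : ∃ k, (S.act L ^ k) x ∈ B.Pos
  · obtain ⟨k, hk⟩ := h
    refine hL.not_forall_pow_mem_pos B ((S.act L ^ k) x) fun m => ?_
    induction m with
    | zero => simpa
    | succ m ih =>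
      rw [← Module.End.mul_apply, ← pow_add] at ih
      rw [pow_succ', Module.End.mul_apply, ← Module.End.mul_apply (S.act L ^ m), ← pow_add]
      exact hcon _ ih
  · push Not at h
    refine hL.not_forall_pow_mem_pos B (-x) fun m => ?_
    rw [map_neg]
    exact B.neg_mem_pos (IsWord.pow_mem B hL.isWord m hx) (h m)

lemma IsEnum.exists_pow_weight {L : List V} (hL : B.IsEnum L) {x : V} (hx : x ∈ S.R) :
    ∃ k, ∃ a ∈ B.Pi, S.act L (B.weight a - (S.act L ^ k) x) = B.weight a := by
  obtain ⟨k, h1, h2⟩ := hL.exists_descent B hx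
  obtain ⟨M, a, N, hs, hN⟩ := B.exists_split_of_act_notMem hL.isWord h1 h2
  exact ⟨k, a, hL.isWord _ a (by simp [hs]), B.act_weight_sub hL.isWord hL.nodup hs hN⟩

lemma IsEnum.eq_of_act_weight_sub {L : List V} (hL : B.IsEnum L) {a x y : V}
    (hx : S.act L (B.weight a - x) = B.weight a) (hy : S.act L (B.weight a - y) = B.weight a) :
    x = y := by
  have := IsWord.pow_injective B hL.isWord 1 (by simpa using hx.trans hy.symm)
  simpa using this

lemma IsEnum.exists_eq_pow {L : List V} (hL : B.IsEnum L) {x : V} (hx : x ∈ S.R) :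
    ∃ k, ∃ a ∈ B.Pi, ∃ y, S.act L (B.weight a - y) = B.weight a ∧ x = (S.act L ^ k) y := by
  obtain ⟨k, a, ha, h⟩ := hL.exists_pow_weight B hx
  have hn := (IsWord.isOfFinOrder B hL.isWord).orderOf_pos
  refine ⟨k * (orderOf (S.act L) - 1), a, ha, _, h, ?_⟩
  rw [← Module.End.mul_apply, ← pow_add, ← Nat.mul_succ, Nat.succ_eq_add_one,
    Nat.sub_add_cancel hn, mul_comm, pow_mul, pow_orderOf_eq_one, one_pow, Module.End.one_apply]

/-- Every root is in the Weyl group orbit of a simple root. -/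
lemma IsEnum.exists_eq_act {L : List V} (hL : B.IsEnum L) {x : V} (hx : x ∈ S.R) :
    ∃ a ∈ B.Pi, ∃ M, B.IsWord M ∧ x = S.act M a := by
  obtain ⟨k, a, ha, y, hy, rfl⟩ := hL.exists_eq_pow B hx
  obtain ⟨z, hz, M, hM, hzM⟩ := hL.exists_root B ha
  obtain ⟨K, hK, hKk⟩ := IsWord.exists_pow B hL.isWord k
  refine ⟨a, ha, K ++ M, fun b hb => ?_, ?_⟩
  · rcases List.mem_append.1 hb with hb | hb
    exacts [hK b hb, hM b hb]
  · rw [hL.eq_of_act_weight_sub B hy hz, hzM, S.act_append, hKk, Module.End.mul_apply]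

omit [FiniteDimensional ℝ V] in
lemma act_mem_span {Z : Set V} {M : List V} (hM : ∀ a ∈ M, a ∈ Z ∨ ∀ b ∈ Z, S.I a b = 0) {x : V}
    (hx : x ∈ Submodule.span ℝ Z) : S.act M x ∈ Submodule.span ℝ Z := by
  induction M with
  | nil => exact hx
  | cons a M ih =>
    have h := ih fun b hb => hM b (List.mem_cons_of_mem _ hb)
    rw [S.act_cons, Module.End.mul_apply]
    rcases hM a List.mem_cons_self with ha | ha
    · rw [S.refl_apply]
      exact Submodule.sub_mem _ h (Submodule.smul_mem _ _ (Submodule.subset_span ha))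
    · have hle : Submodule.span ℝ Z ≤ LinearMap.ker (S.I a) :=
        Submodule.span_le.2 fun b hb => ha b hb
      rwa [S.refl_of_orthogonal (hle h)]

/-- The simple roots do not split into two nonempty orthogonal subsets. -/
lemma IsEnum.pi_irreducible {L : List V} (hL : B.IsEnum L) (p : V → Prop)
    (horth : ∀ a ∈ B.Pi, ∀ b ∈ B.Pi, p a → ¬ p b → S.I a b = 0) :
    (∀ a ∈ B.Pi, p a) ∨ ∀ a ∈ B.Pi, ¬ p a := by
  set Z : Set V := {a | a ∈ B.Pi ∧ p a}
  set Z' : Set V := {a | a ∈ B.Pi ∧ ¬ p a}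
  have hunion : S.R.filter (· ∈ Submodule.span ℝ Z) ∪ S.R.filter (· ∈ Submodule.span ℝ Z') =
      S.R := by
    refine Finset.Subset.antisymm
      (Finset.union_subset (Finset.filter_subset _ _) (Finset.filter_subset _ _)) fun x hx => ?_
    obtain ⟨a, ha, M, hM, rfl⟩ := hL.exists_eq_act B hx
    by_cases hp : p a
    · refine Finset.mem_union_left _ (Finset.mem_filter.2 ⟨hx, act_mem_span (fun b hb => ?_)
        (Submodule.subset_span ⟨ha, hp⟩)⟩)
      by_cases hb' : p b
      · exact Or.inl ⟨hM b hb, hb'⟩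
      · exact Or.inr fun d hd => by rw [S.symm]; exact horth d hd.1 b (hM b hb) hd.2 hb'
    · refine Finset.mem_union_right _ (Finset.mem_filter.2 ⟨hx, act_mem_span (fun b hb => ?_)
        (Submodule.subset_span ⟨ha, hp⟩)⟩)
      by_cases hb' : p b
      · exact Or.inr fun d hd => horth b (hM b hb) d hd.1 hb' hd.2
      · exact Or.inl ⟨hM b hb, hb'⟩
  have hperp : ∀ x ∈ Submodule.span ℝ Z, ∀ y ∈ Submodule.span ℝ Z', S.I x y = 0 := by
    intro x hx y hy
    induction hx using Submodule.span_induction with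
    | mem x hx =>
      induction hy using Submodule.span_induction with
      | mem y hy => exact horth x hx.1 y hy.1 hx.2 hy.2
      | zero => simp
      | add y z _ _ h1 h2 => simp [h1, h2]
      | smul r y _ h1 => simp [h1]
    | zero => simp
    | add x z _ _ h1 h2 => simp [h1, h2]
    | smul r x _ h1 => simp [h1]
  rcases S.irred _ _ hunion fun x hx y hy =>
    hperp x (Finset.mem_filter.1 hx).2 y (Finset.mem_filter.1 hy).2 with h | h
  · refine Or.inr fun a ha hp => ?_
    have : a ∈ S.R.filter (· ∈ Submodule.span ℝ Z) :=
      Finset.mem_filter.2 ⟨B.pi_sub_roots ha, Submodule.subset_span ⟨ha, hp⟩⟩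
    simp [h] at this
  · refine Or.inl fun a ha => ?_
    by_contra hp
    have : a ∈ S.R.filter (· ∈ Submodule.span ℝ Z') :=
      Finset.mem_filter.2 ⟨B.pi_sub_roots ha, Submodule.subset_span ⟨ha, hp⟩⟩
    simp [h] at this

lemma IsEnum.I_weight_weight_pos {L : List V} (hL : B.IsEnum L) {a b : V} (ha : a ∈ B.Pi)
    (hb : b ∈ B.Pi) : 0 < S.I (B.weight a) (B.weight b) := by
  obtain ⟨c, hc⟩ := B.exists_coeff (B.weight b)
  have hdom : B.Dominant (∑ d ∈ B.Pi, c d • d) := hc ▸ B.dominant_weight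
  have hnonneg : ∀ d ∈ B.Pi, 0 ≤ c d := fun d hd => Dominant.coeff_nonneg B hdom hd
  have hposa := S.I_self_pos (B.pi_sub_roots ha)
  rw [hc, B.I_weight_sum ha]
  refine mul_pos ((hnonneg a ha).lt_of_ne' fun hca => ?_) (by positivity)
  have hall := (hL.pi_irreducible B (fun d => c d = 0) fun d hd e he hcd hce => ?_).resolve_right
    fun h => h a ha hca
  · have hw : B.weight b = 0 := by
      rw [hc]
      exact Finset.sum_eq_zero fun d hd => by rw [hall d hd, zero_smul]
    have h1 := B.I_weight (a := b) hb
    have h2 := S.I_self_pos (B.pi_sub_roots hb)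
    rw [hw, if_pos rfl] at h1
    simp only [map_zero, LinearMap.zero_apply] at h1
    linarith
  · have hterm : ∀ f ∈ B.Pi, c f * S.I f d ≤ 0 := fun f hf => by
      by_cases hfd : f = d
      · rw [hfd, hcd, zero_mul]
      · exact mul_nonpos_of_nonneg_of_nonpos (hnonneg f hf) (B.I_nonpos_of_ne hf hd hfd)
    have hsum : 0 ≤ ∑ f ∈ B.Pi, c f * S.I f d := by
      have := hdom d hd
      rw [map_sum, LinearMap.sum_apply] at this
      simpa using this
    have h0 := (Finset.sum_eq_zero_iff_of_nonpos hterm).1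
      (le_antisymm (Finset.sum_nonpos hterm) hsum) e he
    rw [S.symm]
    exact (mul_eq_zero.1 h0).resolve_left hce

/-- The powers of a Coxeter element act freely on the roots. -/
lemma IsEnum.pow_eq_one {L : List V} (hL : B.IsEnum L) {k : ℕ} {x : V} (hx : x ∈ S.R)
    (h : (S.act L ^ k) x = x) : S.act L ^ k = 1 := by
  have hn := (IsWord.isOfFinOrder B hL.isWord).orderOf_pos
  have hinj : Function.Injective (S.act L) := by
    simpa using IsWord.pow_injective B hL.isWord 1
  set n := orderOf (S.act L) with hn_def
  set g := S.act L ^ k with hg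
  have hcomm : Commute g (S.act L) := Commute.pow_self _ _
  have hgn : g ^ n = 1 := by rw [hg, ← pow_mul, mul_comm, pow_mul, pow_orderOf_eq_one, one_pow]
  set Q : Module.End ℝ V := ∑ m ∈ Finset.range n, g ^ m with hQ
  have hQcomm : ∀ m, Commute Q (S.act L ^ m) := fun m =>
    Commute.sum_left _ _ _ fun i _ => (hcomm.pow_pow i m)
  have hgQ : ∀ y, g (Q y) = Q y := fun y => by
    have := congrArg (fun f : Module.End ℝ V => f y) (mul_geom_sum g n)
    rw [hgn] at this
    rw [sub_self, sub_mul, one_mul] at this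
    exact sub_eq_zero.1 this
  have hgpow : ∀ u, g u = u → ∀ m, (g ^ m) u = u := fun u hu m => by
    induction m with
    | zero => simp
    | succ m ih => rw [pow_succ, Module.End.mul_apply, hu, ih]
  have hIQ : ∀ y u, g u = u → S.I (Q y) u = n * S.I y u := fun y u hu => by
    have hterm : ∀ m ∈ Finset.range n, S.I ((g ^ m) y) u = S.I y u := fun m _ => by
      conv_lhs => rw [← hgpow u hu m]
      rw [hg, ← pow_mul, IsWord.I_pow_pow B hL.isWord]
    rw [hQ, LinearMap.sum_apply, map_sum, LinearMap.sum_apply, Finset.sum_congr rfl hterm]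
    simp
  have hQ0 : ∀ m y, Q ((S.act L ^ m) y) = (S.act L ^ m) (Q y) := fun m y => by
    rw [← Module.End.mul_apply, (hQcomm m).eq, Module.End.mul_apply]
  obtain ⟨i, a, ha, hai⟩ := hL.exists_pow_weight B hx
  have hfixa : g (B.weight a) = B.weight a := by
    have hroot : g ((S.act L ^ i) x) = (S.act L ^ i) x := by
      rw [← Module.End.mul_apply, (hcomm.pow_right i).eq, Module.End.mul_apply, h]
    have h1 := congrArg g hai
    rw [← Module.End.mul_apply, hcomm.eq, Module.End.mul_apply, map_sub g, hroot] at h1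
    exact hL.eq_of_act_sub_eq B h1 hai
  have hne : ∀ d ∈ S.R, Q d ≠ 0 := by
    intro d hd hQd
    obtain ⟨j, b, hb, hbj⟩ := hL.exists_pow_weight B hd
    have h1 := congrArg Q hbj
    have h2 := hQ0 1 (B.weight b - (S.act L ^ j) d)
    rw [pow_one, h1, map_sub, hQ0, hQd, map_zero, sub_zero] at h2
    have h3 := hIQ (B.weight b) _ hfixa
    rw [hL.eq_zero_of_fixed B h2.symm, map_zero, LinearMap.zero_apply] at h3
    have h4 := hL.I_weight_weight_pos B hb ha
    have : (0 : ℝ) < n := by exact_mod_cast hn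
    exact (mul_pos this h4).ne h3
  obtain ⟨y, hy⟩ := S.exists_forall_I_ne_zero (S.R.image Q) (by
    intro h0
    obtain ⟨d, hd, hd0⟩ := Finset.mem_image.1 h0
    exact hne d hd hd0)
  obtain ⟨M, hM, hMg⟩ := IsWord.exists_pow B hL.isWord k
  rw [hg, ← hMg]
  refine B.act_eq_one_of_regular hM (u := Q y) (by rw [hMg]; exact hgQ y) fun d hd h0 => ?_
  have h1 := hIQ d (Q y) (hgQ y)
  rw [h0, mul_zero, S.symm, hIQ y (Q d) (hgQ d), S.symm] at h1
  have h2 : (n : ℝ) ≠ 0 := by exact_mod_cast hn.ne'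
  exact (mul_ne_zero h2 (hy _ (Finset.mem_image_of_mem Q hd))) h1

lemma IsEnum.eq_of_pow_eq_pow {L : List V} (hL : B.IsEnum L) {a b x y : V} (ha : a ∈ B.Pi)
    (hxR : x ∈ S.R) (hx : S.act L (B.weight a - x) = B.weight a)
    (hy : S.act L (B.weight b - y) = B.weight b) {i j : ℕ} (hij : i ≤ j)
    (hj : j < orderOf (S.act L)) (h : (S.act L ^ i) x = (S.act L ^ j) y) : a = b ∧ i = j := by
  set c := S.act L with hc
  have hxy : x = (c ^ (j - i)) y := by
    apply IsWord.pow_injective B hL.isWord i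
    rw [h, ← Module.End.mul_apply, ← pow_add, Nat.add_sub_cancel' hij]
  have hw : (c ^ (j - i)) (B.weight b) = B.weight a := by
    have h1 := congrArg (c ^ (j - i)) hy
    rw [← Module.End.mul_apply, ← pow_succ, pow_succ', Module.End.mul_apply, map_sub (c ^ (j - i)),
      ← hxy] at h1
    exact hL.eq_of_act_sub_eq B h1 hx
  have hab : a = b := by
    obtain ⟨M, hM, hMc⟩ := IsWord.exists_pow B hL.isWord (j - i)
    refine B.weight_injOn ha ?_
    have := (B.act_dominant _ hM rfl (B.dominant_weight (a := b)) (by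
      rw [hMc, hw]; exact B.dominant_weight)).1
    rw [hMc, hw] at this
    exact this
  refine ⟨hab, ?_⟩
  subst hab
  rw [← hL.eq_of_act_weight_sub B hx hy] at hxy
  have h1 := hL.pow_eq_one B hxR hxy.symm
  have h2 := Nat.eq_zero_of_dvd_of_lt (orderOf_dvd_of_pow_eq_one h1) (by rw [← hc]; omega)
  omega

/-- The number of roots of a given length is the Coxeter number times the number of simple roots
of that length. -/
theorem IsEnum.card_filter_length {L : List V} (hL : B.IsEnum L) (t : ℝ) :
    (S.R.filter fun x => S.I x x = t).card =
      orderOf (S.act L) * (B.Pi.filter fun x => S.I x x = t).card := by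
  choose! γ hγ M hM hγM using fun a ha => hL.exists_root B (a := a) ha
  have hγR : ∀ a ∈ B.Pi, γ a ∈ S.R := fun a ha =>
    hγM a ha ▸ S.act_mem (hM a ha).roots (B.pi_sub_roots ha)
  have hγI : ∀ a ∈ B.Pi, S.I (γ a) (γ a) = S.I a a := fun a ha => by
    rw [hγM a ha, S.I_act_act (hM a ha).roots]
  have hn := (IsWord.isOfFinOrder B hL.isWord).orderOf_pos
  rw [← Finset.card_range (orderOf (S.act L)), ← Finset.card_product]
  refine (Finset.card_nbij (fun q : ℕ × V => (S.act L ^ q.1) (γ q.2)) ?_ ?_ ?_).symm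
  · rintro ⟨k, a⟩ hq
    obtain ⟨-, ha⟩ := Finset.mem_product.1 hq
    obtain ⟨ha, hat⟩ := Finset.mem_filter.1 ha
    exact Finset.mem_filter.2 ⟨IsWord.pow_mem B hL.isWord k (hγR a ha), by
      rw [IsWord.I_pow_pow B hL.isWord, hγI a ha, hat]⟩
  · rintro ⟨i, a⟩ hi ⟨j, b⟩ hj hij
    obtain ⟨hi, ha⟩ := Finset.mem_product.1 hi
    obtain ⟨hj, hb⟩ := Finset.mem_product.1 hj
    have ha := (Finset.mem_filter.1 ha).1
    have hb := (Finset.mem_filter.1 hb).1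
    have hi := Finset.mem_range.1 hi
    have hj := Finset.mem_range.1 hj
    rcases le_total i j with h | h
    · obtain ⟨h1, h2⟩ := hL.eq_of_pow_eq_pow B ha (hγR a ha) (hγ a ha) (hγ b hb) h hj hij
      exact Prod.ext h2 h1
    · obtain ⟨h1, h2⟩ := hL.eq_of_pow_eq_pow B hb (hγR b hb) (hγ b hb) (hγ a ha) h hi hij.symm
      exact Prod.ext h2.symm h1.symm
  · intro x hx
    obtain ⟨hx, hxt⟩ := Finset.mem_filter.1 hx
    obtain ⟨k, a, ha, y, hy, rfl⟩ := hL.exists_eq_pow B hx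
    rw [hL.eq_of_act_weight_sub B hy (hγ a ha)] at hxt ⊢
    rw [IsWord.I_pow_pow B hL.isWord, hγI a ha] at hxt
    refine ⟨(k % orderOf (S.act L), a), Finset.mem_product.2
      ⟨Finset.mem_range.2 (Nat.mod_lt _ hn), Finset.mem_filter.2 ⟨ha, hxt⟩⟩, ?_⟩
    simp only [pow_mod_orderOf]

end Base

/-- **Lemma 2: counting roots of each length via Coxeter orbits.**
If `R_f` has two root lengths `a < b` and `h` is the order of a Coxeter element
`c = s_{α_l} ⋯ s_{α_1}` of the Weyl group, then the number of short roots is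
`h·|Π_{f,s}|` and the number of long roots is `h·|Π_{f,l}|`. -/
theorem coxeter_orbit_count (V : Type) [AddCommGroup V] [Module ℝ V]
    [FiniteDimensional ℝ V]
    (S : RootSys V) (B : Base S)
    -- two root lengths a < b
    (a b : ℝ) (hab : a < b)
    (hlen : ∀ α ∈ S.R, S.I α α = a ∨ S.I α α = b)
    (hs : ∃ α ∈ S.R, S.I α α = a) (hl : ∃ α ∈ S.R, S.I α α = b)
    -- a Coxeter element c = s_{α_l} ⋯ s_{α_1}, an enumeration α_1, …, α_l of Π_f
    (cx : V ≃ₗ[ℝ] V) (lst : List V) (hnd : lst.Nodup) (hset : lst.toFinset = B.Pi)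
    (hcx : ∀ x : V, cx x = lst.foldl (fun y α => y - (2 * S.I α y / S.I α α) • α) x)
    -- the Coxeter number h: the order of the Coxeter element c
    (h : ℕ) (hh : h = orderOf cx) :
    (S.R.filter (fun α => S.I α α = a)).card =
        h * (B.Pi.filter (fun α => S.I α α = a)).card ∧
    (S.R.filter (fun α => S.I α α = b)).card =
        h * (B.Pi.filter (fun α => S.I α α = b)).card := by
  have hL : B.IsEnum lst.reverse :=
    ⟨List.nodup_reverse.2 hnd, fun x => by rw [← hset]; simp⟩
  have hact : (cx : V →ₗ[ℝ] V) = S.act lst.reverse :=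
    LinearMap.ext fun x => by rw [← S.foldl_eq_act_reverse]; exact hcx x
  have hord : h = orderOf (S.act lst.reverse) := by
    rw [hh, ← hact]
    exact (orderOf_injective (LinearEquiv.automorphismGroup.toLinearMapMonoidHom (R := ℝ) (M := V))
      LinearEquiv.toLinearMap_injective cx).symm
  rw [hord]
  exact ⟨hL.card_filter_length B a, hL.card_filter_length B b⟩
end
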